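/- Let J be a Jordan algebra of compact operators on a complex Banach space X (a linear subspace of B(X), closed under the Jordan product {A,B} = AB + BA, all of whose elements are compact), and let T be a nonzero element of J. If every element of J has T-stable spectrum, then J is reducible: there exists a closed subspace M of X with M ≠ {0} and M ≠ X such that A(M) ⊆ M for every A ∈ J. -/

import Mathlib

section

open Set Filter Topology Metric NormedSpace

section CompactSpectrum

variable {X : Type*} [NormedAddCommGroup X] [NormedSpace ℂ X]

/-- A compact operator has only finitely many eigenvalues outside a disc around zero. -/
theorem IsCompactOperator.finite_eigenvalues {K : X →L[ℂ] X} (hK : IsCompactOperator K)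
    {ε : ℝ} (hε : 0 < ε) :
    {z : ℂ | ε ≤ ‖z‖ ∧ Module.End.HasEigenvalue (K : Module.End ℂ X) z}.Finite := by
  by_contra hinf
  have hinf : {z : ℂ | ε ≤ ‖z‖ ∧ Module.End.HasEigenvalue (K : Module.End ℂ X) z}.Infinite := hinf
  set μ := hinf.natEmbedding with hμ
  have hvec : ∀ n, ∃ v, Module.End.HasEigenvector (K : Module.End ℂ X) (μ n : ℂ) v := fun n =>
    (μ n).2.2.exists_hasEigenvector
  choose e he using hvec
  have hli : LinearIndependent ℂ e :=
    Module.End.eigenvectors_linearIndependent' _ (fun n => (μ n : ℂ))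
      (fun a b h => μ.injective (Subtype.ext h)) e he
  set F : ℕ → Submodule ℂ X := fun n => Submodule.span ℂ (e '' Set.Iio n) with hF
  have hFfin : ∀ n, FiniteDimensional ℂ (F n) := fun n =>
    FiniteDimensional.span_of_finite ℂ ((Set.finite_Iio n).image e)
  have hFmono : Monotone F := fun m n hmn =>
    Submodule.span_mono (Set.image_mono (Set.Iio_subset_Iio hmn))
  have heF : ∀ n, e n ∈ F (n + 1) := fun n =>
    Submodule.subset_span ⟨n, by simp, rfl⟩
  have henF : ∀ n, e n ∉ F n := fun n => hli.notMem_span_image (by simp)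
  have hKe : ∀ n, K (e n) = (μ n : ℂ) • e n := fun n => (he n).apply_eq_smul
  have hKF : ∀ n, ∀ x ∈ F n, K x ∈ F n := by
    intro n x hx
    induction hx using Submodule.span_induction with
    | mem x h =>
      obtain ⟨i, hi, rfl⟩ := h
      rw [hKe]
      exact Submodule.smul_mem _ _ (Submodule.subset_span ⟨i, hi, rfl⟩)
    | zero => simp
    | add x y _ _ hx hy => rw [map_add]; exact add_mem hx hy
    | smul a x _ hx => rw [map_smul]; exact Submodule.smul_mem _ _ hx
  have hKsub : ∀ n, ∀ x ∈ F (n + 1), K x - (μ n : ℂ) • x ∈ F n := by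
    intro n x hx
    induction hx using Submodule.span_induction with
    | mem x h =>
      obtain ⟨i, hi, rfl⟩ := h
      rcases Nat.lt_succ_iff_lt_or_eq.1 hi with h | rfl
      · have : e i ∈ F n := Submodule.subset_span ⟨i, h, rfl⟩
        exact sub_mem (hKF n _ this) (Submodule.smul_mem _ _ this)
      · simp [hKe]
    | zero => simp
    | add x y _ _ hx hy =>
      rw [map_add, smul_add, add_sub_add_comm]; exact add_mem hx hy
    | smul a x _ hx =>
      rw [map_smul, smul_comm, ← smul_sub]; exact Submodule.smul_mem _ _ hx
  have hy : ∀ n, ∃ y ∈ F (n + 1), ‖y‖ = 1 ∧ ∀ x ∈ F n, 1 / 2 ≤ ‖y - x‖ := by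
    intro n
    have hcl : IsClosed ((F n).comap (F (n + 1)).subtype : Set (F (n + 1))) :=
      (F n).closed_of_finiteDimensional.preimage continuous_subtype_val
    obtain ⟨x₀, hx₀, h⟩ := riesz_lemma hcl ⟨⟨e n, heF n⟩, by simpa using henF n⟩
      (r := 1 / 2) (by norm_num)
    have hx0 : x₀ ≠ 0 := by rintro rfl; exact hx₀ (zero_mem _)
    have hn : 0 < ‖(x₀ : X)‖ := by simpa using hx0
    refine ⟨((‖(x₀ : X)‖⁻¹ : ℝ) : ℂ) • (x₀ : X), Submodule.smul_mem _ _ x₀.2, ?_, ?_⟩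
    · rw [norm_smul]; simp [hn.ne']
    · intro x hx
      have := h ⟨((‖(x₀ : X)‖ : ℝ) : ℂ) • x,
        Submodule.smul_mem _ _ (hFmono (Nat.le_succ n) hx)⟩ (Submodule.smul_mem _ _ hx)
      have h2 : ((‖(x₀ : X)‖⁻¹ : ℝ) : ℂ) • (x₀ : X) - x
          = ((‖(x₀ : X)‖⁻¹ : ℝ) : ℂ) • ((x₀ : X) - ((‖(x₀ : X)‖ : ℝ) : ℂ) • x) := by
        rw [smul_sub, smul_smul, ← Complex.ofReal_mul, inv_mul_cancel₀ hn.ne']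
        simp
      rw [h2, norm_smul]
      change 1 / 2 * ‖(x₀ : X)‖ ≤ ‖(x₀ : X) - ((‖(x₀ : X)‖ : ℝ) : ℂ) • x‖ at this
      rw [Complex.norm_real, norm_inv, norm_norm, inv_mul_eq_div, le_div_iff₀ hn]
      exact this
  choose y hyF hy1 hyd using hy
  have hsep : ∀ m n, m < n → ε / 2 ≤ ‖K (y n) - K (y m)‖ := by
    intro m n hmn
    have hμ0 : (μ n : ℂ) ≠ 0 := by
      intro h; have := (μ n).2.1; rw [h] at this; simp at this; linarith
    have hmem : K (y n) - (μ n : ℂ) • y n - K (y m) ∈ F n :=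
      sub_mem (hKsub n _ (hyF n)) (hFmono hmn (hKF _ _ (hyF m)))
    have h2 := hyd n _ (Submodule.smul_mem _ (-(μ n : ℂ)⁻¹) hmem)
    have h3 : K (y n) - K (y m) = (μ n : ℂ) •
        (y n - (-(μ n : ℂ)⁻¹) • (K (y n) - (μ n : ℂ) • y n - K (y m))) := by
      rw [smul_sub, smul_smul]
      simp only [mul_neg, mul_inv_cancel₀ hμ0, neg_smul, one_smul]
      abel
    rw [h3, norm_smul]
    have := (μ n).2.1
    nlinarith [norm_nonneg (μ n : ℂ)]
  have hcomp := hK.isCompact_closure_image_closedBall 1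
  obtain ⟨a, -, φ, hφ, hlim⟩ := hcomp.tendsto_subseq (x := fun n => K (y n))
    (fun n => subset_closure ⟨y n, by simp [hy1], rfl⟩)
  have hc := hlim.cauchySeq
  rw [Metric.cauchySeq_iff'] at hc
  obtain ⟨N, hN⟩ := hc (ε / 2) (by linarith)
  have := hN (N + 1) (by simp)
  rw [dist_eq_norm] at this
  exact absurd (hsep _ _ (hφ (Nat.lt_succ_self N))) (not_le.2 this)

variable [CompleteSpace X]

theorem IsCompactOperator.countable_spectrum {K : X →L[ℂ] X} (hK : IsCompactOperator K) :
    (spectrum ℂ K).Countable := by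
  have : spectrum ℂ K ⊆ {0} ∪ ⋃ n : ℕ,
      {z : ℂ | 1 / ((n : ℝ) + 1) ≤ ‖z‖ ∧ Module.End.HasEigenvalue (K : Module.End ℂ X) z} := by
    intro z hz
    by_cases h0 : z = 0
    · left; exact h0
    · right
      obtain ⟨n, hn⟩ := exists_nat_one_div_lt (norm_pos_iff.2 h0)
      exact mem_iUnion.2 ⟨n, hn.le, (hK.hasEigenvalue_iff_mem_spectrum h0).2 hz⟩
  refine Countable.mono this ((countable_singleton _).union (countable_iUnion fun n => ?_))
  exact (hK.finite_eigenvalues (by positivity)).countable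

theorem countable_spectrum_one_add {K : X →L[ℂ] X} (hK : IsCompactOperator K) :
    (spectrum ℂ (1 + K)).Countable := by
  have h := hK.countable_spectrum.image (fun z : ℂ => 1 + z)
  have hsub : spectrum ℂ (1 + K) ⊆ (fun z : ℂ => 1 + z) '' spectrum ℂ K := by
    intro z hz
    exact ⟨z - 1, by
      rw [spectrum.mem_iff] at hz ⊢
      convert hz using 2
      simp only [map_sub, map_one]; abel, by ring⟩
  exact h.mono hsub

end CompactSpectrum

theorem Set.Countable.exists_sphere_disjoint {S : Set ℂ} (hS : S.Countable) (a : ℂ) {s r : ℝ}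
    (hr : s < r) : ∃ t, s < t ∧ t < r ∧ ∀ z ∈ S, dist z a ≠ t := by
  have h : ¬ Ioo s r ⊆ (fun z => dist z a) '' S := fun h => by
    have := (hS.image (fun z => dist z a)).mono h
    have h2 := Cardinal.mk_Ioo_real hr
    rw [← Cardinal.le_aleph0_iff_set_countable, h2] at this
    exact absurd this (not_le.2 Cardinal.aleph0_lt_continuum)
  obtain ⟨t, ht, hn⟩ := Set.not_subset.1 h
  exact ⟨t, ht.1, ht.2, fun z hz hzt => hn ⟨z, hz, hzt⟩⟩

theorem Set.Countable.isPreconnected_compl {S : Set ℂ} (hS : S.Countable) :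
    IsPreconnected Sᶜ :=
  (hS.isConnected_compl_of_one_lt_rank (by rw [Complex.rank_real_complex]; norm_num)).isPreconnected

section BanachAlgebra

variable {A : Type*} [NormedRing A] [NormedAlgebra ℂ A]

/-- An element is quasinilpotent when its spectrum is contained in `{0}`. -/
def IsQuasinilpotent (a : A) : Prop := ∀ z : ℂ, IsUnit (1 + z • a)

theorem isQuasinilpotent_iff_spectrum_subset {a : A} :
    IsQuasinilpotent a ↔ ∀ z ∈ spectrum ℂ a, z = 0 := by
  constructor
  · intro h z hz
    by_contra h0
    apply hz
    have h1 := (h (-z⁻¹)).smul (Units.mk0 z h0)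
    have h2 : Units.mk0 z h0 • (1 + -z⁻¹ • a) = algebraMap ℂ A z - a := by
      rw [Units.smul_def, Units.val_mk0, smul_add, smul_smul, Algebra.algebraMap_eq_smul_one]
      simp [h0, sub_eq_add_neg]
    rwa [h2] at h1
  · intro h z
    by_cases h0 : z = 0
    · simp [h0]
    · have h1 : -z⁻¹ ∉ spectrum ℂ a := fun hm => by
        have := h _ hm; simp [h0] at this
      have h1 := (spectrum.notMem_iff.1 h1).smul (Units.mk0 (-z) (neg_ne_zero.2 h0))
      have h2 : Units.mk0 (-z) (neg_ne_zero.2 h0) • (algebraMap ℂ A (-z⁻¹) - a) = 1 + z • a := by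
        rw [Units.smul_def, Units.val_mk0, smul_sub, Algebra.algebraMap_eq_smul_one, smul_smul]
        simp [h0]
      rwa [h2] at h1

theorem IsQuasinilpotent.zero : IsQuasinilpotent (0 : A) := fun z => by simp

theorem IsQuasinilpotent.smul {a : A} (h : IsQuasinilpotent a) (c : ℂ) :
    IsQuasinilpotent (c • a) := fun z => by
  rw [smul_smul]; exact h _

theorem IsNilpotent.isQuasinilpotent {a : A} (h : IsNilpotent a) : IsQuasinilpotent a := by
  intro z
  have : IsNilpotent (z • a) := h.smul z
  exact this.isUnit_one_add

theorem isUnit_one_add_mul_comm {R : Type*} [Ring R] {a b : R} (h : IsUnit (1 + a * b)) :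
    IsUnit (1 + b * a) := by
  obtain ⟨u, hu⟩ := h
  have h1 : (1 + a * b) * (↑u⁻¹ : R) = 1 := by rw [← hu]; simp
  have h2 : (↑u⁻¹ : R) * (1 + a * b) = 1 := by rw [← hu]; simp
  refine ⟨⟨1 + b * a, 1 - b * ↑u⁻¹ * a, ?_, ?_⟩, rfl⟩
  · have : (1 + b * a) * (1 - b * ↑u⁻¹ * a)
        = 1 + b * a - b * ((1 + a * b) * ↑u⁻¹) * a := by noncomm_ring
    rw [this, h1]; noncomm_ring
  · have : (1 - b * ↑u⁻¹ * a) * (1 + b * a)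
        = 1 + b * a - b * (↑u⁻¹ * (1 + a * b)) * a := by noncomm_ring
    rw [this, h2]; noncomm_ring

theorem IsQuasinilpotent.mul_comm {a b : A} (h : IsQuasinilpotent (a * b)) :
    IsQuasinilpotent (b * a) := fun z => by
  have := isUnit_one_add_mul_comm (a := z • a) (b := b) (by simpa using h z)
  simpa using this

/-- The norm of an inverse stays bounded in the closed disc if it is bounded on the circle. -/
theorem isUnit_of_tendsto_of_no_spectrum [CompleteSpace A] {ι : Type*} {l : Filter ι} {u : ι → A}
    {a : A} (hu : Tendsto u l (𝓝 a)) {c : ℂ} {t : ℝ} (ht : 0 < t)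
    (hs : ∀ z ∈ sphere c t, z ∉ spectrum ℂ a)
    (hfr : ∃ᶠ n in l, ∀ z ∈ closedBall c t, z ∉ spectrum ℂ (u n)) : c ∉ spectrum ℂ a := by
  set g : A → ℂ → A := fun b z => Ring.inverse (algebraMap ℂ A z - b) with hg
  have hcont : ∀ b z, z ∉ spectrum ℂ b →
      ContinuousAt (fun p : A × ℂ => Ring.inverse (algebraMap ℂ A p.2 - p.1)) (b, z) := by
    intro b z hz
    obtain ⟨w, hw⟩ := spectrum.notMem_iff.1 hz
    have h1 := NormedRing.inverse_continuousAt w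
    rw [hw] at h1
    exact ContinuousAt.comp (f := fun p : A × ℂ => algebraMap ℂ A p.2 - p.1) (x := (b, z)) h1
      (by fun_prop)
  obtain ⟨C, hC⟩ : ∃ C, ∀ z ∈ sphere c t, ‖g a z‖ ≤ C := by
    have : ContinuousOn (g a) (sphere c t) := fun z hz => by
      have := (hcont a z (hs z hz)).comp (f := fun z : ℂ => (a, z)) (x := z) (by fun_prop)
      exact this.continuousWithinAt
    exact (isCompact_sphere c t).exists_bound_of_continuousOn this
  have hev : ∀ᶠ b in 𝓝 a, ∀ z ∈ sphere c t, ‖g b z‖ < C + 1 := by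
    refine (isCompact_sphere c t).eventually_forall_of_forall_eventually fun z hz => ?_
    have := (hcont a z (hs z hz)).norm
    exact this.eventually_lt continuousAt_const
      (show ‖g a z‖ < C + 1 from lt_of_le_of_lt (hC z hz) (lt_add_one C))
  have hC0 : 0 < C + 1 := by
    have := (norm_nonneg _).trans (hC (c + t) (by simp [ht.le]))
    linarith
  have hclose : ∀ᶠ b in 𝓝 a, ‖b - a‖ < (C + 1)⁻¹ := by
    have : Tendsto (fun b => ‖b - a‖) (𝓝 a) (𝓝 ‖a - a‖) := by
      apply Continuous.tendsto; fun_prop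
    rw [sub_self, norm_zero] at this
    exact this.eventually_lt tendsto_const_nhds (inv_pos.2 hC0)
  obtain ⟨n, hn, hb, hcl⟩ := (hfr.and_eventually ((hu.eventually hev).and
    (hu.eventually hclose))).exists
  set b := u n
  have hdiff : DifferentiableOn ℂ (g b) (closedBall c t) := fun z hz => by
    obtain ⟨w, hw⟩ := spectrum.notMem_iff.1 (hn z hz)
    have h1 := hasFDerivAt_ringInverse (𝕜 := ℂ) w
    rw [hw] at h1
    exact (DifferentiableAt.comp z (f := fun z => algebraMap ℂ A z - b) h1.differentiableAt
      (by simp only [Algebra.algebraMap_eq_smul_one]; fun_prop)).differentiableWithinAt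
  have hmax : ‖g b c‖ ≤ C + 1 := by
    refine Complex.norm_le_of_forall_mem_frontier_norm_le (U := ball c t) isBounded_ball
      (f := g b) ?_ ?_ (subset_closure (mem_ball_self ht))
    · exact hdiff.diffContOnCl_ball subset_rfl
    · intro z hz
      rw [frontier_ball c ht.ne'] at hz
      exact (hb z hz).le
  obtain ⟨w, hw⟩ := spectrum.notMem_iff.1 (hn c (mem_closedBall_self ht.le))
  have hwinv : (↑w⁻¹ : A) = g b c := by
    simp only [hg]; rw [← hw, Ring.inverse_unit]
  rcases subsingleton_or_nontrivial A with hA | hA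
  · rw [spectrum.of_subsingleton]; simp
  rw [spectrum.notMem_iff]
  have hwpos : 0 < ‖(↑w⁻¹ : A)‖ := Units.norm_pos _
  have : ‖(algebraMap ℂ A c - a) - w‖ < ‖(↑w⁻¹ : A)‖⁻¹ := by
    rw [hw, show algebraMap ℂ A c - a - (algebraMap ℂ A c - b) = b - a by abel]
    refine hcl.trans_le ?_
    rw [hwinv] at hwpos ⊢
    exact inv_anti₀ hwpos hmax
  exact ⟨Units.ofNearby w _ this, rfl⟩

theorem eventually_exists_mem_spectrum [CompleteSpace A] {ι : Type*} {l : Filter ι} {u : ι → A}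
    {a : A} (hu : Tendsto u l (𝓝 a)) (hc : (spectrum ℂ a).Countable) {c : ℂ}
    (hca : c ∈ spectrum ℂ a) {r : ℝ} (hr : 0 < r) :
    ∀ᶠ n in l, ∃ z ∈ spectrum ℂ (u n), dist z c < r := by
  obtain ⟨t, ht0, htr, ht⟩ := hc.exists_sphere_disjoint c hr
  by_contra h
  refine isUnit_of_tendsto_of_no_spectrum hu ht0 (fun z hz hza => ht z hza hz) ?_ hca
  refine (not_eventually.1 h).mono fun n hn z hz hzs => hn ⟨z, hzs, ?_⟩
  exact lt_of_le_of_lt (mem_closedBall.1 hz) htr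

theorem isQuasinilpotent_of_tendsto' [CompleteSpace A] {ι : Type*} {l : Filter ι} [l.NeBot]
    {u : ι → A} {a : A} (hu : Tendsto u l (𝓝 a)) (hc : (spectrum ℂ a).Countable)
    (h : ∀ ε > 0, ∀ᶠ n in l, ∀ z ∈ spectrum ℂ (u n), ‖z‖ < ε) : IsQuasinilpotent a := by
  rw [isQuasinilpotent_iff_spectrum_subset]
  intro z hz
  by_contra h0
  have hz0 := norm_pos_iff.2 h0
  obtain ⟨n, ⟨w, hw, hwz⟩, hn⟩ := ((eventually_exists_mem_spectrum hu hc hz (half_pos hz0)).and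
    (h (‖z‖ / 2) (half_pos hz0))).exists
  have h1 := hn w hw
  have h2 : ‖z‖ ≤ ‖w‖ + dist w z := by
    rw [dist_comm, dist_eq_norm]; simpa using norm_add_le w (z - w)
  linarith

theorem isQuasinilpotent_of_tendsto [CompleteSpace A] {ι : Type*} {l : Filter ι} [l.NeBot]
    {u : ι → A} {a : A} (hu : Tendsto u l (𝓝 a)) (hc : (spectrum ℂ a).Countable)
    (h : ∀ᶠ n in l, IsQuasinilpotent (u n)) : IsQuasinilpotent a :=
  isQuasinilpotent_of_tendsto' hu hc fun ε hε => h.mono fun n hn z hz => by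
    rw [isQuasinilpotent_iff_spectrum_subset.1 hn z hz]; simpa using hε

/-- Geometric decay of the powers of a quasinilpotent element. -/
theorem IsQuasinilpotent.eventually_pow_norm_lt [CompleteSpace A] {a : A}
    (h : IsQuasinilpotent a) {ε : ℝ} (hε : 0 < ε) : ∀ᶠ n : ℕ in atTop, ‖a ^ n‖ < ε ^ n := by
  have h0 : spectralRadius ℂ a = 0 := by
    rw [isQuasinilpotent_iff_spectrum_subset] at h
    simp only [spectralRadius, ENNReal.iSup_eq_zero]
    intro z hz; simp [h z hz]
  have h1 := spectrum.pow_norm_pow_one_div_tendsto_nhds_spectralRadius a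
  rw [h0] at h1
  have h2 := (h1.eventually_lt_const (ENNReal.ofReal_pos.2 hε))
  filter_upwards [h2, eventually_gt_atTop 0] with n hn hn0
  rw [ENNReal.ofReal_lt_ofReal_iff hε] at hn
  have := pow_lt_pow_left₀ hn (by positivity) hn0.ne'
  rwa [← Real.rpow_natCast, ← Real.rpow_mul (norm_nonneg _), one_div,
    inv_mul_cancel₀ (by exact_mod_cast hn0.ne'), Real.rpow_one] at this

theorem IsQuasinilpotent.exists_pow_norm_le [CompleteSpace A] {a : A}
    (h : IsQuasinilpotent a) {ε : ℝ} (hε : 0 < ε) : ∃ C > 0, ∀ n : ℕ, ‖a ^ n‖ ≤ C * ε ^ n := by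
  obtain ⟨N, hN⟩ := eventually_atTop.1 (h.eventually_pow_norm_lt hε)
  refine ⟨1 + ∑ n ∈ Finset.range N, ‖a ^ n‖ / ε ^ n, by positivity, fun n => ?_⟩
  have hp : 0 < ε ^ n := by positivity
  rcases le_or_gt N n with hn | hn
  · have h1 := (hN n hn).le
    have h2 : 0 ≤ ∑ n ∈ Finset.range N, ‖a ^ n‖ / ε ^ n := by positivity
    nlinarith
  · have h1 := Finset.single_le_sum (f := fun n => ‖a ^ n‖ / ε ^ n) (s := Finset.range N)
      (fun i _ => by positivity) (Finset.mem_range.2 hn)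
    rw [div_le_iff₀ hp] at h1
    nlinarith

end BanachAlgebra

section QuasinilpotentContinuation

variable {A : Type*} [NormedRing A] [NormOneClass A] [NormedAlgebra ℂ A] [CompleteSpace A]

theorem exists_uniform_pow_norm_le {Y : Type*} [TopologicalSpace Y] {K : Set Y} (hK : IsCompact K)
    {f : Y → A} (hf : ContinuousOn f K) (hq : ∀ z ∈ K, IsQuasinilpotent (f z)) {ε : ℝ}
    (hε : 0 < ε) : ∃ N : ℕ, 0 < N ∧ ∀ z ∈ K, ‖f z ^ N‖ ≤ ε ^ N := by
  have key : ∀ S : Set Y, ∀ n m : ℕ, (∀ z ∈ S, ‖f z ^ n‖ ≤ ε ^ n) →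
      ∀ z ∈ S, ‖f z ^ (n * m)‖ ≤ ε ^ (n * m) := fun S n m h z hz => by
    rw [pow_mul, pow_mul]
    exact (norm_pow_le _ _).trans (pow_le_pow_left₀ (norm_nonneg _) (h z hz) m)
  refine hK.induction_on (p := fun S => ∃ N : ℕ, 0 < N ∧ ∀ z ∈ S, ‖f z ^ N‖ ≤ ε ^ N)
    ⟨1, one_pos, by simp⟩ ?_ ?_ ?_
  · rintro s t hst ⟨N, hN, h⟩
    exact ⟨N, hN, fun z hz => h z (hst hz)⟩
  · rintro s t ⟨N, hN, h⟩ ⟨M, hM, h'⟩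
    refine ⟨N * M, Nat.mul_pos hN hM, ?_⟩
    rintro z (hz | hz)
    · exact key s N M h z hz
    · rw [Nat.mul_comm]; exact key t M N h' z hz
  · intro z hz
    obtain ⟨n, hn, hn0⟩ := (((hq z hz).eventually_pow_norm_lt hε).and
      (eventually_gt_atTop 0)).exists
    have h1 := ((hf z hz).pow n).norm.eventually_lt
      (continuousWithinAt_const (b := ε ^ n)) hn
    exact ⟨_, h1, n, hn0, fun w hw => le_of_lt hw⟩

theorem isQuasinilpotent_of_mem_ball {f : ℂ → A} {c : ℂ} {R s : ℝ} (hs : 0 < s)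
    (hf : DifferentiableOn ℂ f (ball c R)) (hq : ∀ z ∈ ball c s, IsQuasinilpotent (f z)) :
    ∀ z ∈ ball c R, IsQuasinilpotent (f z) := by
  intro z₁ hz₁
  by_cases hzs : z₁ ∈ ball c s
  · exact hq z₁ hzs
  have hd : s ≤ ‖z₁ - c‖ := by simpa [dist_eq_norm] using hzs
  have hdR : ‖z₁ - c‖ < R := by simpa [dist_eq_norm] using hz₁
  obtain ⟨R', hR1, hR2⟩ := exists_between hdR
  obtain ⟨s', hs'0, hs's⟩ := exists_between hs
  have hd0 : 0 < ‖z₁ - c‖ := hs.trans_le hd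
  obtain ⟨C, hC⟩ := (isCompact_closedBall c R').exists_bound_of_continuousOn
    (hf.continuousOn.mono (closedBall_subset_ball hR2))
  have hC0 : 0 ≤ C := (norm_nonneg _).trans (hC c (mem_closedBall_self (hd0.trans hR1).le))
  set l := Real.log s' with hl
  set u := Real.log R' with hu
  have hlu : l < u := Real.log_lt_log hs'0 (by linarith)
  set ζ := Complex.log (z₁ - c) with hζ
  have hζe : c + Complex.exp ζ = z₁ := by
    rw [hζ, Complex.exp_log (by simpa using hd0)]; ring
  have hζre : ζ.re = Real.log ‖z₁ - c‖ := Complex.log_re _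
  have hlζ : l ≤ ζ.re := by rw [hζre]; exact Real.log_le_log hs'0 (by linarith)
  have hζu : ζ.re < u := by rw [hζre]; exact Real.log_lt_log hd0 hR1
  set t := (ζ.re - l) / (u - l) with ht
  have ht1 : t < 1 := by rw [ht, div_lt_one (by linarith)]; linarith
  have ht0 : 0 ≤ t := div_nonneg (by linarith) (by linarith)
  have hbnd : ∀ w : ℂ, w.re ≤ u → c + Complex.exp w ∈ closedBall c R' := fun w hw => by
    rw [mem_closedBall, dist_eq_norm, add_sub_cancel_left, Complex.norm_exp]
    rw [← Real.exp_log (hd0.trans hR1)]; exact Real.exp_le_exp.2 hw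
  have key : ∀ ε : ℝ, 0 < ε → ∀ x ∈ spectrum ℂ (f z₁), ‖x‖ ≤ ε ^ (1 - t) * C ^ t := by
    intro ε hε x hx
    obtain ⟨N, hN0, hN⟩ := exists_uniform_pow_norm_le (isCompact_closedBall c s') (f := f)
      (hf.continuousOn.mono (closedBall_subset_ball (by linarith)))
      (fun z hz => hq z (closedBall_subset_ball hs's hz)) hε
    have h3 := Complex.HadamardThreeLines.norm_le_interp_of_mem_verticalClosedStrip'
      (f := fun w => f (c + Complex.exp w) ^ N) (z := ζ) (a := ε ^ N) (b := C ^ N) hlu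
      ⟨hlζ, hζu.le⟩ ?_ ?_ ?_ ?_
    · simp only [hζe, ← ht] at h3
      have h4 : ‖x‖ ^ N ≤ ‖f z₁ ^ N‖ := by
        rw [← norm_pow]; exact spectrum.norm_le_norm_of_mem (spectrum.pow_mem_pow _ _ hx)
      have h5 : (ε ^ N) ^ (1 - t) * (C ^ N) ^ t = (ε ^ (1 - t) * C ^ t) ^ N := by
        rw [mul_pow, ← Real.rpow_natCast, ← Real.rpow_natCast, ← Real.rpow_natCast,
          ← Real.rpow_natCast, ← Real.rpow_mul hε.le, ← Real.rpow_mul hε.le,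
          ← Real.rpow_mul hC0, ← Real.rpow_mul hC0, _root_.mul_comm (N : ℝ),
          _root_.mul_comm (N : ℝ)]
      rw [h5] at h3
      exact le_of_pow_le_pow_left₀ hN0.ne' (by positivity) (h4.trans h3)
    · have hsub : MapsTo (fun w => c + Complex.exp w) {w : ℂ | w.re ≤ u} (ball c R) :=
        fun w hw => closedBall_subset_ball hR2 (hbnd w hw)
      have hd : DifferentiableOn ℂ (fun w => f (c + Complex.exp w) ^ N) {w : ℂ | w.re ≤ u} := by
        have := hf.comp (f := fun w : ℂ => c + Complex.exp w) (by fun_prop) hsub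
        exact DifferentiableOn.pow (n := N) this
      refine DifferentiableOn.diffContOnCl (hd.mono ?_)
      refine closure_minimal (fun w hw => ?_) (isClosed_le Complex.continuous_re continuous_const)
      exact (show w.re < u from hw.2).le
    · refine ⟨C ^ N, ?_⟩
      rintro _ ⟨w, hw, rfl⟩
      exact (norm_pow_le _ _).trans (pow_le_pow_left₀ (norm_nonneg _) (hC _ (hbnd w hw.2)) N)
    · intro w hw
      refine hN _ ?_
      rw [mem_closedBall, dist_eq_norm, add_sub_cancel_left, Complex.norm_exp]
      rw [show w.re = l from hw, hl, Real.exp_log hs'0]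
    · intro w hw
      exact (norm_pow_le _ _).trans (pow_le_pow_left₀ (norm_nonneg _)
        (hC _ (hbnd w (le_of_eq hw))) N)
  rw [isQuasinilpotent_iff_spectrum_subset]
  intro x hx
  have hlim : Tendsto (fun ε : ℝ => ε ^ (1 - t) * C ^ t) (𝓝[>] 0) (𝓝 (0 ^ (1 - t) * C ^ t)) := by
    have : ContinuousAt (fun ε : ℝ => ε ^ (1 - t) * C ^ t) 0 :=
      (Real.continuousAt_rpow_const _ _ (Or.inr (by linarith))).mul continuousAt_const
    exact this.tendsto.mono_left nhdsWithin_le_nhds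
  rw [Real.zero_rpow (by linarith), zero_mul] at hlim
  have := ge_of_tendsto hlim (eventually_mem_nhdsWithin.mono fun ε hε => key ε hε x hx)
  simpa using this

/-- Quasinilpotency of the values of an analytic function propagates along connected sets. -/
theorem isQuasinilpotent_of_eventually {f : ℂ → A} {Ω : Set ℂ} (hΩ : IsOpen Ω)
    (hc : IsPreconnected Ω) (hf : DifferentiableOn ℂ f Ω) {z₀ : ℂ} (hz₀ : z₀ ∈ Ω)
    (hq : ∀ᶠ z in 𝓝 z₀, IsQuasinilpotent (f z)) : ∀ z ∈ Ω, IsQuasinilpotent (f z) := by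
  have h : Ω ⊆ {z | ∀ᶠ w in 𝓝 z, IsQuasinilpotent (f w)} := by
    refine hc.subset_of_closure_inter_subset isOpen_setOfPred_eventually_nhds ⟨z₀, hz₀, hq⟩ ?_
    rintro z ⟨hz, hzΩ⟩
    obtain ⟨R, hR, hRΩ⟩ := Metric.isOpen_iff.1 hΩ z hzΩ
    obtain ⟨w, hw, hzw⟩ := Metric.mem_closure_iff.1 hz (R / 2) (half_pos hR)
    obtain ⟨s, hs, hsw⟩ := Metric.eventually_nhds_iff_ball.1 hw
    have h1 : ball w (R / 2) ⊆ Ω := fun y hy => hRΩ (by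
      rw [mem_ball] at hy ⊢
      have := dist_triangle y w z
      rw [dist_comm] at hzw
      linarith)
    have h2 := isQuasinilpotent_of_mem_ball hs (hf.mono h1) hsw
    exact mem_of_superset (isOpen_ball.mem_nhds (mem_ball.2 hzw)) h2
  exact fun z hz => (h hz).self_of_nhds

end QuasinilpotentContinuation

section Jacobson

variable {F A : Type*} [Field F] [Ring A] [Algebra F A]

namespace Submodule

theorem isNilpotent_mulLeft_add_mulRight {K : Submodule F A} (hK : IsNilpotent K) :
    ∃ n : ℕ, ∀ Q : ℕ → Submodule F A, (∀ m, Q (m + 1) = K * Q m + Q m * K) → Q n = 0 := by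
  obtain ⟨n, hn⟩ := hK
  set l : AddMonoid.End (Submodule F A) := AddMonoidHom.mulLeft K with hl
  set r : AddMonoid.End (Submodule F A) := AddMonoidHom.mulRight K with hr
  have hl' : ∀ Q, l Q = K * Q := fun Q => rfl
  have hr' : ∀ Q, r Q = Q * K := fun Q => rfl
  have hcomm : Commute l r := by
    ext Q : 1
    change l (r Q) = r (l Q)
    rw [hl', hr', hl', hr', mul_assoc]
  have hln : ∀ m Q, (l ^ m) Q = K ^ m * Q := by
    intro m
    induction m with
    | zero => intro Q; simp
    | succ m ih =>
      intro Q
      rw [pow_succ']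
      change l ((l ^ m) Q) = _
      rw [ih, hl', pow_succ', mul_assoc]
  have hrn : ∀ m Q, (r ^ m) Q = Q * K ^ m := by
    intro m
    induction m with
    | zero => intro Q; simp
    | succ m ih =>
      intro Q
      rw [pow_succ']
      change r ((r ^ m) Q) = _
      rw [ih, hr', pow_succ, mul_assoc]
  have h1 : IsNilpotent l := ⟨n, by ext Q : 1; rw [hln, hn, zero_mul]; rfl⟩
  have h2 : IsNilpotent r := ⟨n, by ext Q : 1; rw [hrn, hn, mul_zero]; rfl⟩
  obtain ⟨N, hN⟩ := hcomm.isNilpotent_add h1 h2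
  refine ⟨N, fun Q hQ => ?_⟩
  have : ∀ m, Q m = ((l + r) ^ m) (Q 0) := by
    intro m
    induction m with
    | zero => simp
    | succ m ih =>
      rw [pow_succ']
      change _ = (l + r) (((l + r) ^ m) (Q 0))
      rw [← ih, hQ]
      rfl
  rw [this, hN]; rfl

theorem isNilpotent_sup_of_jordan {K : Submodule F A} (hK : IsNilpotent K) {w : A}
    (hw : IsNilpotent w) (hKw : ∀ k ∈ K, k * w + w * k ∈ K) :
    IsNilpotent (K + span F {w}) := by
  set S := span F {w} with hS
  have hSn : IsNilpotent S := by
    obtain ⟨p, hp⟩ := hw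
    refine ⟨p, ?_⟩
    rw [hS, span_pow, Set.singleton_pow, hp, span_zero_singleton]; rfl
  set B := Algebra.adjoin F ((K + S : Submodule F A) : Set A) with hB
  set D := Subalgebra.toSubmodule B with hD
  have h1S : K ≤ K + S := le_sup_left
  have h2S : S ≤ K + S := le_sup_right
  have hKSD : K + S ≤ D := fun x hx => Algebra.subset_adjoin hx
  have hDD : D * D ≤ D := by
    rw [mul_le]; exact fun a ha b hb => B.mul_mem ha hb
  have h1D : ∀ Q, Q ≤ D * Q := fun Q x hx => by
    have := mul_mem_mul (show (1 : A) ∈ D from B.one_mem) hx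
    rwa [one_mul] at this
  have hwD : w ∈ D := hKSD (h2S (mem_span_singleton_self w))
  have hKD : K * D ≤ D * K := by
    have key : ∀ d ∈ B, ∀ k ∈ K, k * d ∈ D * K := by
      intro d hd
      induction hd using Algebra.adjoin_induction with
      | mem x hx =>
        intro k hk
        obtain ⟨k', hk', s, hs, rfl⟩ := mem_sup.1 hx
        obtain ⟨c, rfl⟩ := mem_span_singleton.1 hs
        rw [mul_add, mul_smul_comm]
        refine add_mem (mul_mem_mul (hKSD (h1S hk)) hk') (smul_mem _ _ ?_)
        have : k * w = (k * w + w * k) - w * k := by abel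
        rw [this]
        exact sub_mem (h1D _ (hKw k hk)) (mul_mem_mul hwD hk)
      | algebraMap c =>
        intro k hk
        rw [← Algebra.commutes, ← Algebra.smul_def]
        exact h1D _ (smul_mem _ _ hk)
      | add x y _ _ hx hy => intro k hk; rw [mul_add]; exact add_mem (hx k hk) (hy k hk)
      | mul x y _ _ hx hy =>
        intro k hk
        rw [← mul_assoc]
        have h1 : ∀ z ∈ D * K, z * y ∈ D * K := by
          intro z hz
          induction hz using Submodule.mul_induction_on' with
          | mem_mul_mem m hm n hn =>
            rw [mul_assoc]
            have := mul_mem_mul hm (hy n hn)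
            rw [← mul_assoc] at this
            exact mul_le_mul_left hDD K this
          | add a _ b _ ha hb => rw [add_mul]; exact add_mem ha hb
        exact h1 _ (hx k hk)
    rw [mul_le]; exact fun k hk d hd => key d hd k hk
  obtain ⟨n, hn⟩ := hK
  have hKn : ∀ m, K ^ m * D ≤ D * K ^ m := by
    intro m
    induction m with
    | zero => simp
    | succ m ih =>
      calc K ^ (m + 1) * D = K * (K ^ m * D) := by rw [pow_succ', mul_assoc]
        _ ≤ K * (D * K ^ m) := by gcongr
        _ = K * D * K ^ m := by rw [mul_assoc]
        _ ≤ D * K * K ^ m := by gcongr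
        _ = D * K ^ (m + 1) := by rw [pow_succ', mul_assoc]
  have hDK : ∀ m, (D * K) ^ m ≤ D * K ^ m := by
    intro m
    induction m with
    | zero => simpa using h1D 1
    | succ m ih =>
      calc (D * K) ^ (m + 1) = (D * K) ^ m * (D * K) := by rw [pow_succ]
        _ ≤ D * K ^ m * (D * K) := by gcongr
        _ = D * (K ^ m * D) * K := by simp only [mul_assoc]
        _ ≤ D * (D * K ^ m) * K := mul_le_mul' (mul_le_mul' le_rfl (hKn m)) le_rfl
        _ = D * D * (K ^ m * K) := by simp only [mul_assoc]
        _ ≤ D * (K ^ m * K) := by gcongr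
        _ = D * K ^ (m + 1) := by rw [pow_succ]
  have hSD : ∀ m, S ^ m ≤ D := by
    intro m
    induction m with
    | zero => rw [pow_zero, one_le]; exact B.one_mem
    | succ m ih =>
      rw [pow_succ]
      exact (mul_le_mul' ih (h2S.trans hKSD)).trans hDD
  have hKS : ∀ m, (K + S) ^ m ≤ D * K + S ^ m := by
    intro m
    induction m with
    | zero => rw [pow_zero, pow_zero]; exact le_sup_right
    | succ m ih =>
      rw [pow_succ']
      refine (mul_le_mul' le_rfl ih).trans ?_
      rw [mul_add, add_mul (c := S ^ m)]
      refine sup_le (c := D * K + S ^ (m + 1)) ?_ (sup_le ?_ ?_)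
      · rw [← mul_assoc]
        exact ((mul_le_mul' (mul_le_mul' hKSD le_rfl) le_rfl).trans
          (mul_le_mul' hDD le_rfl)).trans le_sup_left
      · exact ((mul_le_mul' le_rfl (hSD m)).trans hKD).trans le_sup_left
      · rw [pow_succ']; exact le_sup_right
  obtain ⟨p, hp⟩ := hSn
  refine ⟨p * n, ?_⟩
  have h1 := hKS p
  rw [hp, add_zero] at h1
  have h2 : (K + S) ^ (p * n) ≤ D * K ^ n := by
    rw [pow_mul]
    exact (pow_le_pow_left' h1 n).trans (hDK n)
  rw [hn, mul_zero] at h2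
  exact le_antisymm h2 bot_le

/-- Jacobson's theorem: a finite-dimensional Jordan algebra of nilpotent elements generates a
nilpotent algebra. -/
theorem isNilpotent_of_jordan (W : Submodule F A) [FiniteDimensional F W]
    (hJ : ∀ a ∈ W, ∀ b ∈ W, a * b + b * a ∈ W) (hn : ∀ a ∈ W, IsNilpotent a) :
    IsNilpotent W := by
  set N : Set ℕ := {n | ∃ K : Submodule F A, K ≤ W ∧ IsNilpotent K ∧ Module.finrank F K = n}
  have hNb : BddAbove N := ⟨Module.finrank F W, by
    rintro _ ⟨K, hK, -, rfl⟩; exact finrank_mono hK⟩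
  have hNne : N.Nonempty := ⟨_, ⊥, bot_le, IsNilpotent.zero, rfl⟩
  obtain ⟨K, hKW, hK, hKr⟩ := Nat.sSup_mem hNne hNb
  have hmax : ∀ K', K ≤ K' → K' ≤ W → IsNilpotent K' → K' = K := by
    intro K' h1 h2 h3
    have : FiniteDimensional F K' := Submodule.finiteDimensional_of_le h2
    refine (Submodule.eq_of_le_of_finrank_le h1 ?_).symm
    rw [hKr]; exact le_csSup hNb ⟨K', h2, h3, rfl⟩
  by_cases hKe : W ≤ K
  · rwa [le_antisymm hKe hKW]
  exfalso
  obtain ⟨w₀, hw₀, hw₀K⟩ := SetLike.not_le_iff_exists.1 hKe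
  obtain ⟨w, hw, hwK, hwJ⟩ : ∃ w ∈ W, w ∉ K ∧ ∀ k ∈ K, k * w + w * k ∈ K := by
    by_contra! hcon
    obtain ⟨n, hn⟩ := isNilpotent_mulLeft_add_mulRight hK
    set Q : ℕ → Submodule F A := fun m => Nat.rec ⊤ (fun _ Q => K * Q + Q * K) m with hQ
    have hQs : ∀ m, Q (m + 1) = K * Q m + Q m * K := fun m => rfl
    have : ∀ m, ∃ w ∈ W, w ∉ K ∧ w ∈ Q m := by
      intro m
      induction m with
      | zero => exact ⟨w₀, hw₀, hw₀K, mem_top⟩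
      | succ m ih =>
        obtain ⟨w, hw, hwK, hwQ⟩ := ih
        obtain ⟨k, hk, hkw⟩ := hcon w hw hwK
        exact ⟨_, hJ k (hKW hk) w hw, hkw, by
          rw [hQs]; exact add_mem_sup (mul_mem_mul hk hwQ) (mul_mem_mul hwQ hk)⟩
    obtain ⟨w, -, hwK, hwQ⟩ := this n
    rw [hn Q hQs] at hwQ
    have : w = 0 := hwQ
    exact hwK (this ▸ zero_mem _)
  have h1 := isNilpotent_sup_of_jordan hK (hn w hw) hwJ
  have h2 := hmax (K + span F {w}) le_sup_left (sup_le hKW (by simpa using hw)) h1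
  have h3 : w ∈ K + span F {w} := (le_sup_right : span F {w} ≤ K + span F {w})
    (mem_span_singleton_self w)
  rw [h2] at h3
  exact hwK h3

end Submodule

theorem exists_common_kernel_of_jordan {V : Type*} [AddCommGroup V] [Module F V] [Nontrivial V]
    (W : Submodule F (Module.End F V)) [FiniteDimensional F W]
    (hJ : ∀ a ∈ W, ∀ b ∈ W, a * b + b * a ∈ W) (hn : ∀ a ∈ W, IsNilpotent a) :
    ∃ v : V, v ≠ 0 ∧ ∀ a ∈ W, a v = 0 := by
  classical
  have hW := W.isNilpotent_of_jordan hJ hn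
  set n := Nat.find hW with hn
  have h0 : n ≠ 0 := by
    intro h
    have := Nat.find_spec hW
    rw [← hn, h, pow_zero] at this
    exact one_ne_zero this
  obtain ⟨m, hm⟩ := Nat.exists_eq_succ_of_ne_zero h0
  have h1 : W ^ m ≠ 0 := Nat.find_min hW (by omega)
  obtain ⟨b, hb, hb0⟩ := Submodule.exists_mem_ne_zero_of_ne_bot h1
  obtain ⟨x, hx⟩ : ∃ x, b x ≠ 0 := by
    by_contra! h; exact hb0 (LinearMap.ext h)
  refine ⟨b x, hx, fun a ha => ?_⟩
  have h2 := Submodule.mul_mem_mul ha hb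
  rw [← pow_succ', ← Nat.succ_eq_add_one, ← hm, Nat.find_spec hW] at h2
  have : a * b = 0 := h2
  exact LinearMap.congr_fun this x

end Jacobson

section SpectrumMul

variable {A : Type*} [NormedRing A] [NormedAlgebra ℂ A] [CompleteSpace A]

/-- The spectrum of a product of commuting elements consists of products of spectral values. -/
theorem spectrum_mul_subset_of_commute {a b : A} (hab : Commute a b) :
    spectrum ℂ (a * b) ⊆ Set.image2 (· * ·) (spectrum ℂ a) (spectrum ℂ b) := by
  set S : Set A := {a, b} with hS
  set C := Subalgebra.centralizer ℂ S with hC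
  set D := Subalgebra.centralizer ℂ (C : Set A) with hD
  have hSC : S ⊆ C := by
    rintro x (rfl | rfl) <;> rw [SetLike.mem_coe, Subalgebra.mem_centralizer_iff] <;>
      rintro y (rfl | rfl) <;> first | rfl | exact hab.eq | exact hab.eq.symm
  have hDC : D ≤ C := Subalgebra.centralizer_le ℂ S C hSC
  have hDcomm : ∀ x y : D, x * y = y * x := fun x y =>
    Subtype.ext ((Subalgebra.mem_centralizer_iff ℂ).1 y.2 x (hDC x.2))
  have haD : a ∈ D := by
    rw [Subalgebra.mem_centralizer_iff]
    intro c hc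
    exact ((Subalgebra.mem_centralizer_iff ℂ).1 hc a (by simp [hS])).symm
  have hbD : b ∈ D := by
    rw [Subalgebra.mem_centralizer_iff]
    intro c hc
    exact ((Subalgebra.mem_centralizer_iff ℂ).1 hc b (by simp [hS])).symm
  have hinv : ∀ x : D, IsUnit (x : A) → IsUnit x := by
    rintro x ⟨u, hu⟩
    have : (↑u⁻¹ : A) ∈ D := by
      rw [Subalgebra.mem_centralizer_iff]
      intro c hc
      have h1 : Commute c (u : A) := by
        rw [hu]; exact (Subalgebra.mem_centralizer_iff ℂ).1 x.2 c hc
      exact h1.units_inv_right.eq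
    exact ⟨⟨x, ⟨_, this⟩, Subtype.ext (by simp [← hu]), Subtype.ext (by simp [← hu])⟩, rfl⟩
  have hDcl : IsClosed (D : Set A) := by
    have : (D : Set A) = ⋂ c ∈ C, {x | c * x = x * c} := by
      ext x
      simp [hD, Set.mem_centralizer_iff]
    rw [this]
    exact isClosed_biInter fun c _ => isClosed_eq (by fun_prop) (by fun_prop)
  have : CompleteSpace D := hDcl.completeSpace_coe
  let _ : NormedCommRing D := { (inferInstance : NormedRing D) with mul_comm := hDcomm }
  intro z hz
  have hz' : z ∈ spectrum ℂ ((⟨a, haD⟩ : D) * ⟨b, hbD⟩) := by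
    rw [spectrum.mem_iff] at hz ⊢
    intro h
    have := h.map D.val
    exact hz this
  obtain ⟨φ, hφ⟩ := WeakDual.CharacterSpace.mem_spectrum_iff_exists.1 hz'
  have key : ∀ x : D, φ x ∈ spectrum ℂ (x : A) := fun x hx => by
    have h1 := hinv (algebraMap ℂ D (φ x) - x) hx
    have h2 := AlgHom.apply_mem_spectrum φ x
    exact h2 h1
  exact ⟨_, key ⟨a, haD⟩, _, key ⟨b, hbD⟩, by rw [← hφ]; exact (map_mul φ _ _).symm⟩

/-- The operator `c ↦ a * c * b` on a Banach algebra. -/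
noncomputable def mulLeftRightCLM (a b : A) : A →L[ℂ] A :=
  ContinuousLinearMap.mulLeftRight ℂ A a b

theorem mulLeftRightCLM_apply (a b c : A) : mulLeftRightCLM a b c = a * c * b := by
  simp [mulLeftRightCLM]

theorem countable_spectrum_mulLeftRightCLM {a b : A} (ha : (spectrum ℂ a).Countable)
    (hb : (spectrum ℂ b).Countable) : (spectrum ℂ (mulLeftRightCLM a b)).Countable := by
  have hmul : ∀ a b c d : A, mulLeftRightCLM a b * mulLeftRightCLM c d
      = mulLeftRightCLM (a * c) (d * b) := fun a b c d => by
    ext x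
    simp only [mul_apply_eq_comp, mulLeftRightCLM_apply, mul_assoc]
  have hone : mulLeftRightCLM (1 : A) 1 = 1 := by
    ext x; simp [mulLeftRightCLM_apply]
  have hcomm : Commute (mulLeftRightCLM a 1) (mulLeftRightCLM 1 b) := by
    rw [Commute, SemiconjBy, hmul, hmul]; simp
  have h1 : spectrum ℂ (mulLeftRightCLM a 1) ⊆ spectrum ℂ a := by
    intro z hz hu
    refine hz ?_
    have : algebraMap ℂ (A →L[ℂ] A) z - mulLeftRightCLM a 1
        = mulLeftRightCLM (algebraMap ℂ A z - a) 1 := by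
      ext x
      simp [mulLeftRightCLM_apply, Algebra.algebraMap_eq_smul_one, sub_mul]
    obtain ⟨u, hu⟩ := hu
    rw [spectrum.mem_resolventSet_iff, this, ← hu]
    exact ⟨⟨mulLeftRightCLM u 1, mulLeftRightCLM (↑u⁻¹ : A) 1, by rw [hmul]; simp [hone],
      by rw [hmul]; simp [hone]⟩, rfl⟩
  have h2 : spectrum ℂ (mulLeftRightCLM 1 b) ⊆ spectrum ℂ b := by
    intro z hz hu
    refine hz ?_
    have : algebraMap ℂ (A →L[ℂ] A) z - mulLeftRightCLM 1 b
        = mulLeftRightCLM 1 (algebraMap ℂ A z - b) := by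
      ext x
      simp [mulLeftRightCLM_apply, Algebra.algebraMap_eq_smul_one, mul_sub]
    obtain ⟨u, hu⟩ := hu
    rw [spectrum.mem_resolventSet_iff, this, ← hu]
    exact ⟨⟨mulLeftRightCLM 1 u, mulLeftRightCLM 1 (↑u⁻¹ : A), by rw [hmul]; simp [hone],
      by rw [hmul]; simp [hone]⟩, rfl⟩
  have h3 := spectrum_mul_subset_of_commute hcomm
  rw [hmul] at h3
  simp only [mul_one] at h3
  exact ((ha.mono h1).image2 (hb.mono h2) _).mono h3

end SpectrumMul

section Jordan

variable {A : Type*} [NormedRing A] [NormedAlgebra ℂ A]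

/-- A subspace closed under the Jordan product. -/
def IsJordanSubspace (J : Submodule ℂ A) : Prop := ∀ a ∈ J, ∀ b ∈ J, a * b + b * a ∈ J

namespace IsJordanSubspace

variable {J : Submodule ℂ A}

theorem topologicalClosure (hJ : IsJordanSubspace J) :
    IsJordanSubspace J.topologicalClosure := fun _ ha _ hb =>
  map_mem_closure₂ (f := fun a b : A => a * b + b * a) (by fun_prop) ha hb hJ

theorem sq_mem (hJ : IsJordanSubspace J) {a : A} (ha : a ∈ J) : a * a ∈ J := by
  have := J.smul_mem (2⁻¹ : ℂ) (hJ a ha a ha)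
  rwa [← two_smul ℂ, smul_smul, inv_mul_cancel₀ two_ne_zero, one_smul] at this

theorem mul_mul_mem (hJ : IsJordanSubspace J) {a b : A} (ha : a ∈ J) (hb : b ∈ J) :
    a * b * a ∈ J := by
  have h := J.smul_mem (2⁻¹ : ℂ) (J.sub_mem (hJ a ha _ (hJ a ha b hb)) (hJ _ (hJ.sq_mem ha) b hb))
  have h2 : a * (a * b + b * a) + (a * b + b * a) * a - (a * a * b + b * (a * a))
      = a * b * a + a * b * a := by noncomm_ring
  rwa [h2, ← two_smul ℂ, smul_smul, inv_mul_cancel₀ two_ne_zero, one_smul] at h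

theorem pow_succ_mem (hJ : IsJordanSubspace J) {a : A} (ha : a ∈ J) (n : ℕ) : a ^ (n + 1) ∈ J := by
  induction n with
  | zero => simpa using ha
  | succ n ih =>
    have := J.smul_mem (2⁻¹ : ℂ) (hJ _ ih a ha)
    rwa [← pow_succ, ← pow_succ', ← two_smul ℂ, smul_smul, inv_mul_cancel₀ two_ne_zero,
      one_smul] at this

theorem exp_sub_one_mem [CompleteSpace A] (hJ : IsJordanSubspace J) (hcl : IsClosed (J : Set A))
    {a : A} (ha : a ∈ J) : exp a - 1 ∈ J := by
  have h := (hasSum_nat_add_iff' 1).2 (exp_series_hasSum_exp' (𝕂 := ℂ) a)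
  simp only [Finset.range_one, Finset.sum_singleton, pow_zero, Nat.factorial_zero, Nat.cast_one,
    inv_one, one_smul] at h
  exact hcl.mem_of_tendsto h (Eventually.of_forall fun s =>
    J.sum_mem fun n _ => J.smul_mem _ (hJ.pow_succ_mem ha n))

/-- The inverse of `1 + a` for a quasinilpotent `a` is given by the Neumann series. -/
theorem exists_inverse_one_add [CompleteSpace A] (hJ : IsJordanSubspace J)
    (hcl : IsClosed (J : Set A)) {a : A} (ha : a ∈ J) (hq : IsQuasinilpotent a) :
    ∃ b ∈ J, (1 + a) * (1 + b) = 1 ∧ (1 + b) * (1 + a) = 1 := by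
  have hs : Summable fun n : ℕ => (-a) ^ n := by
    obtain ⟨C, -, hC⟩ := hq.exists_pow_norm_le (ε := 1 / 2) (by norm_num)
    refine Summable.of_norm_bounded
      ((summable_geometric_of_lt_one (by norm_num) (by norm_num : (1 / 2 : ℝ) < 1)).mul_left C)
      fun n => ?_
    rw [neg_pow]
    rcases neg_one_pow_eq_or A n with h | h <;> rw [h] <;> simpa using hC n
  have h := (hasSum_nat_add_iff' 1).2 hs.hasSum
  simp only [Finset.range_one, Finset.sum_singleton, pow_zero] at h
  refine ⟨_, hcl.mem_of_tendsto h (Eventually.of_forall fun s =>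
    J.sum_mem fun n _ => hJ.pow_succ_mem (J.neg_mem ha) n), ?_, ?_⟩
  · simpa using hs.one_sub_mul_tsum_pow
  · simpa using hs.tsum_pow_mul_one_sub

end IsJordanSubspace

/-- The exponential as a unit. -/
noncomputable def expUnit [CompleteSpace A] (a : A) : Aˣ where
  val := exp a
  inv := exp (-a)
  val_inv := by
    let _ : NormedAlgebra ℚ A := NormedAlgebra.restrictScalars ℚ ℂ A
    rw [← exp_add_of_commute (Commute.neg_right (Commute.refl a)), add_neg_cancel, exp_zero]
  inv_val := by
    let _ : NormedAlgebra ℚ A := NormedAlgebra.restrictScalars ℚ ℂ A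
    rw [← exp_add_of_commute (Commute.neg_left (Commute.refl a)), neg_add_cancel, exp_zero]

theorem expUnit_val [CompleteSpace A] (a : A) : (expUnit a : A) = exp a := rfl

theorem expUnit_inv [CompleteSpace A] (a : A) : (expUnit a)⁻¹ = expUnit (-a) := by
  ext; change exp (-a) = exp (-a); rfl

theorem HasDerivAt.mem_of_isClosed {E : Type*} [NormedAddCommGroup E] [NormedSpace ℂ E]
    {M : Submodule ℂ E} (hM : IsClosed (M : Set E)) {f : ℂ → E} {d : E} {z : ℂ}
    (hf : HasDerivAt f d z) (h : ∀ w, f w ∈ M) : d ∈ M :=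
  hM.mem_of_tendsto hf.tendsto_slope (Eventually.of_forall fun w => by
    rw [slope_def_module]
    exact M.smul_mem _ (M.sub_mem (h _) (h _)))

/-- The elements of `J` whose addition does not change invertibility of `1 + a`, `a ∈ J`. -/
def stableIdeal (J : Submodule ℂ A) : Submodule ℂ A where
  carrier := {s | s ∈ J ∧ ∀ a ∈ J, IsUnit (1 + a) → ∀ z : ℂ, IsUnit (1 + a + z • s)}
  zero_mem' := ⟨zero_mem _, fun a _ h z => by simpa using h⟩
  add_mem' := by
    rintro s t ⟨hs, h1⟩ ⟨ht, h2⟩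
    refine ⟨add_mem hs ht, fun a ha hu z => ?_⟩
    have h3 := h1 a ha hu z
    rw [add_assoc] at h3
    have := h2 _ (add_mem ha (J.smul_mem z hs)) h3 z
    rw [smul_add]
    simpa only [add_assoc] using this
  smul_mem' := by
    rintro c s ⟨hs, h⟩
    refine ⟨J.smul_mem _ hs, fun a ha hu z => ?_⟩
    rw [smul_smul]; exact h a ha hu _

theorem stableIdeal_le (J : Submodule ℂ A) : stableIdeal J ≤ J := fun _ h => h.1

theorem isQuasinilpotent_of_mem_stableIdeal {J : Submodule ℂ A} {s : A} (hs : s ∈ stableIdeal J) :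
    IsQuasinilpotent s := fun z => by simpa using hs.2 0 (zero_mem _) (by simp) z

theorem isUnit_add_smul_iff (u : Aˣ) (s : A) :
    (∀ z : ℂ, IsUnit (↑u + z • s)) ↔ IsQuasinilpotent (↑u⁻¹ * s) := by
  refine forall_congr' fun z => ?_
  have : (↑u + z • s) = u * (1 + z • (↑u⁻¹ * s)) := by
    rw [mul_add, mul_one, mul_smul_comm, Units.mul_inv_cancel_left]
  rw [this, Units.isUnit_units_mul]

theorem isClosed_stableIdeal [CompleteSpace A] {J : Submodule ℂ A} (hcl : IsClosed (J : Set A))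
    (hcount : ∀ s ∈ J, ∀ a : A, (spectrum ℂ (a * s)).Countable) :
    IsClosed (stableIdeal J : Set A) := by
  refine isClosed_of_closure_subset fun s hs => ?_
  obtain ⟨t, ht, hlim⟩ := mem_closure_iff_seq_limit.1 hs
  have hsJ : s ∈ J := hcl.mem_of_tendsto hlim (Eventually.of_forall fun n => (ht n).1)
  refine ⟨hsJ, fun a ha hu => ?_⟩
  obtain ⟨u, hu⟩ := hu
  rw [← hu, isUnit_add_smul_iff]
  refine isQuasinilpotent_of_tendsto (hlim.const_mul (↑u⁻¹ : A)) (hcount s hsJ _)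
    (Eventually.of_forall fun n => ?_)
  rw [← isUnit_add_smul_iff, hu]
  exact (ht n).2 a ha ⟨u, hu⟩

theorem mul_mul_mem_stableIdeal {J : Submodule ℂ A} (hJ : IsJordanSubspace J) {w : Aˣ}
    (h1 : (w : A) - 1 ∈ J) (h2 : (↑w⁻¹ : A) - 1 ∈ J) {s : A} (hs : s ∈ stableIdeal J) :
    w * s * w ∈ stableIdeal J := by
  have key : ∀ b ∈ J, ∀ a ∈ J, (1 + b) * a * (1 + b) ∈ J := fun b hb a ha => by
    have : (1 + b) * a * (1 + b) = a + (b * a + a * b) + b * a * b := by noncomm_ring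
    rw [this]
    exact add_mem (add_mem ha (hJ b hb a ha)) (hJ.mul_mul_mem hb ha)
  refine ⟨?_, fun a ha hu z => ?_⟩
  · have := key _ h1 s hs.1
    rwa [add_sub_cancel] at this
  · set v : A := ↑w⁻¹ with hv
    have e1 : v * a * v ∈ J := by
      have := key _ h2 a ha
      rwa [add_sub_cancel] at this
    have e2 : v * v - 1 ∈ J := by
      have : v * v - 1 = (v - 1) + (v - 1) + (v - 1) * (v - 1) := by noncomm_ring
      rw [this]
      exact add_mem (add_mem h2 h2) (hJ.sq_mem h2)
    have e3 : 1 + (v * v - 1 + v * a * v) = v * (1 + a) * v := by noncomm_ring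
    have h := hs.2 _ (add_mem e2 e1) (by
      rw [e3]; exact ((Units.isUnit _).mul hu).mul (Units.isUnit _)) z
    rw [e3] at h
    have e4 : 1 + a + z • (w * s * w) = w * (v * (1 + a) * v + z • s) * w := by
      rw [mul_add, add_mul, mul_smul_comm, smul_mul_assoc]
      congr 1
      simp [hv, mul_assoc]
    rw [e4]
    exact ((Units.isUnit _).mul h).mul (Units.isUnit _)

theorem exp_mul_mul_exp_mem_stableIdeal [CompleteSpace A] {J : Submodule ℂ A}
    (hJ : IsJordanSubspace J) (hcl : IsClosed (J : Set A)) {b s : A} (hb : b ∈ J) (hs : s ∈ stableIdeal J) :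
    exp b * s * exp b ∈ stableIdeal J :=
  mul_mul_mem_stableIdeal hJ (w := expUnit b) (hJ.exp_sub_one_mem hcl hb)
    (by rw [expUnit_inv]; exact hJ.exp_sub_one_mem hcl (neg_mem hb)) hs

theorem hasDerivAt_exp_mul_mul_exp [CompleteSpace A] (b s : A) :
    HasDerivAt (fun z : ℂ => exp (z • b) * s * exp (z • b)) (b * s + s * b) 0 := by
  have h := hasDerivAt_exp_smul_const (𝕂 := ℂ) b 0
  have h2 := (h.mul_const s).mul h
  simp only [zero_smul, exp_zero, one_mul, mul_one] at h2
  exact h2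

/-- Membership in a closed subspace of a Jordan product, from exponential conjugations. -/
theorem add_mem_of_exp_mul_mul_exp_mem [CompleteSpace A] {I : Submodule ℂ A}
    (hI : IsClosed (I : Set A)) {b s : A} (h : ∀ z : ℂ, exp (z • b) * s * exp (z • b) ∈ I) :
    b * s + s * b ∈ I :=
  (hasDerivAt_exp_mul_mul_exp b s).mem_of_isClosed hI h

end Jordan

section StableElement

theorem IsCompactOperator.mul_left {X : Type*} [NormedAddCommGroup X] [NormedSpace ℂ X]
    {K : X →L[ℂ] X} (hK : IsCompactOperator K) (S : X →L[ℂ] X) : IsCompactOperator (S * K) :=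
  hK.clm_comp S

theorem IsCompactOperator.mul_right {X : Type*} [NormedAddCommGroup X] [NormedSpace ℂ X]
    {K : X →L[ℂ] X} (hK : IsCompactOperator K) (S : X →L[ℂ] X) : IsCompactOperator (K * S) :=
  hK.comp_clm S

variable {A : Type*} [NormedRing A] [NormedAlgebra ℂ A]

theorem differentiableAt_inverse_one_sub_smul_mul [CompleteSpace A] {a b : A} {z : ℂ} (h : IsUnit (1 - z • a)) :
    DifferentiableAt ℂ (fun z : ℂ => Ring.inverse (1 - z • a) * b) z := by
  obtain ⟨u, hu⟩ := h
  have h1 := hasFDerivAt_ringInverse (𝕜 := ℂ) u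
  rw [hu] at h1
  have h2 := DifferentiableAt.comp z (f := fun z => 1 - z • a) h1.differentiableAt (by fun_prop)
  exact h2.mul_const b

theorem isUnit_sub_of_spectralRadius_lt {a : A} {z : ℂ} (hz : z ≠ 0)
    (h : spectralRadius ℂ a < ‖z⁻¹‖₊) : IsUnit (1 - z • a) := by
  have h1 : z⁻¹ ∈ resolventSet ℂ a := spectrum.mem_resolventSet_of_spectralRadius_lt h
  rw [spectrum.mem_resolventSet_iff] at h1
  have h2 := h1.smul (Units.mk0 z hz)
  have h3 : Units.mk0 z hz • (algebraMap ℂ A z⁻¹ - a) = 1 - z • a := by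
    rw [Units.smul_def, Units.val_mk0, smul_sub, Algebra.algebraMap_eq_smul_one, smul_smul,
      mul_inv_cancel₀ hz, one_smul]
  rwa [h3] at h2

theorem isUnit_of_inverse_mul_isQuasinilpotent {a s : A} (ha : IsUnit a)
    (h : IsQuasinilpotent (Ring.inverse a * s)) (z : ℂ) : IsUnit (a + z • s) := by
  obtain ⟨u, rfl⟩ := ha
  rw [Ring.inverse_unit, ← isUnit_add_smul_iff] at h
  exact h z

variable [NormOneClass A] [CompleteSpace A]

theorem isUnit_one_add_of_stable {J : Submodule ℂ A} {t a : A} (ha : a ∈ J)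
    (hcount : (spectrum ℂ a).Countable)
    (hst : ∀ a ∈ J, ∀ z : ℂ, spectralRadius ℂ (a + z • t) ≤ spectralRadius ℂ a)
    (hu : IsUnit (1 + a)) (z : ℂ) : IsUnit (1 + a + z • t) := by
  set Ω : Set ℂ := {z | IsUnit (1 - z • a)} with hΩ
  have hopen : IsOpen Ω := Units.isOpen.preimage (f := fun z : ℂ => 1 - z • a) (by fun_prop)
  have hsmall : ∀ z : ℂ, z ≠ 0 → ‖a‖ < ‖z⁻¹‖ → ∀ x : ℂ, IsUnit (1 - z • a + x • t) := by
    intro z hz hza x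
    have h1 : spectralRadius ℂ (a + (-(x * z⁻¹)) • t) < ‖z⁻¹‖₊ :=
      ((hst a ha _).trans (spectrum.spectralRadius_le_nnnorm a)).trans_lt
        (by exact_mod_cast hza)
    have h2 := isUnit_sub_of_spectralRadius_lt hz h1
    have h3 : 1 - z • (a + (-(x * z⁻¹)) • t) = 1 - z • a + x • t := by
      rw [smul_add, smul_smul, show z * -(x * z⁻¹) = -x by field_simp]
      rw [neg_smul]; abel
    rwa [h3] at h2
  have hconn : IsPreconnected Ω := by
    have h1 : Ωᶜ.Countable := by
      refine (hcount.image (fun z : ℂ => z⁻¹)).mono fun z hz => ?_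
      have hz0 : z ≠ 0 := by rintro rfl; simp [hΩ] at hz
      refine ⟨z⁻¹, fun h => hz ?_, inv_inv z⟩
      rw [spectrum.mem_resolventSet_iff] at h
      have h2 := h.smul (Units.mk0 z hz0)
      have h3 : Units.mk0 z hz0 • (algebraMap ℂ A z⁻¹ - a) = 1 - z • a := by
        rw [Units.smul_def, Units.val_mk0, smul_sub, Algebra.algebraMap_eq_smul_one, smul_smul,
          mul_inv_cancel₀ hz0, one_smul]
      rwa [h3] at h2
    simpa using h1.isPreconnected_compl
  have hsmall' : ∀ z : ℂ, z ≠ 0 → ‖a‖ < ‖z⁻¹‖ →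
      IsUnit (1 - z • a) ∧ IsQuasinilpotent (Ring.inverse (1 - z • a) * t) := by
    intro z hz hza
    have h := hsmall z hz hza
    have h0 : IsUnit (1 - z • a) := by simpa using h 0
    refine ⟨h0, ?_⟩
    obtain ⟨u, hu⟩ := h0
    rw [← hu, Ring.inverse_unit, ← isUnit_add_smul_iff, hu]
    exact h
  set z₀ : ℂ := ((‖a‖ + 1 : ℝ) : ℂ)⁻¹ with hz₀
  have hpos : (0 : ℝ) < ‖a‖ + 1 := by positivity
  have hz0 : z₀ ≠ 0 := by
    rw [hz₀]; exact inv_ne_zero (by exact_mod_cast hpos.ne')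
  have hza : ‖a‖ < ‖z₀⁻¹‖ := by
    rw [hz₀, inv_inv, Complex.norm_real, Real.norm_of_nonneg hpos.le]; linarith
  have hev : ∀ᶠ z in 𝓝 z₀, IsQuasinilpotent (Ring.inverse (1 - z • a) * t) := by
    have h1 : ∀ᶠ z in 𝓝 z₀, z ≠ 0 := isOpen_ne.mem_nhds hz0
    have h2 : ∀ᶠ z : ℂ in 𝓝 z₀, ‖a‖ < ‖z⁻¹‖ := by
      have : ContinuousAt (fun z : ℂ => ‖z⁻¹‖) z₀ := (continuousAt_inv₀ hz0).norm
      exact this.eventually (lt_mem_nhds hza)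
    filter_upwards [h1, h2] with z hz hz' using (hsmall' z hz hz').2
  have h := isQuasinilpotent_of_eventually hopen hconn (f := fun z => Ring.inverse (1 - z • a) * t)
    (fun z hz => (differentiableAt_inverse_one_sub_smul_mul hz).differentiableWithinAt)
    (hsmall' z₀ hz0 hza).1 hev (-1) (by simpa [hΩ] using hu)
  simp only [neg_smul, one_smul, sub_neg_eq_add] at h
  exact isUnit_of_inverse_mul_isQuasinilpotent hu h z

theorem mem_stableIdeal_topologicalClosure {J : Submodule ℂ A} {t : A} (ht : t ∈ J)
    (hcount : ∀ a ∈ J, ∀ b : A, (spectrum ℂ (b * a)).Countable)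
    (hst : ∀ a ∈ J, ∀ z : ℂ, spectralRadius ℂ (a + z • t) ≤ spectralRadius ℂ a) :
    t ∈ stableIdeal J.topologicalClosure := by
  refine ⟨J.le_topologicalClosure ht, fun a ha hu z => ?_⟩
  obtain ⟨s, hs, hlim⟩ := mem_closure_iff_seq_limit.1 ha
  refine isUnit_of_inverse_mul_isQuasinilpotent hu ?_ z
  have hlim1 : Tendsto (fun n => 1 + s n) atTop (𝓝 (1 + a)) := hlim.const_add 1
  have hev : ∀ᶠ n in atTop, IsUnit (1 + s n) := hlim1.eventually (Units.isOpen.mem_nhds hu)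
  have hlim2 : Tendsto (fun n => Ring.inverse (1 + s n) * t) atTop
      (𝓝 (Ring.inverse (1 + a) * t)) := by
    obtain ⟨u, hu⟩ := hu
    have h1 := NormedRing.inverse_continuousAt u
    rw [hu] at h1
    exact (h1.tendsto.comp hlim1).mul_const t
  refine isQuasinilpotent_of_tendsto hlim2 (hcount t ht _) ?_
  filter_upwards [hev] with n hn
  have h := isUnit_one_add_of_stable (hs n) (by simpa using hcount _ (hs n) 1) hst hn
  obtain ⟨u, hu⟩ := hn
  rw [← hu, Ring.inverse_unit, ← isUnit_add_smul_iff, hu]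
  exact h

end StableElement

section IrreducibleJordanPair

variable {X : Type*} [NormedAddCommGroup X] [NormedSpace ℂ X]

/-- A closed Jordan algebra `J` of compact operators without nontrivial closed invariant subspaces,
together with a nonzero Jordan ideal `I` of quasinilpotent operators which is invariant under the
maps `c ↦ exp b * c * exp b`, `b ∈ J`. -/
structure IrreducibleJordanPair (J I : Submodule ℂ (X →L[ℂ] X)) : Prop where
  isJordanSubspace : IsJordanSubspace J
  isClosed : IsClosed (J : Set (X →L[ℂ] X))
  isCompactOperator : ∀ b ∈ J, IsCompactOperator b
  irreducible : ∀ M : Submodule ℂ X, IsClosed (M : Set X) → (∀ b ∈ J, ∀ x ∈ M, b x ∈ M) →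
    M = ⊥ ∨ M = ⊤
  le : I ≤ J
  add_mem : ∀ b ∈ J, ∀ c ∈ I, b * c + c * b ∈ I
  exp_mul_mul_exp_mem : ∀ b ∈ J, ∀ c ∈ I, exp b * c * exp b ∈ I
  isQuasinilpotent : ∀ c ∈ I, IsQuasinilpotent c
  ne_bot : I ≠ ⊥

theorem apply_mem_of_exp_apply_mem [CompleteSpace X] {M : Submodule ℂ X}
    (hM : IsClosed (M : Set X)) {b : X →L[ℂ] X} {x : X} (h : ∀ z : ℂ, exp (z • b) x ∈ M) : b x ∈ M := by
  have h1 := (hasDerivAt_exp_smul_const (𝕂 := ℂ) b 0)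
  have h2 : HasDerivAt (fun z : ℂ => exp (z • b) x) (b x) 0 := by
    have := (ContinuousLinearMap.apply ℂ X x).hasFDerivAt.comp_hasDerivAt (0 : ℂ) h1
    simp only [ContinuousLinearMap.apply_apply, zero_smul, exp_zero, one_mul] at this
    exact this
  exact h2.mem_of_isClosed hM h

namespace IrreducibleJordanPair

variable {J I : Submodule ℂ (X →L[ℂ] X)}

theorem dense_span_apply [CompleteSpace X] (h : IrreducibleJordanPair J I) {G : Set (X →L[ℂ] X)}
    (hG : ∀ b ∈ J, ∀ g ∈ G, exp b * g ∈ G) {x : X} (hx : ∃ g ∈ G, g x ≠ 0) :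
    (Submodule.span ℂ ((fun g : X →L[ℂ] X => g x) '' G)).topologicalClosure = ⊤ := by
  set S := Submodule.span ℂ ((fun g : X →L[ℂ] X => g x) '' G) with hS
  refine (h.irreducible _ S.isClosed_topologicalClosure fun b hb y hy => ?_).resolve_left ?_
  · refine apply_mem_of_exp_apply_mem S.isClosed_topologicalClosure fun z => ?_
    have h1 : S ≤ S.comap (exp (z • b) : X →L[ℂ] X).toLinearMap := by
      rw [hS, Submodule.span_le]
      rintro _ ⟨g, hg, rfl⟩
      exact Submodule.subset_span ⟨_, hG _ (J.smul_mem z hb) g hg, rfl⟩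
    exact map_mem_closure (exp (z • b) : X →L[ℂ] X).continuous hy fun y hy => h1 hy
  · obtain ⟨g, hg, hgx⟩ := hx
    intro hbot
    have : g x ∈ S.topologicalClosure := S.le_topologicalClosure (Submodule.subset_span ⟨g, hg, rfl⟩)
    rw [hbot] at this
    exact hgx (by simpa using this)

theorem eq_zero_of_forall_apply_eq_zero (h : IrreducibleJordanPair J I) {x : X}
    (hx : ∀ c ∈ I, c x = 0) : x = 0 := by
  let M : Submodule ℂ X :=
    { carrier := {x | ∀ c ∈ I, c x = 0}
      zero_mem' := by simp
      add_mem' := fun {x y} hx hy c hc => by rw [map_add, hx c hc, hy c hc, add_zero]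
      smul_mem' := fun z x hx c hc => by rw [map_smul, hx c hc, smul_zero] }
  have hM : IsClosed (M : Set X) := by
    have : (M : Set X) = ⋂ c ∈ I, {x | c x = 0} := by ext; simp [M]
    rw [this]
    exact isClosed_biInter fun c _ => isClosed_eq c.continuous continuous_const
  have hinv : ∀ b ∈ J, ∀ x ∈ M, b x ∈ M := fun b hb x hx c hc => by
    have := hx _ (h.add_mem b hb c hc)
    simpa [hx c hc] using this
  rcases h.irreducible M hM hinv with h1 | h1
  · have : x ∈ M := hx
    rw [h1] at this
    simpa using this
  · refine absurd ((Submodule.eq_bot_iff I).2 fun c hc => ?_) h.ne_bot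
    ext y
    have : y ∈ M := h1 ▸ Submodule.mem_top
    exact this c hc

theorem dense_span_range (h : IrreducibleJordanPair J I) :
    (Submodule.span ℂ {y | ∃ c ∈ I, ∃ x, c x = y}).topologicalClosure = ⊤ := by
  set S := Submodule.span ℂ {y | ∃ c ∈ I, ∃ x, c x = y} with hS
  have hmem : ∀ c ∈ I, ∀ x, c x ∈ S := fun c hc x => Submodule.subset_span ⟨c, hc, x, rfl⟩
  refine (h.irreducible _ S.isClosed_topologicalClosure fun b hb y hy => ?_).resolve_left ?_
  · have h1 : S ≤ S.comap b.toLinearMap := by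
      rw [hS, Submodule.span_le]
      rintro _ ⟨c, hc, x, rfl⟩
      have := S.sub_mem (hmem _ (h.add_mem b hb c hc) x) (hmem c hc (b x))
      simpa using this
    exact map_mem_closure b.continuous hy fun y hy => h1 hy
  · intro hbot
    refine h.ne_bot ((Submodule.eq_bot_iff I).2 fun c hc => ?_)
    ext x
    have : c x ∈ S.topologicalClosure := S.le_topologicalClosure (hmem c hc x)
    rw [hbot] at this
    simpa using this

theorem exists_mul_ne_zero (h : IrreducibleJordanPair J I) : ∃ c ∈ I, ∃ d ∈ I, c * d ≠ 0 := by
  by_contra! hcd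
  refine h.ne_bot ((Submodule.eq_bot_iff I).2 fun c hc => ?_)
  have h1 : Submodule.span ℂ {y | ∃ c ∈ I, ∃ x, c x = y} ≤ LinearMap.ker c.toLinearMap := by
    rw [Submodule.span_le]
    rintro _ ⟨d, hd, x, rfl⟩
    simpa using congr($(hcd c hc d hd) x)
  have h2 := Submodule.topologicalClosure_minimal _ h1 c.isClosed_ker
  rw [h.dense_span_range] at h2
  ext x
  simpa using h2 (Submodule.mem_top (x := x))

end IrreducibleJordanPair

theorem eq_zero_of_span_apply_topologicalClosure_eq_top {G : Set (X →L[ℂ] X)} {x : X}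
    (hG : (Submodule.span ℂ ((fun g : X →L[ℂ] X => g x) '' G)).topologicalClosure = ⊤)
    {c : X →L[ℂ] X} (hc : ∀ g ∈ G, c (g x) = 0) : c = 0 := by
  have h1 : Submodule.span ℂ ((fun g : X →L[ℂ] X => g x) '' G) ≤ LinearMap.ker c.toLinearMap := by
    rw [Submodule.span_le]
    rintro _ ⟨g, hg, rfl⟩
    simpa using hc g hg
  have h2 := Submodule.topologicalClosure_minimal _ h1 c.isClosed_ker
  rw [hG] at h2
  ext x
  simpa using h2 (Submodule.mem_top (x := x))

theorem IsQuasinilpotent.isNilpotent_of_coe_apply {c : X →L[ℂ] X} (hc : IsQuasinilpotent c)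
    {Y : Submodule ℂ X} [FiniteDimensional ℂ Y] {e : Module.End ℂ Y}
    (he : ∀ y : Y, (e y : X) = c y) : IsNilpotent e := by
  have h1 : ∀ z : ℂ, e.HasEigenvalue z → z = 0 := by
    intro z hz
    by_contra hz0
    obtain ⟨y, hy⟩ := hz.exists_hasEigenvector
    have h2 : c y = z • (y : X) := by rw [← he, hy.apply_eq_smul]; rfl
    obtain ⟨u, hu⟩ := hc (-z⁻¹)
    have h3 : (u : X →L[ℂ] X) y = 0 := by simp [hu, h2, smul_smul, hz0]
    have h4 : ((↑u⁻¹ * ↑u : X →L[ℂ] X)) y = 0 := by rw [mul_apply_eq_comp, h3, map_zero]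
    rw [Units.inv_mul] at h4
    exact hy.2 (by simpa using h4)
  have h2 : e.maxGenEigenspace 0 = ⊤ := by
    rw [eq_top_iff, ← Module.End.iSup_maxGenEigenspace_eq_top e, iSup_le_iff]
    intro z
    by_cases hz : e.HasEigenvalue z
    · rw [h1 z hz]
    · rw [Module.End.maxGenEigenspace_eq_genEigenspace_finrank, (?_ : e.genEigenspace z _ = ⊥)]
      · exact bot_le
      · by_contra hne
        exact hz (Module.End.hasEigenvalue_of_hasGenEigenvalue (k := Module.finrank ℂ Y) hne)
  refine ⟨Module.finrank ℂ Y, LinearMap.ker_eq_top.1 ?_⟩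
  rw [← h2, Module.End.maxGenEigenspace_eq_genEigenspace_finrank, Module.End.genEigenspace_nat]
  simp

end IrreducibleJordanPair

section FiniteRank

variable {X : Type*} [NormedAddCommGroup X] [NormedSpace ℂ X]

/-- The restrictions to `Y` of the elements of `I` with range in `Y`. -/
def restrictedEnd (I : Submodule ℂ (X →L[ℂ] X)) (Y : Submodule ℂ X) :
    Submodule ℂ (Module.End ℂ Y) where
  carrier := {e | ∃ c ∈ I, (∀ x, c x ∈ Y) ∧ ∀ y : Y, (e y : X) = c y}
  zero_mem' := ⟨0, I.zero_mem, fun x => by simp, fun y => by simp⟩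
  add_mem' := by
    rintro e f ⟨c, hc, h1, h2⟩ ⟨d, hd, h3, h4⟩
    exact ⟨c + d, I.add_mem hc hd, fun x => Y.add_mem (h1 x) (h3 x), fun y => by simp [h2, h4]⟩
  smul_mem' := by
    rintro z e ⟨c, hc, h1, h2⟩
    exact ⟨z • c, I.smul_mem z hc, fun x => Y.smul_mem z (h1 x), fun y => by simp [h2]⟩

/-- Products of finite rank elements of a Jordan algebra of quasinilpotent operators are
nilpotent. -/
theorem isNilpotent_of_mem_subsemigroupClosure {I : Submodule ℂ (X →L[ℂ] X)}
    (hI : IsJordanSubspace I) (hq : ∀ c ∈ I, IsQuasinilpotent c)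
    (hf : ∀ c ∈ I, FiniteDimensional ℂ (LinearMap.range c.toLinearMap)) {g : X →L[ℂ] X}
    (hg : g ∈ Subsemigroup.closure (I : Set (X →L[ℂ] X))) : IsNilpotent g := by
  have key : ∃ Y₀ : Submodule ℂ X, FiniteDimensional ℂ Y₀ ∧ ∀ Y : Submodule ℂ X, Y₀ ≤ Y →
      (∀ x, g x ∈ Y) ∧ ∃ k, ∃ e ∈ restrictedEnd I Y ^ (k + 1), ∀ y : Y, (e y : X) = g y := by
    induction hg using Subsemigroup.closure_induction with
    | mem c hc =>
      refine ⟨LinearMap.range c.toLinearMap, hf c hc, fun Y hY => ?_⟩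
      have h1 : ∀ x, c x ∈ Y := fun x => hY ⟨x, rfl⟩
      refine ⟨h1, 0, c.toLinearMap.restrict (p := Y) (q := Y) fun x _ => h1 x, ?_, fun y => rfl⟩
      rw [zero_add, pow_one]
      exact ⟨c, hc, h1, fun y => rfl⟩
    | mul g₁ g₂ _ _ h1 h2 =>
      obtain ⟨Y₁, hf1, h1⟩ := h1
      obtain ⟨Y₂, hf2, h2⟩ := h2
      refine ⟨Y₁ ⊔ Y₂, inferInstance, fun Y hY => ?_⟩
      obtain ⟨r1, k1, e1, he1, h1⟩ := h1 Y (le_sup_left.trans hY)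
      obtain ⟨r2, k2, e2, he2, h2⟩ := h2 Y (le_sup_right.trans hY)
      refine ⟨fun x => r1 _, k1 + 1 + k2, e1 * e2, ?_, fun y => ?_⟩
      · rw [add_assoc, pow_add]
        exact Submodule.mul_mem_mul he1 he2
      · rw [Module.End.mul_apply, h1, h2]; rfl
  obtain ⟨Y, hY, h⟩ := key
  obtain ⟨hr, k, e, he, heg⟩ := h Y le_rfl
  have hnil : IsNilpotent (restrictedEnd I Y) := by
    refine Submodule.isNilpotent_of_jordan _ ?_ ?_
    · rintro a ⟨c, hc, h1, h2⟩ b ⟨d, hd, h3, h4⟩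
      exact ⟨c * d + d * c, hI c hc d hd, fun x => Y.add_mem (h1 _) (h3 _),
        fun y => by simp [h2, h4]⟩
    · rintro a ⟨c, hc, h1, h2⟩
      exact (hq c hc).isNilpotent_of_coe_apply h2
  obtain ⟨n, hn⟩ := hnil
  have hen : e ^ n = 0 := by
    have h1 := Submodule.pow_mem_pow _ he n
    rw [← pow_mul, mul_comm, pow_mul, hn, Submodule.zero_eq_bot, Submodule.bot_pow k.succ_ne_zero]
      at h1
    simpa using h1
  have h2 : ∀ m, ∀ y : Y, ((e ^ m) y : X) = (g ^ m) y := by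
    intro m
    induction m with
    | zero => simp
    | succ m ih => intro y; rw [pow_succ', pow_succ', Module.End.mul_apply, heg, ih]; rfl
  refine ⟨n + 1, ?_⟩
  ext x
  rw [pow_succ, mul_apply_eq_comp, ← h2 n ⟨g x, hr x⟩, hen]
  simp

end FiniteRank

section Path

variable {A : Type*} [NormedRing A] [NormedAlgebra ℂ A] [CompleteSpace A]

/-- The group generated by the exponentials of elements of `J`. -/
def expGroup (J : Submodule ℂ A) : Subgroup Aˣ := Subgroup.closure (expUnit '' (J : Set A))

theorem expUnit_mem_expGroup {J : Submodule ℂ A} {b : A} (hb : b ∈ J) : expUnit b ∈ expGroup J :=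
  Subgroup.subset_closure ⟨b, hb, rfl⟩

theorem expGroup_induction {J : Submodule ℂ A} {p : Aˣ → Prop} (h1 : p 1)
    (hmul : ∀ b ∈ J, ∀ u ∈ expGroup J, p u → p (expUnit b * u)) {u : Aˣ} (hu : u ∈ expGroup J) :
    p u := by
  induction hu using Subgroup.closure_induction_left with
  | one => exact h1
  | mul_left x hx y hy ih =>
    obtain ⟨b, hb, rfl⟩ := hx
    exact hmul b hb y hy ih
  | inv_mul_cancel x hx y hy ih =>
    obtain ⟨b, hb, rfl⟩ := hx
    rw [expUnit_inv]
    exact hmul _ (J.neg_mem hb) y hy ih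

theorem exists_path_to_inverse {J : Submodule ℂ A} {u : Aˣ} (hu : u ∈ expGroup J) :
    ∃ f : ℂ → Aˣ, (∀ z, f z ∈ expGroup J) ∧ Differentiable ℂ (fun z => (f z : A)) ∧
      Differentiable ℂ (fun z => (↑(f z)⁻¹ : A)) ∧ f 0 = u ∧ f 1 = u⁻¹ := by
  have hexp : ∀ (b : A) (g : ℂ → ℂ), Differentiable ℂ g →
      Differentiable ℂ fun z => (expUnit (g z • b) : A) := fun b g hg z =>
    (hasDerivAt_exp_smul_const (𝕂 := ℂ) b (g z)).differentiableAt.comp z (hg z)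
  refine expGroup_induction (p := fun u => ∃ f : ℂ → Aˣ, (∀ z, f z ∈ expGroup J) ∧
      Differentiable ℂ (fun z => (f z : A)) ∧ Differentiable ℂ (fun z => (↑(f z)⁻¹ : A)) ∧
      f 0 = u ∧ f 1 = u⁻¹)
    ⟨fun _ => 1, fun _ => one_mem _, by simp, by simp, rfl, by simp⟩ ?_ hu
  rintro b hb u hu ⟨f, h1, h2, h3, h4, h5⟩
  refine ⟨fun z => expUnit ((1 - z) • b) * f z * expUnit ((-z) • b), fun z => ?_, ?_, ?_, ?_, ?_⟩
  · exact mul_mem (mul_mem (expUnit_mem_expGroup (J.smul_mem _ hb)) (h1 z))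
      (expUnit_mem_expGroup (J.smul_mem _ hb))
  · simp only [Units.val_mul]
    exact ((hexp b _ (by fun_prop)).mul h2).mul (hexp b _ (by fun_prop))
  · simp only [mul_inv_rev, expUnit_inv, ← neg_smul, Units.val_mul]
    exact (hexp b _ (by fun_prop)).mul (h3.mul (hexp b _ (by fun_prop)))
  · have h0 : expUnit (0 : A) = 1 := by ext; simp [expUnit_val]
    simp [h4, h0]
  · have h0 : expUnit (0 : A) = 1 := by ext; simp [expUnit_val]
    simp [h5, h0, expUnit_inv]

theorem Differentiable.exists_ne_zero_and {E F : Type*} [NormedAddCommGroup E] [NormedSpace ℂ E]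
    [CompleteSpace E] [NormedAddCommGroup F] [NormedSpace ℂ F] [CompleteSpace F] {f : ℂ → E}
    {g : ℂ → F} (hf : Differentiable ℂ f) (hg : Differentiable ℂ g) {z w : ℂ} (hz : f z ≠ 0)
    (hw : g w ≠ 0) : ∃ x, f x ≠ 0 ∧ g x ≠ 0 := by
  have hf1 : ∀ᶠ x in 𝓝[≠] (0 : ℂ), f x ≠ 0 := by
    by_contra h
    exact hz ((hf.differentiableOn.analyticOnNhd isOpen_univ).eqOn_zero_of_preconnected_of_frequently_eq_zero
      isPreconnected_univ (mem_univ 0) h (mem_univ z))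
  have hg1 : ∀ᶠ x in 𝓝[≠] (0 : ℂ), g x ≠ 0 := by
    by_contra h
    exact hw ((hg.differentiableOn.analyticOnNhd isOpen_univ).eqOn_zero_of_preconnected_of_frequently_eq_zero
      isPreconnected_univ (mem_univ 0) h (mem_univ w))
  exact (hf1.and hg1).exists

end Path

section EvenProducts

variable {X : Type*} [NormedAddCommGroup X] [NormedSpace ℂ X]
  {J I : Submodule ℂ (X →L[ℂ] X)}

/-- The products of even numbers of elements of `I`. -/
def evenProducts (I : Submodule ℂ (X →L[ℂ] X)) : Subsemigroup (X →L[ℂ] X) :=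
  Subsemigroup.closure {g | ∃ c ∈ I, ∃ d ∈ I, c * d = g}

theorem evenProducts_le : evenProducts I ≤ Subsemigroup.closure (I : Set (X →L[ℂ] X)) := by
  refine Subsemigroup.closure_le.2 ?_
  rintro _ ⟨c, hc, d, hd, rfl⟩
  exact mul_mem (Subsemigroup.subset_closure hc) (Subsemigroup.subset_closure hd)

theorem range_eq_of_finrank_le {g s t : X →L[ℂ] X}
    [FiniteDimensional ℂ (LinearMap.range g.toLinearMap)]
    (h : Module.finrank ℂ (LinearMap.range g.toLinearMap) ≤
      Module.finrank ℂ (LinearMap.range (g * s * t).toLinearMap)) (x : X) :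
    ∃ y, g (s y) = g x := by
  have h1 : LinearMap.range (g * s * t).toLinearMap ≤ LinearMap.range g.toLinearMap := by
    rintro _ ⟨y, rfl⟩; exact ⟨s (t y), rfl⟩
  have h2 := Submodule.eq_of_le_of_finrank_le h1 h
  have h3 : g x ∈ LinearMap.range (g * s * t).toLinearMap := h2 ▸ ⟨x, rfl⟩
  obtain ⟨y, hy⟩ := h3
  exact ⟨t y, hy⟩

variable [CompleteSpace X]

theorem conj_mem_evenProducts (hexp : ∀ b ∈ J, ∀ c ∈ I, exp b * c * exp b ∈ I)
    {u : (X →L[ℂ] X)ˣ} (hu : u ∈ expGroup J) {g : X →L[ℂ] X}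
    (hg : g ∈ evenProducts I) :
    ↑u * g * ↑u⁻¹ ∈ evenProducts I := by
  refine expGroup_induction (p := fun u => ↑u * g * ↑u⁻¹ ∈ evenProducts I) (by simpa using hg)
     (fun b hb u _ ih => ?_) hu
  set g' : X →L[ℂ] X := u * g * ↑u⁻¹ with hg'
  have h1 : (↑(expUnit b * u) * g * ↑(expUnit b * u)⁻¹ : X →L[ℂ] X)
      = expUnit b * g' * ↑(expUnit b)⁻¹ := by
    simp only [hg', mul_inv_rev, Units.val_mul, mul_assoc]
  rw [h1]
  clear_value g'
  clear h1 hg'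
  induction ih using Subsemigroup.closure_induction with
  | mem x hx =>
    obtain ⟨c, hc, d, hd, rfl⟩ := hx
    refine Subsemigroup.subset_closure ⟨_, hexp b hb c hc, _, hexp (-b) (J.neg_mem hb) d hd, ?_⟩
    have h2 : exp b * exp (-b) = 1 := (expUnit b).mul_inv
    rw [expUnit_inv]
    simp only [expUnit_val]
    calc exp b * c * exp b * (exp (-b) * d * exp (-b))
        = exp b * c * (exp b * exp (-b)) * d * exp (-b) := by simp only [mul_assoc]
      _ = _ := by rw [h2, mul_one]; simp only [mul_assoc]
  | mul x y _ _ hx hy =>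
    have := mul_mem hx hy
    simpa [mul_assoc] using this

/-- A nonzero Jordan ideal of quasinilpotent operators of an irreducible Jordan algebra contains
an operator of infinite rank. -/
theorem IrreducibleJordanPair.exists_not_finiteDimensional_range
    (h : IrreducibleJordanPair J I) :
    ¬ ∀ c ∈ I, FiniteDimensional ℂ (LinearMap.range c.toLinearMap) := by
  intro hf
  have hnil : ∀ g ∈ evenProducts I, IsNilpotent g := fun g hg =>
    isNilpotent_of_mem_subsemigroupClosure (fun a ha b hb => h.add_mem a (h.le ha) b hb)
      h.isQuasinilpotent hf (evenProducts_le hg)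
  have hfin : ∀ g ∈ evenProducts I, FiniteDimensional ℂ (LinearMap.range g.toLinearMap) := by
    intro g hg
    induction hg using Subsemigroup.closure_induction with
    | mem g hg =>
      obtain ⟨c, hc, d, hd, rfl⟩ := hg
      have := hf c hc
      exact Submodule.finiteDimensional_of_le (S₂ := LinearMap.range c.toLinearMap)
        (by rintro _ ⟨y, rfl⟩; exact ⟨d y, rfl⟩)
    | mul x y _ _ hx hy =>
      exact Submodule.finiteDimensional_of_le (S₂ := LinearMap.range x.toLinearMap)
        (by rintro _ ⟨z, rfl⟩; exact ⟨y z, rfl⟩)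
  obtain ⟨c, hc, d, hd, hcd⟩ := h.exists_mul_ne_zero
  obtain ⟨g, ⟨hg, hg0⟩, hmin⟩ := exists_minimalFor_of_wellFoundedLT
    (fun g : X →L[ℂ] X => g ∈ evenProducts I ∧ g ≠ 0)
    (fun g => Module.finrank ℂ (LinearMap.range g.toLinearMap))
    ⟨c * d, Subsemigroup.subset_closure ⟨c, hc, d, hd, rfl⟩, hcd⟩
  have hmin' : ∀ k ∈ evenProducts I, k ≠ 0 →
      Module.finrank ℂ (LinearMap.range g.toLinearMap) ≤
        Module.finrank ℂ (LinearMap.range k.toLinearMap) := fun k hk hk0 => by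
    rcases le_total (Module.finrank ℂ (LinearMap.range g.toLinearMap))
      (Module.finrank ℂ (LinearMap.range k.toLinearMap)) with h1 | h1
    · exact h1
    · exact hmin ⟨hk, hk0⟩ h1
  have := hfin g hg
  have hconj : ∀ u ∈ expGroup J, ∀ k ∈ evenProducts I, ↑u * k * ↑u⁻¹ ∈ evenProducts I :=
    fun u hu k hk => conj_mem_evenProducts h.exp_mul_mul_exp_mem hu hk
  have hstep : ∀ u ∈ expGroup J, g * u * g ≠ 0 → ∀ x, ∃ y, g ((u : X →L[ℂ] X) (g y)) = g x := by
    intro u hu hne x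
    have h1 : g * (u * g) * ↑u⁻¹ ∈ evenProducts I := by
      rw [mul_assoc]; exact mul_mem hg (hconj u hu g hg)
    refine range_eq_of_finrank_le (s := (u : X →L[ℂ] X) * g) (t := ↑u⁻¹) (hmin' _ h1 ?_) x
    intro h0
    have h2 : g * (u * g) * ↑u⁻¹ * ↑u = 0 := by rw [h0, zero_mul]
    rw [Units.inv_mul_cancel_right, ← mul_assoc] at h2
    exact hne h2
  have hzero : ∀ u ∈ expGroup J, g * u * g = 0 := by
    intro u hu
    by_contra hne
    obtain ⟨f, hfJ, hf1, hf2, hf3, hf4⟩ := exists_path_to_inverse hu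
    obtain ⟨z, hz1, hz2⟩ := Differentiable.exists_ne_zero_and
      (f := fun z => g * f z * g) (g := fun z => g * ↑(f z)⁻¹ * g) (z := 0) (w := 1)
      ((hf1.const_mul g).mul_const g) ((hf2.const_mul g).mul_const g) (by simpa [hf3] using hne)
      (by simpa [hf4] using hne)
    set v := f z
    set k := g * (v * g * ↑v⁻¹) with hk
    have hkmem : k ∈ evenProducts I := mul_mem hg (hconj v (hfJ z) g hg)
    have hkr : ∀ x, ∃ y, k (g y) = g x := by
      intro x
      obtain ⟨y, hy⟩ := hstep v (hfJ z) hz1 x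
      obtain ⟨y', hy'⟩ := hstep v⁻¹ (inv_mem (hfJ z)) hz2 y
      refine ⟨y', ?_⟩
      rw [← hy, ← hy']
      simp [hk]
    obtain ⟨n, hn⟩ := hnil k hkmem
    have hpow : ∀ m x, ∃ y, (k ^ m) (g y) = g x := by
      intro m
      induction m with
      | zero => exact fun x => ⟨x, rfl⟩
      | succ m ih =>
        intro x
        obtain ⟨y, hy⟩ := ih x
        obtain ⟨y', hy'⟩ := hkr y
        exact ⟨y', by rw [pow_succ, mul_apply_eq_comp, hy', hy]⟩
    apply hg0
    ext x
    obtain ⟨y, hy⟩ := hpow n x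
    rw [← hy, hn]; rfl
  obtain ⟨x, hx⟩ : ∃ x, g x ≠ 0 := by
    by_contra! hx
    exact hg0 (ContinuousLinearMap.ext hx)
  refine hg0 (eq_zero_of_span_apply_topologicalClosure_eq_top (x := g x)
    (G := (fun u : (X →L[ℂ] X)ˣ => (u : X →L[ℂ] X)) '' (expGroup J : Set (X →L[ℂ] X)ˣ))
    (h.dense_span_apply ?_ ⟨1, ⟨1, one_mem _, rfl⟩, hx⟩) ?_)
  · rintro b hb _ ⟨u, hu, rfl⟩
    exact ⟨expUnit b * u, mul_mem (expUnit_mem_expGroup hb) hu, rfl⟩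
  · rintro _ ⟨u, hu, rfl⟩
    exact congr($(hzero u hu) x)

end EvenProducts

section RieszIntegral

theorem ContinuousLinearMap.circleIntegral_comp_comm {E F : Type*} [NormedAddCommGroup E]
    [NormedSpace ℂ E] [CompleteSpace E] [NormedAddCommGroup F] [NormedSpace ℂ F] [CompleteSpace F]
    (L : E →L[ℂ] F) {f : ℂ → E} {c : ℂ} {r : ℝ} (hf : CircleIntegrable f c r) :
    ∮ z in C(c, r), L (f z) = L (∮ z in C(c, r), f z) := by
  rw [circleIntegral, circleIntegral, ← L.intervalIntegral_comp_comm hf.out]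
  simp

variable {A : Type*} [NormedRing A] [NormedAlgebra ℂ A]

/-- The contour integral of the resolvent of `a` along a circle, divided by `2πi`. -/
noncomputable def rieszIntegral (a : A) (c : ℂ) (r : ℝ) : A :=
  (2 * Real.pi * Complex.I : ℂ)⁻¹ • ∮ z in C(c, r), resolvent a z

theorem sub_mul_resolvent {a : A} {z : ℂ} (hz : z ∈ resolventSet ℂ a) (c : ℂ) :
    (a - algebraMap ℂ A c) * resolvent a z = (z - c) • resolvent a z - 1 := by
  have h : (algebraMap ℂ A z - a) * resolvent a z = 1 := Ring.mul_inverse_cancel _ hz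
  rw [Algebra.smul_def, ← h, map_sub]
  noncomm_ring

theorem commute_resolvent {a b : A} (h : Commute b a) (z : ℂ) : Commute b (resolvent a z) := by
  have h1 : Commute b (algebraMap ℂ A z - a) := Commute.sub_right (Algebra.commute_algebraMap_right z b) h
  change Commute b (Ring.inverse (algebraMap ℂ A z - a))
  by_cases hu : IsUnit (algebraMap ℂ A z - a)
  · obtain ⟨u, hu⟩ := hu
    rw [← hu] at h1 ⊢
    rw [Ring.inverse_unit]
    exact h1.units_inv_right
  · rw [Ring.inverse_non_unit _ hu]
    exact Commute.zero_right b

variable [CompleteSpace A]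

theorem continuousOn_resolvent {a : A} {s : Set ℂ} (hs : ∀ z ∈ s, z ∈ resolventSet ℂ a) :
    ContinuousOn (resolvent a) s := fun z hz => by
  obtain ⟨u, hu⟩ := hs z hz
  have h1 := NormedRing.inverse_continuousAt u
  rw [hu] at h1
  exact (ContinuousAt.comp (f := fun z => algebraMap ℂ A z - a) h1 (by fun_prop)).continuousWithinAt

variable {a : A} {c : ℂ} {r : ℝ}

theorem commute_rieszIntegral {b : A} (h : Commute b a) (hr : 0 < r)
    (hs : ∀ z ∈ sphere c r, z ∈ resolventSet ℂ a) : Commute b (rieszIntegral a c r) := by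
  have hi := (continuousOn_resolvent hs).circleIntegrable hr.le
  have h1 := (ContinuousLinearMap.mul ℂ A b).circleIntegral_comp_comm hi
  have h2 := ((ContinuousLinearMap.mul ℂ A).flip b).circleIntegral_comp_comm hi
  simp only [ContinuousLinearMap.mul_apply', ContinuousLinearMap.flip_apply] at h1 h2
  refine Commute.smul_right ?_ _
  rw [Commute, SemiconjBy, ← h1, ← h2]
  exact circleIntegral.integral_congr hr.le fun z _ => commute_resolvent h z

theorem circleIntegral_pow_smul_one (c : ℂ) (r : ℝ) (n : ℕ) :
    ∮ z in C(c, r), (z - c) ^ n • (1 : A) = 0 := by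
  rw [circleIntegral.integral_smul_const]
  have := circleIntegral.integral_sub_zpow_of_ne (n := n) (by lia) c c r
  simp only [zpow_natCast] at this
  rw [this, zero_smul]

theorem pow_mul_rieszIntegral (hr : 0 < r) (hs : ∀ z ∈ sphere c r, z ∈ resolventSet ℂ a) (n : ℕ) :
    (a - algebraMap ℂ A c) ^ n * rieszIntegral a c r =
      (2 * Real.pi * Complex.I : ℂ)⁻¹ • ∮ z in C(c, r), (z - c) ^ n • resolvent a z := by
  have hi : ∀ n : ℕ, CircleIntegrable (fun z => (z - c) ^ n • resolvent a z) c r := fun n =>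
    (ContinuousOn.smul (by fun_prop) (continuousOn_resolvent hs)).circleIntegrable hr.le
  induction n with
  | zero => simp [rieszIntegral]
  | succ n ih =>
    rw [pow_succ', mul_assoc, ih, mul_smul_comm]
    congr 1
    have h1 := (ContinuousLinearMap.mul ℂ A (a - algebraMap ℂ A c)).circleIntegral_comp_comm (hi n)
    simp only [ContinuousLinearMap.mul_apply'] at h1
    rw [← h1]
    have h2 : EqOn (fun z => (a - algebraMap ℂ A c) * (z - c) ^ n • resolvent a z)
        (fun z => (z - c) ^ (n + 1) • resolvent a z - (z - c) ^ n • (1 : A)) (sphere c r) := by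
      intro z hz
      simp only
      rw [mul_smul_comm, sub_mul_resolvent (hs z hz), smul_sub, smul_smul, pow_succ]
    rw [circleIntegral.integral_congr hr.le h2, circleIntegral.integral_sub (hi _)
      (ContinuousOn.circleIntegrable hr.le (by fun_prop)), circleIntegral_pow_smul_one, sub_zero]

theorem exists_norm_resolvent_le (hs : ∀ z ∈ sphere c r, z ∈ resolventSet ℂ a) :
    ∃ M > 0, ∀ z ∈ sphere c r, ‖resolvent a z‖ ≤ M := by
  obtain ⟨M, hM⟩ := (isCompact_sphere c r).exists_bound_of_continuousOn (continuousOn_resolvent hs)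
  exact ⟨max M 1, by positivity, fun z hz => (hM z hz).trans (le_max_left _ _)⟩

theorem exists_norm_pow_mul_rieszIntegral_le (hr : 0 < r)
    (hs : ∀ z ∈ sphere c r, z ∈ resolventSet ℂ a) :
    ∃ C > 0, ∀ n, ‖(a - algebraMap ℂ A c) ^ n * rieszIntegral a c r‖ ≤ C * r ^ n := by
  obtain ⟨M, hM0, hM⟩ := exists_norm_resolvent_le hs
  refine ⟨r * M, by positivity, fun n => ?_⟩
  rw [pow_mul_rieszIntegral hr hs]
  have h := circleIntegral.norm_two_pi_i_inv_smul_integral_le_of_norm_le_const hr.le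
    (f := fun z => (z - c) ^ n • resolvent a z) (C := r ^ n * M) (c := c) fun z hz => by
      rw [norm_smul, norm_pow, mem_sphere_iff_norm.1 hz]
      gcongr
      exact hM z hz
  exact h.trans_eq (by ring)

theorem rieszIntegral_mul_eq_self (hr : 0 < r) (hs : ∀ z ∈ sphere c r, z ∈ resolventSet ℂ a)
    {x : A} {C s : ℝ} (hs0 : 0 ≤ s) (hsr : s < r)
    (hx : ∀ n, ‖(a - algebraMap ℂ A c) ^ n * x‖ ≤ C * s ^ n) : rieszIntegral a c r * x = x := by
  obtain ⟨M, hM0, hM⟩ := exists_norm_resolvent_le hs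
  set N := a - algebraMap ℂ A c with hN
  set κ : ℂ := (2 * Real.pi * Complex.I : ℂ)⁻¹ with hκ
  have hne : ∀ z ∈ sphere c r, z - c ≠ 0 := fun z hz h0 => by
    rw [mem_sphere_iff_norm, h0, norm_zero] at hz; exact hr.ne hz
  have hcont : ∀ n : ℕ, ContinuousOn (fun z => ((z - c) ^ n)⁻¹) (sphere c r) := fun n =>
    ContinuousOn.inv₀ (by fun_prop) fun z hz => pow_ne_zero _ (hne z hz)
  have hi : ∀ n : ℕ, CircleIntegrable
      (fun z => ((z - c) ^ n)⁻¹ • (resolvent a z * (N ^ n * x))) c r := fun n =>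
    (ContinuousOn.smul (hcont n)
      ((continuousOn_resolvent hs).mul continuousOn_const)).circleIntegrable hr.le
  have hcomm : ∀ z, N * resolvent a z = resolvent a z * N := fun z =>
    commute_resolvent ((Commute.refl a).sub_left (Algebra.commute_algebraMap_left c a)) z
  have hstep : ∀ n : ℕ, ∮ z in C(c, r), ((z - c) ^ n)⁻¹ • (resolvent a z * (N ^ n * x)) =
      (∮ z in C(c, r), ((z - c) ^ (n + 1))⁻¹ • (N ^ n * x)) +
      ∮ z in C(c, r), ((z - c) ^ (n + 1))⁻¹ • (resolvent a z * (N ^ (n + 1) * x)) := by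
    intro n
    have hc : CircleIntegrable (fun z => ((z - c) ^ (n + 1))⁻¹ • (N ^ n * x)) c r :=
      ((hcont (n + 1)).smul continuousOn_const).circleIntegrable hr.le
    rw [← circleIntegral.integral_add hc (hi (n + 1))]
    refine circleIntegral.integral_congr hr.le fun z hz => ?_
    rw [pow_succ' N n, mul_assoc N, ← mul_assoc _ N, ← hcomm, sub_mul_resolvent (hs z hz), sub_mul,
      one_mul, smul_sub, add_sub_cancel, smul_mul_assoc, smul_smul, pow_succ, mul_inv,
      inv_mul_cancel_right₀ (hne z hz)]
  have h0 : κ • ∮ z in C(c, r), ((z - c) ^ (0 + 1))⁻¹ • (N ^ 0 * x) = x := by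
    rw [circleIntegral.integral_smul_const]
    simp only [zero_add, pow_one, pow_zero, one_mul]
    rw [circleIntegral.integral_sub_center_inv c hr.ne', smul_smul, hκ, inv_mul_cancel₀, one_smul]
    simp [Real.pi_ne_zero]
  have hpos : ∀ n : ℕ, ∮ z in C(c, r), ((z - c) ^ (n + 1 + 1))⁻¹ • (N ^ (n + 1) * x) = 0 := by
    intro n
    rw [circleIntegral.integral_smul_const]
    have := circleIntegral.integral_sub_zpow_of_ne (n := -((n + 1 + 1 : ℕ) : ℤ)) (by lia) c c r
    simp only [zpow_neg, zpow_natCast] at this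
    rw [this, zero_smul]
  have hP : rieszIntegral a c r * x = κ • ∮ z in C(c, r), resolvent a z * x := by
    have h2 := ((ContinuousLinearMap.mul ℂ A).flip x).circleIntegral_comp_comm
      ((continuousOn_resolvent hs).circleIntegrable hr.le)
    simp only [ContinuousLinearMap.mul_apply', ContinuousLinearMap.flip_apply] at h2
    rw [rieszIntegral, h2, smul_mul_assoc]
  have hall : ∀ n : ℕ, rieszIntegral a c r * x - x =
      κ • ∮ z in C(c, r), ((z - c) ^ (n + 1))⁻¹ • (resolvent a z * (N ^ (n + 1) * x)) := by
    intro n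
    induction n with
    | zero =>
      have := hstep 0
      rw [← add_sub_cancel_left (κ • ∮ z in C(c, r), ((z - c) ^ (0 + 1))⁻¹ • (N ^ 0 * x))
        (κ • ∮ z in C(c, r), ((z - c) ^ (0 + 1))⁻¹ • (resolvent a z * (N ^ (0 + 1) * x))),
        ← smul_add, ← this, h0, hP]
      simp
    | succ n ih => rw [ih, hstep (n + 1), hpos, zero_add]
  have hlim : Tendsto (fun n : ℕ => r * M * (|C| * (s / r) ^ (n + 1))) atTop (𝓝 0) := by
    have h1 := (tendsto_pow_atTop_nhds_zero_of_lt_one (div_nonneg hs0 hr.le)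
      ((div_lt_one hr).2 hsr)).comp (tendsto_add_atTop_nat 1)
    simpa using (h1.const_mul |C|).const_mul (r * M)
  rw [← sub_eq_zero, ← norm_le_zero_iff]
  refine ge_of_tendsto' hlim fun n => ?_
  rw [hall n]
  refine (circleIntegral.norm_two_pi_i_inv_smul_integral_le_of_norm_le_const hr.le
    (C := M * (|C| * (s / r) ^ (n + 1))) fun z hz => ?_).trans_eq (by ring)
  rw [norm_smul, norm_inv, norm_pow, mem_sphere_iff_norm.1 hz, div_pow]
  calc (r ^ (n + 1))⁻¹ * ‖resolvent a z * (N ^ (n + 1) * x)‖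
      ≤ (r ^ (n + 1))⁻¹ * (M * (|C| * s ^ (n + 1))) := by
        gcongr
        refine (norm_mul_le _ _).trans ?_
        gcongr
        · exact hM z hz
        · exact (hx _).trans (by gcongr; exact le_abs_self C)
    _ = _ := by ring

theorem rieszIntegral_one_add (k : A) (hr : 0 < r) (h1 : 1 ∉ sphere c r)
    (hs : ∀ z ∈ sphere c r, z ∈ resolventSet ℂ (1 + k)) : ∃ S : A, rieszIntegral (1 + k) c r =
      ((2 * Real.pi * Complex.I : ℂ)⁻¹ * ∮ z in C(c, r), (z - 1)⁻¹) • (1 : A) + k * S := by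
  have hne : ∀ z ∈ sphere c r, z - 1 ≠ 0 := fun z hz h0 => h1 (by rwa [sub_eq_zero.1 h0] at hz)
  have hcont : ContinuousOn (fun z : ℂ => (z - 1)⁻¹) (sphere c r) :=
    ContinuousOn.inv₀ (by fun_prop) hne
  have hi : CircleIntegrable (fun z => (z - 1)⁻¹ • resolvent (1 + k) z) c r :=
    (hcont.smul (continuousOn_resolvent hs)).circleIntegrable hr.le
  refine ⟨(2 * Real.pi * Complex.I : ℂ)⁻¹ • ∮ z in C(c, r), (z - 1)⁻¹ • resolvent (1 + k) z, ?_⟩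
  have h2 := (ContinuousLinearMap.mul ℂ A k).circleIntegral_comp_comm hi
  simp only [ContinuousLinearMap.mul_apply'] at h2
  rw [rieszIntegral, mul_smul_comm, ← h2, mul_smul, ← circleIntegral.integral_smul_const,
    ← smul_add, ← circleIntegral.integral_add]
  · congr 1
    refine circleIntegral.integral_congr hr.le fun z hz => ?_
    have h3 := sub_mul_resolvent (hs z hz) 1
    rw [map_one, add_sub_cancel_left] at h3
    rw [mul_smul_comm, h3, ← smul_add, add_sub_cancel, smul_smul, inv_mul_cancel₀ (hne z hz),
      one_smul]
  · exact (hcont.smul continuousOn_const).circleIntegrable hr.le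
  · exact ((ContinuousLinearMap.mul ℂ A k).continuous.comp_continuousOn
      (hcont.smul (continuousOn_resolvent hs))).circleIntegrable hr.le

end RieszIntegral

section SpectralSubspace

variable {X : Type*} [NormedAddCommGroup X] [NormedSpace ℂ X]

theorem IsCompactOperator.finiteDimensional_of_apply_eq_self {K : X →L[ℂ] X}
    (hK : IsCompactOperator K) {Y : Submodule ℂ X} (hY : ∀ y ∈ Y, K y = y) :
    FiniteDimensional ℂ Y := by
  set Z := LinearMap.ker (K - 1 : X →L[ℂ] X).toLinearMap with hZ
  have hZK : ∀ z ∈ Z, K z = z := fun z hz => by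
    have : (K - 1 : X →L[ℂ] X) z = 0 := hz
    simpa [sub_eq_zero] using this
  have hid : IsCompactOperator (id : Z → Z) := by
    have h1 := hK.comp_clm Z.subtypeL
    have hmem : ∀ z : Z, (K ∘ Z.subtypeL) z ∈ Z := fun z => by
      change K z ∈ Z
      rw [hZK z z.2]; exact z.2
    have h2 : (id : Z → Z) = Set.codRestrict (K ∘ Z.subtypeL) Z hmem :=
      funext fun z => Subtype.ext (hZK z z.2).symm
    rw [h2]
    exact h1.codRestrict hmem (K - 1 : X →L[ℂ] X).isClosed_ker
  have := FiniteDimensional.of_isCompactOperator_id (𝕜 := ℂ) hid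
  refine Submodule.finiteDimensional_of_le (S₂ := Z) fun y hy => ?_
  change (K - 1 : X →L[ℂ] X) y = 0
  simp [hY y hy]

variable [CompleteSpace X]

theorem rieszIntegral_apply_eq_self {Φ : X →L[ℂ] X} {c : ℂ} {r : ℝ} (hr : 0 < r)
    (hs : ∀ z ∈ sphere c r, z ∈ resolventSet ℂ Φ) {x : X} {C s : ℝ} (hs0 : 0 ≤ s) (hsr : s < r)
    (hx : ∀ n, ‖((Φ - algebraMap ℂ (X →L[ℂ] X) c) ^ n) x‖ ≤ C * s ^ n) :
    rieszIntegral Φ c r x = x := by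
  by_cases hx0 : x = 0
  · simp [hx0]
  obtain ⟨φ, hφ1, hφ⟩ := exists_dual_vector ℂ x (norm_ne_zero_iff.2 hx0)
  have h := rieszIntegral_mul_eq_self hr hs (x := φ.smulRight x) (C := C) hs0 hsr fun n => by
    have h1 : (Φ - algebraMap ℂ (X →L[ℂ] X) c) ^ n * φ.smulRight x =
        φ.smulRight (((Φ - algebraMap ℂ (X →L[ℂ] X) c) ^ n) x) := by ext; simp
    rw [h1, ContinuousLinearMap.norm_smulRight_apply, hφ1, one_mul]
    exact hx n
  have h2 : φ x • rieszIntegral Φ c r x = φ x • x := by simpa using congr($h x)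
  have h3 : φ x ≠ 0 := by rw [hφ]; simpa using hx0
  exact smul_right_injective X h3 h2

/-- A compact perturbation `1 + K` of the identity is, up to a finite rank operator, concentrated
near `1`. -/
theorem IsCompactOperator.exists_finiteDimensional_range_one_sub {K : X →L[ℂ] X}
    (hK : IsCompactOperator K) {ε : ℝ} (hε : 0 < ε) :
    ∃ p : X →L[ℂ] X, FiniteDimensional ℂ (LinearMap.range (1 - p).toLinearMap) ∧ Commute K p ∧
      ∃ C > 0, ∀ n, ‖K ^ n * p‖ ≤ C * ε ^ n ∧ ‖p * K ^ n‖ ≤ C * ε ^ n := by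
  have hcount := countable_spectrum_one_add hK
  obtain ⟨r₁, h0, hr, hs₁⟩ := hcount.exists_sphere_disjoint 1 hε
  obtain ⟨r₂, h12, hr₂, hs₂⟩ := hcount.exists_sphere_disjoint 1 hr
  have key : ∀ r : ℝ, 0 < r → (∀ z ∈ spectrum ℂ (1 + K), dist z 1 ≠ r) →
      ∀ z ∈ sphere (1 : ℂ) r, z ∈ resolventSet ℂ (1 + K) := fun r _ h z hz => by
    by_contra hn
    exact h z hn hz
  have hs₁ := key r₁ h0 hs₁
  have hr20 : 0 < r₂ := h0.trans h12
  have hs₂ := key r₂ hr20 hs₂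
  have hcompact : ∀ r : ℝ, 0 < r → (∀ z ∈ sphere (1 : ℂ) r, z ∈ resolventSet ℂ (1 + K)) →
      IsCompactOperator (1 - rieszIntegral (1 + K) 1 r : X →L[ℂ] X) := by
    intro r hr hs
    obtain ⟨S, hS⟩ := rieszIntegral_one_add K hr (by simp [hr.ne]) hs
    rw [circleIntegral.integral_sub_center_inv _ hr.ne', inv_mul_cancel₀ (by simp [Real.pi_ne_zero]),
      one_smul] at hS
    rw [hS, sub_add_cancel_left]
    exact (hK.mul_right S).neg
  have hsub : (1 + K) - algebraMap ℂ (X →L[ℂ] X) 1 = K := by rw [map_one, add_sub_cancel_left]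
  obtain ⟨C₁, hC₁, hb₁⟩ := exists_norm_pow_mul_rieszIntegral_le h0 hs₁
  obtain ⟨C₂, hC₂, hb₂⟩ := exists_norm_pow_mul_rieszIntegral_le hr20 hs₂
  rw [hsub] at hb₁ hb₂
  have hp : rieszIntegral (1 + K) 1 r₂ * rieszIntegral (1 + K) 1 r₁ = rieszIntegral (1 + K) 1 r₁ :=
    rieszIntegral_mul_eq_self hr20 hs₂ h0.le h12 (by rwa [hsub])
  have hcomm : ∀ n, Commute (K ^ n) (rieszIntegral (1 + K) 1 r₂) := fun n =>
    commute_rieszIntegral ((Commute.one_right _).add_right ((Commute.refl K).pow_left n)) hr20 hs₂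
  have hp' : Commute (rieszIntegral (1 + K) 1 r₂) (rieszIntegral (1 + K) 1 r₁) :=
    commute_rieszIntegral (((Commute.one_left _).add_left (by simpa using hcomm 1)).symm) h0 hs₁
  refine ⟨rieszIntegral (1 + K) 1 r₂, ?_, by simpa using hcomm 1, C₂, hC₂, fun n => ?_⟩
  · refine (hcompact r₁ h0 hs₁).finiteDimensional_of_apply_eq_self ?_
    rintro _ ⟨x, rfl⟩
    have h1 : (1 - rieszIntegral (1 + K) 1 r₁) * (1 - rieszIntegral (1 + K) 1 r₂) =
        1 - rieszIntegral (1 + K) 1 r₂ := by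
      rw [sub_mul, one_mul, mul_sub, ← hp'.eq, hp]; simp
    exact congr($h1 x)
  · have h1 : ‖K ^ n * rieszIntegral (1 + K) 1 r₂‖ ≤ C₂ * ε ^ n :=
      (hb₂ n).trans (by gcongr)
    exact ⟨h1, by rwa [← (hcomm n).eq]⟩

theorem norm_iterate_le_of_commuting {A : Type*} [NormedRing A] {K k : A} {p q c : A}
    {C r : ℝ} (hp : ∀ n, ‖K ^ n * p‖ ≤ C * r ^ n) (hq : ∀ n, ‖q * k ^ n‖ ≤ C * r ^ n)
    {N : A → A} (hN : ∀ y, N y = K * y + y * k + K * y * k) (n : ℕ) :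
    ‖N^[n] (p * c * q)‖ ≤ C * ‖c‖ * C * (2 * r + r ^ 2) ^ n := by
  have key : ∀ n i j, ‖K ^ i * N^[n] (p * c * q) * k ^ j‖ ≤
      C * ‖c‖ * C * (2 * r + r ^ 2) ^ n * r ^ (i + j) := by
    intro n
    induction n with
    | zero =>
      intro i j
      have h1 : K ^ i * (p * c * q) * k ^ j = (K ^ i * p) * c * (q * k ^ j) := by
        simp only [mul_assoc]
      rw [Function.iterate_zero_apply, h1]
      calc _ ≤ ‖K ^ i * p‖ * ‖c‖ * ‖q * k ^ j‖ := norm_mul₃_le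
        _ ≤ (C * r ^ i) * ‖c‖ * (C * r ^ j) := by
          have := (norm_nonneg _).trans (hp i)
          gcongr
          · exact hp i
          · exact hq j
        _ = _ := by rw [pow_zero, pow_add]; ring
    | succ n ih =>
      intro i j
      have h1 : K ^ i * N (N^[n] (p * c * q)) * k ^ j =
          K ^ (i + 1) * N^[n] (p * c * q) * k ^ j + K ^ i * N^[n] (p * c * q) * k ^ (j + 1) +
          K ^ (i + 1) * N^[n] (p * c * q) * k ^ (j + 1) := by
        rw [hN, pow_succ, pow_succ' k]
        noncomm_ring
      rw [Function.iterate_succ_apply', h1]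
      refine (norm_add₃_le).trans ((add_le_add (add_le_add (ih _ _) (ih _ _)) (ih _ _)).trans_eq ?_)
      rw [pow_succ (2 * r + r ^ 2)]
      ring
  simpa using key n 0 0

end SpectralSubspace

theorem rieszIntegral_mem {A : Type*} [NormedRing A] [NormedAlgebra ℂ A] [CompleteSpace A]
    {S : Subalgebra ℂ A} (hS : IsClosed (S : Set A)) {a : A} (ha : a ∈ S)
    (hpre : IsPreconnected (spectrum ℂ a)ᶜ) {c : ℂ} {r : ℝ} (hr : 0 < r)
    (hs : ∀ z ∈ sphere c r, z ∈ resolventSet ℂ a) : rieszIntegral a c r ∈ S := by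
  have : IsClosed (S : Set A) := hS
  have : CompleteSpace S := hS.completeSpace_coe
  have heq := Subalgebra.spectrum_eq_of_isPreconnected_compl S (⟨a, ha⟩ : S) hpre
  have hs' : ∀ z ∈ sphere c r, z ∈ resolventSet ℂ (⟨a, ha⟩ : S) := fun z hz => by
    by_contra hn
    have h1 : z ∈ spectrum ℂ (⟨a, ha⟩ : S) := hn
    rw [heq] at h1
    exact h1 (hs z hz)
  let L : S →L[ℂ] A := ⟨S.val.toLinearMap, continuous_subtype_val⟩
  have h1 := L.circleIntegral_comp_comm
    ((continuousOn_resolvent hs').circleIntegrable hr.le)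
  have h2 : EqOn (resolvent a) (fun z => L (resolvent (⟨a, ha⟩ : S) z))
      (sphere c r) := by
    intro z hz
    obtain ⟨u, hu⟩ := hs' z hz
    have h3 : algebraMap ℂ A z - a = (Units.map S.val.toMonoidHom u : A) := by
      change _ = ((u : S) : A)
      rw [hu]; rfl
    change Ring.inverse (algebraMap ℂ A z - a) = ((Ring.inverse (algebraMap ℂ S z - ⟨a, ha⟩) : S) : A)
    rw [h3, ← hu, Ring.inverse_unit, Ring.inverse_unit]
    rfl
  rw [rieszIntegral, circleIntegral.integral_congr hr.le h2, h1]
  exact S.smul_mem (Subtype.property _) _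

theorem rieszIntegral_apply_mem {A : Type*} [NormedAddCommGroup A] [NormedSpace ℂ A]
    [CompleteSpace A] {I : Submodule ℂ A} (hI : IsClosed (I : Set A)) {Φ : A →L[ℂ] A}
    (hΦ : ∀ c ∈ I, Φ c ∈ I) (hpre : IsPreconnected (spectrum ℂ Φ)ᶜ) {a : ℂ} {r : ℝ} (hr : 0 < r)
    (hs : ∀ z ∈ sphere a r, z ∈ resolventSet ℂ Φ) {c : A} (hc : c ∈ I) :
    rieszIntegral Φ a r c ∈ I := by
  let S : Subalgebra ℂ (A →L[ℂ] A) :=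
    { carrier := {Ψ | ∀ c ∈ I, Ψ c ∈ I}
      mul_mem' := fun {a b} ha hb c hc => ha _ (hb c hc)
      add_mem' := fun {a b} ha hb c hc => I.add_mem (ha c hc) (hb c hc)
      algebraMap_mem' := fun z c hc => by
        simpa [Algebra.algebraMap_eq_smul_one] using I.smul_mem z hc }
  have hS : IsClosed (S : Set (A →L[ℂ] A)) := by
    have : (S : Set (A →L[ℂ] A)) = ⋂ c ∈ I, {Ψ | Ψ c ∈ I} := by
      ext Ψ; rw [mem_iInter₂]; exact Iff.rfl
    rw [this]
    exact isClosed_biInter fun c _ => hI.preimage (by fun_prop : Continuous fun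
      Ψ : A →L[ℂ] A => Ψ c)
  exact rieszIntegral_mem hS (a := Φ) hΦ hpre hr hs c hc

theorem ContinuousLinearMap.pow_apply_eq_iterate {A : Type*} [NormedAddCommGroup A]
    [NormedSpace ℂ A] (Φ : A →L[ℂ] A) (n : ℕ) (x : A) : (Φ ^ n) x = Φ^[n] x := by
  induction n with
  | zero => rfl
  | succ n ih => rw [pow_succ', Function.iterate_succ_apply', ← ih]; rfl

theorem finiteDimensional_range_of_mul_mul_eq_zero {X : Type*} [NormedAddCommGroup X]
    [NormedSpace ℂ X] {p q d : X →L[ℂ] X}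
    (hp : FiniteDimensional ℂ (LinearMap.range (1 - p).toLinearMap))
    (hq : FiniteDimensional ℂ (LinearMap.range (1 - q).toLinearMap)) (h : p * d * q = 0) :
    FiniteDimensional ℂ (LinearMap.range d.toLinearMap) := by
  have h1 : d = (1 - p) * d + p * d * (1 - q) := by
    rw [mul_sub _ _ q, h]
    noncomm_ring
  refine Submodule.finiteDimensional_of_le (S₂ := LinearMap.range (1 - p).toLinearMap ⊔
    (LinearMap.range (1 - q).toLinearMap).map (p * d).toLinearMap) ?_
  rintro _ ⟨x, rfl⟩
  rw [show d.toLinearMap x = ((1 - p) * d + p * d * (1 - q)) x from congr($h1 x)]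
  exact Submodule.add_mem_sup ⟨d x, rfl⟩ ⟨_, ⟨x, rfl⟩, rfl⟩

section

variable {A : Type*} [NormedRing A] [NormedAlgebra ℂ A] [CompleteSpace A] {w v : A} {r : ℝ}

/-- The Riesz projection of `c ↦ w * c * v` around `1` fixes `p * c * q`, if `w` and `v` are close
to `1` on the ranges of `p` and `q`. -/
theorem mul_sub_rieszIntegral_mul_eq_zero {p q : A} (hp : Commute (w - 1) p)
    (hq : Commute (v - 1) q) {C δ : ℝ} (hδ : 0 ≤ δ) (hδr : 2 * δ + δ ^ 2 < r)
    (hp' : ∀ n, ‖(w - 1) ^ n * p‖ ≤ C * δ ^ n) (hq' : ∀ n, ‖q * (v - 1) ^ n‖ ≤ C * δ ^ n)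
    (hs : ∀ z ∈ sphere (1 : ℂ) r, z ∈ resolventSet ℂ (mulLeftRightCLM w v)) (c : A) :
    p * (c - rieszIntegral (mulLeftRightCLM w v) 1 r c) * q = 0 := by
  have hr : 0 < r := lt_of_le_of_lt (by positivity) hδr
  have hN : ∀ y, (mulLeftRightCLM w v - 1) y =
      (w - 1) * y + y * (v - 1) + (w - 1) * y * (v - 1) := fun y => by
    rw [sub_apply, mulLeftRightCLM_apply, one_apply_eq_self]
    noncomm_ring
  have h0 : rieszIntegral (mulLeftRightCLM w v) 1 r (p * c * q) = p * c * q := by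
    refine rieszIntegral_apply_eq_self hr hs (s := 2 * δ + δ ^ 2) (by positivity) hδr
      (C := C * ‖c‖ * C) fun n => ?_
    rw [map_one, ContinuousLinearMap.pow_apply_eq_iterate]
    exact norm_iterate_le_of_commuting hp' hq' hN n
  have h1 : Commute (mulLeftRightCLM p q) (mulLeftRightCLM w v) := by
    have hpw : Commute p w := by simpa using (hp.add_left (Commute.one_left p)).symm
    have hqv : Commute q v := by simpa using (hq.add_left (Commute.one_left q)).symm
    ext1 y
    simp only [mul_apply_eq_comp, mulLeftRightCLM_apply]
    rw [← mul_assoc, ← mul_assoc, hpw.eq, mul_assoc _ v q, ← hqv.eq]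
    simp only [mul_assoc]
  have h2 := congr($((commute_rieszIntegral h1 hr hs).eq) c)
  simp only [mul_apply_eq_comp, mulLeftRightCLM_apply] at h2
  rw [mul_sub, sub_mul, h2, h0, sub_self]

theorem exists_norm_pow_apply_le_of_rieszIntegral_apply_eq_self (hr : 0 < r)
    (hs : ∀ z ∈ sphere (1 : ℂ) r, z ∈ resolventSet ℂ (mulLeftRightCLM w v)) {c : A}
    (hc : rieszIntegral (mulLeftRightCLM w v) 1 r c = c) :
    ∃ C, ∀ n, ‖((mulLeftRightCLM w v - 1) ^ n) c‖ ≤ C * r ^ n := by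
  obtain ⟨C, hC, hb⟩ := exists_norm_pow_mul_rieszIntegral_le hr hs
  refine ⟨C * ‖c‖, fun n => ?_⟩
  rw [map_one] at hb
  generalize mulLeftRightCLM w v = Φ at *
  have h1 : ((Φ - 1) ^ n) c = ((Φ - 1) ^ n * rieszIntegral Φ 1 r) c := by
    rw [mul_apply_eq_comp, hc]
  rw [h1]
  refine (ContinuousLinearMap.le_opNorm _ _).trans ?_
  rw [mul_right_comm]
  gcongr
  exact hb n

end

theorem finiteDimensional_range_sub_rieszIntegral {X : Type*} [NormedAddCommGroup X]
    [NormedSpace ℂ X] [CompleteSpace X] {w v : X →L[ℂ] X}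
    (hw : IsCompactOperator (w - 1 : X →L[ℂ] X)) (hv : IsCompactOperator (v - 1 : X →L[ℂ] X))
    {r : ℝ} (hr : 0 < r)
    (hs : ∀ z ∈ sphere (1 : ℂ) r, z ∈ resolventSet ℂ (mulLeftRightCLM w v)) (c : X →L[ℂ] X) :
    FiniteDimensional ℂ
      (LinearMap.range (c - rieszIntegral (mulLeftRightCLM w v) 1 r c).toLinearMap) := by
  have hδ0 : 0 < min 1 (r / 6) := by positivity
  have hδr : 2 * min 1 (r / 6) + min 1 (r / 6) ^ 2 < r := by
    have h1 : min 1 (r / 6) ≤ 1 := min_le_left _ _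
    have h2 : min 1 (r / 6) ≤ r / 6 := min_le_right _ _
    nlinarith
  obtain ⟨p, hp, hpK, C₁, hC₁, hb₁⟩ := hw.exists_finiteDimensional_range_one_sub hδ0
  obtain ⟨q, hq, hqK, C₂, hC₂, hb₂⟩ := hv.exists_finiteDimensional_range_one_sub hδ0
  exact finiteDimensional_range_of_mul_mul_eq_zero hp hq
    (mul_sub_rieszIntegral_mul_eq_zero hpK hqK hδ0.le hδr (C := max C₁ C₂)
      (fun n => (hb₁ n).1.trans (by gcongr; exact le_max_left _ _))
      (fun n => (hb₂ n).2.trans (by gcongr; exact le_max_right _ _)) hs c)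

section Twist

variable {X : Type*} [NormedAddCommGroup X] [NormedSpace ℂ X]

/-- A pair of compact perturbations of the identity intertwining `I` with itself. -/
structure Twist (I : Submodule ℂ (X →L[ℂ] X)) (w w' : (X →L[ℂ] X)ˣ) : Prop where
  isCompactOperator_left : IsCompactOperator (w - 1 : X →L[ℂ] X)
  isCompactOperator_right : IsCompactOperator (w' - 1 : X →L[ℂ] X)
  mul_mul_inv_mem : ∀ c ∈ I, ↑w * c * ↑w'⁻¹ ∈ I
  mul_mul_inv_mem' : ∀ c ∈ I, ↑w' * c * ↑w⁻¹ ∈ I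

theorem isCompactOperator_inv_sub_one {w : (X →L[ℂ] X)ˣ}
    (hw : IsCompactOperator (w - 1 : X →L[ℂ] X)) : IsCompactOperator (↑w⁻¹ - 1 : X →L[ℂ] X) := by
  have h := (hw.mul_left (↑w⁻¹ : X →L[ℂ] X)).neg
  have h1 : (↑w⁻¹ - 1 : X →L[ℂ] X) = -(↑w⁻¹ * (w - 1)) := by
    rw [mul_sub, Units.inv_mul, mul_one, neg_sub]
  rw [h1]
  exact h

theorem isCompactOperator_mul_sub_one {w v : (X →L[ℂ] X)ˣ}
    (hw : IsCompactOperator (w - 1 : X →L[ℂ] X)) (hv : IsCompactOperator (v - 1 : X →L[ℂ] X)) :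
    IsCompactOperator (↑(w * v) - 1 : X →L[ℂ] X) := by
  have h1 : (↑(w * v) - 1 : X →L[ℂ] X) = (w - 1) * v + (v - 1) := by
    rw [Units.val_mul, sub_mul, one_mul, sub_add_sub_cancel]
  rw [h1]
  exact (hw.mul_right _).add hv

namespace Twist

variable {I : Submodule ℂ (X →L[ℂ] X)} {w w' v v' : (X →L[ℂ] X)ˣ}

theorem symm (h : Twist I w w') : Twist I w' w :=
  ⟨h.2, h.1, h.4, h.3⟩

theorem mul (h : Twist I w w') (h' : Twist I v v') : Twist I (w * v) (w' * v') := by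
  refine ⟨isCompactOperator_mul_sub_one h.1 h'.1, isCompactOperator_mul_sub_one h.2 h'.2,
    fun c hc => ?_, fun c hc => ?_⟩
  · simpa [mul_assoc] using h.3 _ (h'.3 c hc)
  · simpa [mul_assoc] using h.4 _ (h'.4 c hc)

theorem one : Twist I 1 1 := by
  have h0 : IsCompactOperator (0 : X →L[ℂ] X) := isCompactOperator_zero
  exact ⟨by simpa using h0, by simpa using h0, by simp, by simp⟩

variable [CompleteSpace X]

theorem countable_spectrum_left (h : Twist I w w') : (spectrum ℂ (w : X →L[ℂ] X)).Countable := by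
  have := countable_spectrum_one_add h.1
  rwa [add_sub_cancel] at this

theorem exists_norm_pow_apply_le (h : Twist I w w') (hI : IsClosed (I : Set (X →L[ℂ] X)))
    (hfin : ∀ c ∈ I, FiniteDimensional ℂ (LinearMap.range c.toLinearMap) → c = 0)
    {c : X →L[ℂ] X} (hc : c ∈ I) {ε : ℝ} (hε : 0 < ε) :
    ∃ C, ∀ n, ‖((mulLeftRightCLM (w : X →L[ℂ] X) ↑w'⁻¹ - 1) ^ n) c‖ ≤ C * ε ^ n := by
  have hvK : IsCompactOperator (↑w'⁻¹ - 1 : X →L[ℂ] X) := isCompactOperator_inv_sub_one h.2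
  have hΦI : ∀ c ∈ I, mulLeftRightCLM (w : X →L[ℂ] X) ↑w'⁻¹ c ∈ I := fun c hc => by
    rw [mulLeftRightCLM_apply]; exact h.3 c hc
  have hcount : (spectrum ℂ (mulLeftRightCLM (w : X →L[ℂ] X) ↑w'⁻¹)).Countable :=
    countable_spectrum_mulLeftRightCLM h.countable_spectrum_left (by
      have := countable_spectrum_one_add hvK
      rwa [add_sub_cancel] at this)
  obtain ⟨r, hr, hrε, hrs⟩ := hcount.exists_sphere_disjoint 1 hε
  have hs : ∀ z ∈ sphere (1 : ℂ) r, z ∈ resolventSet ℂ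
      (mulLeftRightCLM (w : X →L[ℂ] X) ↑w'⁻¹) := fun z hz => by
    by_contra hn
    exact hrs z hn hz
  have hR := hfin _ (I.sub_mem hc
    (rieszIntegral_apply_mem hI hΦI hcount.isPreconnected_compl hr hs hc))
    (finiteDimensional_range_sub_rieszIntegral h.1 hvK hr hs c)
  obtain ⟨C, hC⟩ := exists_norm_pow_apply_le_of_rieszIntegral_apply_eq_self hr hs
    (sub_eq_zero.1 hR).symm
  have hC0 : 0 ≤ C := by simpa using (norm_nonneg _).trans (hC 0)
  exact ⟨C, fun n => (hC n).trans (by gcongr)⟩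

end Twist

end Twist

section QuasinilpotentPart

variable {X : Type*} [NormedAddCommGroup X] [NormedSpace ℂ X]

/-- The vectors on which the powers of `a` decay faster than any geometric sequence. -/
def quasinilpotentPart (a : X →L[ℂ] X) : Submodule ℂ X where
  carrier := {x | ∀ ε > 0, ∃ C, ∀ n, ‖(a ^ n) x‖ ≤ C * ε ^ n}
  zero_mem' := fun ε _ => ⟨0, by simp⟩
  add_mem' := by
    intro x y hx hy ε hε
    obtain ⟨C, hC⟩ := hx ε hε
    obtain ⟨D, hD⟩ := hy ε hε
    refine ⟨C + D, fun n => ?_⟩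
    rw [map_add, add_mul]
    exact (norm_add_le _ _).trans (add_le_add (hC n) (hD n))
  smul_mem' := by
    intro z x hx ε hε
    obtain ⟨C, hC⟩ := hx ε hε
    refine ⟨‖z‖ * C, fun n => ?_⟩
    rw [map_smul, norm_smul, mul_assoc]
    gcongr
    exact hC n

theorem mem_quasinilpotentPart_of_apply_eq_zero {a : X →L[ℂ] X} {x : X} (hx : a x = 0) :
    x ∈ quasinilpotentPart a := fun ε hε => ⟨‖x‖, fun n => by
  cases n with
  | zero => simp
  | succ n =>
    rw [pow_succ, mul_apply_eq_comp, hx, map_zero, norm_zero]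
    positivity⟩

theorem norm_pow_apply_apply_le {a a' : X →L[ℂ] X} {d : ℕ → X →L[ℂ] X} {x : X} {C D ε : ℝ}
    (hd : ∀ k, a * d k = d (k + 1) + d k * a') (hC : ∀ k, ‖d k‖ ≤ C * ε ^ k)
    (hD : ∀ j, ‖(a' ^ j) x‖ ≤ D * ε ^ j) (n : ℕ) :
    ‖(a ^ n) (d 0 x)‖ ≤ C * D * (2 * ε) ^ n := by
  have key : ∀ n k j, ‖(a ^ n) (d k ((a' ^ j) x))‖ ≤ C * ε ^ k * (D * ε ^ j) * (2 * ε) ^ n := by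
    intro n
    induction n with
    | zero =>
      intro k j
      rw [pow_zero, pow_zero, mul_one, one_apply_eq_self]
      refine ((d k).le_opNorm _).trans ?_
      have := (norm_nonneg _).trans (hC k)
      gcongr
      · exact hC k
      · exact hD j
    | succ n ih =>
      intro k j
      have h1 : (a ^ (n + 1)) (d k ((a' ^ j) x)) =
          (a ^ n) (d (k + 1) ((a' ^ j) x)) + (a ^ n) (d k ((a' ^ (j + 1)) x)) := by
        rw [pow_succ, mul_apply_eq_comp, ← mul_apply_eq_comp a, hd, ← map_add, pow_succ' a']
        rfl
      rw [h1]
      refine (norm_add_le _ _).trans ((add_le_add (ih _ _) (ih _ _)).trans_eq ?_)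
      rw [pow_succ (2 * ε), pow_succ ε, pow_succ ε]
      ring
  simpa using key n 0 0

variable [CompleteSpace X]

theorem IsCompactOperator.finiteDimensional_quasinilpotentPart {K : X →L[ℂ] X}
    (hK : IsCompactOperator K) {ν : ℂ} (hν : ν ≠ 1) :
    FiniteDimensional ℂ (quasinilpotentPart (1 + K - algebraMap ℂ (X →L[ℂ] X) ν)) := by
  have h1 : 0 < ‖1 - ν‖ := norm_pos_iff.2 (sub_ne_zero.2 hν.symm)
  obtain ⟨r, hr, hr1, hrs⟩ := (countable_spectrum_one_add hK).exists_sphere_disjoint ν h1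
  have hs : ∀ z ∈ sphere ν r, z ∈ resolventSet ℂ (1 + K) := fun z hz => by
    by_contra hn
    exact hrs z hn hz
  have hout : ∀ z ∈ closedBall ν r, z ≠ 1 := by
    rintro z hz rfl
    rw [mem_closedBall, dist_eq_norm] at hz
    linarith
  obtain ⟨S, hS⟩ := rieszIntegral_one_add K hr (fun h => hout 1 (sphere_subset_closedBall h) rfl) hs
  have h0 : (∮ z in C(ν, r), (z - 1)⁻¹) = 0 := by
    refine Complex.circleIntegral_eq_zero_of_differentiable_on_off_countable hr.le
      countable_empty ?_ ?_
    · exact ContinuousOn.inv₀ (by fun_prop) fun z hz => sub_ne_zero.2 (hout z hz)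
    · intro z hz
      exact DifferentiableAt.inv (by fun_prop)
        (sub_ne_zero.2 (hout z (ball_subset_closedBall hz.1)))
  rw [h0, mul_zero, zero_smul, zero_add] at hS
  refine (hK.mul_right S).finiteDimensional_of_apply_eq_self fun y hy => ?_
  obtain ⟨C, hC⟩ := hy (r / 2) (half_pos hr)
  rw [← hS]
  exact rieszIntegral_apply_eq_self hr hs (half_pos hr).le (half_lt_self hr) hC

end QuasinilpotentPart

namespace Twist

variable {X : Type*} [NormedAddCommGroup X] [NormedSpace ℂ X] [CompleteSpace X]
  {J I : Submodule ℂ (X →L[ℂ] X)} {w w' : (X →L[ℂ] X)ˣ}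

theorem apply_mem_quasinilpotentPart (h : Twist I w w') (hI : IsClosed (I : Set (X →L[ℂ] X)))
    (hfin : ∀ c ∈ I, FiniteDimensional ℂ (LinearMap.range c.toLinearMap) → c = 0)
    {c : X →L[ℂ] X} (hc : c ∈ I) {ν : ℂ} {x : X}
    (hx : x ∈ quasinilpotentPart ((w' : X →L[ℂ] X) - algebraMap ℂ (X →L[ℂ] X) ν)) :
    c x ∈ quasinilpotentPart ((w : X →L[ℂ] X) - algebraMap ℂ (X →L[ℂ] X) ν) := by
  intro ε hε
  obtain ⟨D, hD⟩ := hx (ε / 2) (half_pos hε)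
  obtain ⟨C, hC⟩ := h.exists_norm_pow_apply_le hI hfin hc (ε := ε / 2 / (‖(w' : X →L[ℂ] X)‖ + 1))
    (by positivity)
  refine ⟨C * D, fun n => ?_⟩
  have h2 := norm_pow_apply_apply_le (a := (w : X →L[ℂ] X) - algebraMap ℂ (X →L[ℂ] X) ν)
    (a' := (w' : X →L[ℂ] X) - algebraMap ℂ (X →L[ℂ] X) ν)
    (d := fun k => ((mulLeftRightCLM (w : X →L[ℂ] X) ↑w'⁻¹ - 1) ^ k) c * (w' : X →L[ℂ] X) ^ k)
    (C := C) (D := D) (ε := ε / 2) (x := x) ?_ ?_ hD n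
  · rw [mul_div_cancel₀ _ two_ne_zero] at h2
    simpa using h2
  · intro k
    have h3 : ((mulLeftRightCLM (w : X →L[ℂ] X) ↑w'⁻¹ - 1) ^ (k + 1)) c =
        w * ((mulLeftRightCLM (w : X →L[ℂ] X) ↑w'⁻¹ - 1) ^ k) c * ↑w'⁻¹ -
        ((mulLeftRightCLM (w : X →L[ℂ] X) ↑w'⁻¹ - 1) ^ k) c := by
      rw [pow_succ', mul_apply_eq_comp, sub_apply, mulLeftRightCLM_apply, one_apply_eq_self]
    rw [h3]
    generalize ((mulLeftRightCLM (w : X →L[ℂ] X) ↑w'⁻¹ - 1) ^ k) c = y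
    have h4 : (w : X →L[ℂ] X) * y * ↑w'⁻¹ * (w' : X →L[ℂ] X) ^ (k + 1) =
        w * y * (w' : X →L[ℂ] X) ^ k := by
      rw [pow_succ', mul_assoc _ (↑w'⁻¹ : X →L[ℂ] X), Units.inv_mul_cancel_left]
    rw [sub_mul (w * y * _ : X →L[ℂ] X), h4, sub_mul, mul_sub, pow_succ,
      (Algebra.commutes ν _ : algebraMap ℂ (X →L[ℂ] X) ν * _ = _)]
    noncomm_ring
  · intro k
    refine (norm_mul_le _ _).trans ?_
    have h5 : ‖(w' : X →L[ℂ] X) ^ k‖ ≤ (‖(w' : X →L[ℂ] X)‖ + 1) ^ k := by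
      cases k with
      | zero =>
        rw [pow_zero, pow_zero]
        exact ContinuousLinearMap.norm_id_le
      | succ k =>
        refine (norm_pow_le' _ k.succ_pos).trans ?_
        gcongr
        linarith
    calc _ ≤ C * (ε / 2 / (‖(w' : X →L[ℂ] X)‖ + 1)) ^ k * (‖(w' : X →L[ℂ] X)‖ + 1) ^ k := by
          have := (norm_nonneg _).trans (hC k)
          gcongr
          exact hC k
      _ = _ := by
          rw [mul_assoc, ← mul_pow, div_mul_cancel₀ _ (by positivity)]

theorem finiteDimensional_quasinilpotentPart (h : Twist I w w') {ν : ℂ} (hν : ν ≠ 1) :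
    FiniteDimensional ℂ (quasinilpotentPart ((w : X →L[ℂ] X) - algebraMap ℂ (X →L[ℂ] X) ν)) := by
  have := h.1.finiteDimensional_quasinilpotentPart hν
  rwa [add_sub_cancel] at this

end Twist

namespace IrreducibleJordanPair

variable {X : Type*} [NormedAddCommGroup X] [NormedSpace ℂ X]
  {J I : Submodule ℂ (X →L[ℂ] X)} {w w' : (X →L[ℂ] X)ˣ}

theorem eq_bot_of_invariant (h : IrreducibleJordanPair J I) {Y : Submodule ℂ X}
    [FiniteDimensional ℂ Y] (hY : ∀ c ∈ I, ∀ y ∈ Y, c y ∈ Y) : Y = ⊥ := by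
  by_contra hne
  have : Nontrivial Y := Submodule.nontrivial_iff_ne_bot.2 hne
  let W : Submodule ℂ (Module.End ℂ Y) :=
    { carrier := {e | ∃ c ∈ I, ∀ y, (e y : X) = c y}
      zero_mem' := ⟨0, I.zero_mem, by simp⟩
      add_mem' := by
        rintro e f ⟨c, hc, hec⟩ ⟨d, hd, hfd⟩
        exact ⟨c + d, I.add_mem hc hd, fun y => by simp [hec, hfd]⟩
      smul_mem' := by
        rintro z e ⟨c, hc, hec⟩
        exact ⟨z • c, I.smul_mem z hc, fun y => by simp [hec]⟩ }
  obtain ⟨v, hv0, hv⟩ := exists_common_kernel_of_jordan W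
    (by
      rintro e ⟨c, hc, hec⟩ f ⟨d, hd, hfd⟩
      exact ⟨c * d + d * c, h.add_mem c (h.le hc) d hd, fun y => by simp [hec, hfd]⟩)
    (by
      rintro e ⟨c, hc, hec⟩
      exact (h.isQuasinilpotent c hc).isNilpotent_of_coe_apply hec)
  refine hv0 (Subtype.ext (h.eq_zero_of_forall_apply_eq_zero fun c hc => ?_))
  have := congr(($(hv (c.toLinearMap.restrict (hY c hc)) ⟨c, hc, fun y => rfl⟩) : X))
  simpa using this

variable [CompleteSpace X]

theorem quasinilpotentPart_eq_bot_of_twist (h : IrreducibleJordanPair J I)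
    (hI : IsClosed (I : Set (X →L[ℂ] X)))
    (hfin : ∀ c ∈ I, FiniteDimensional ℂ (LinearMap.range c.toLinearMap) → c = 0)
    (hw : Twist I w w') {ν : ℂ} (hν : ν ≠ 1) :
    quasinilpotentPart ((w : X →L[ℂ] X) - algebraMap ℂ (X →L[ℂ] X) ν) = ⊥ := by
  have h1 := hw.finiteDimensional_quasinilpotentPart hν
  have h2 := hw.symm.finiteDimensional_quasinilpotentPart hν
  have h3 := fun c hc x => hw.apply_mem_quasinilpotentPart hI hfin (c := c) hc (ν := ν) (x := x)
  have h4 := fun c hc x =>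
    hw.symm.apply_mem_quasinilpotentPart hI hfin (c := c) hc (ν := ν) (x := x)
  generalize quasinilpotentPart ((w : X →L[ℂ] X) - algebraMap ℂ (X →L[ℂ] X) ν) = V at *
  generalize quasinilpotentPart ((w' : X →L[ℂ] X) - algebraMap ℂ (X →L[ℂ] X) ν) = V' at *
  have hbot : V ⊔ V' = ⊥ := h.eq_bot_of_invariant fun c hc y hy => by
    obtain ⟨y₁, hy₁, y₂, hy₂, rfl⟩ := Submodule.mem_sup.1 hy
    rw [map_add, add_comm]
    exact Submodule.add_mem_sup (h3 c hc _ hy₂) (h4 c hc _ hy₁)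
  exact (sup_eq_bot_iff.1 hbot).1

theorem isQuasinilpotent_sub_one_of_twist (h : IrreducibleJordanPair J I)
    (hI : IsClosed (I : Set (X →L[ℂ] X)))
    (hfin : ∀ c ∈ I, FiniteDimensional ℂ (LinearMap.range c.toLinearMap) → c = 0)
    (hw : Twist I w w') : IsQuasinilpotent (w - 1 : X →L[ℂ] X) := by
  rw [isQuasinilpotent_iff_spectrum_subset]
  intro z hz
  by_contra hz0
  obtain ⟨x, hx, hx0⟩ : ∃ x, (w - 1 : X →L[ℂ] X) x = z • x ∧ x ≠ 0 := by
    obtain ⟨x, hx⟩ := ((hw.1.hasEigenvalue_iff_mem_spectrum hz0).2 hz).exists_hasEigenvector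
    exact ⟨x, hx.apply_eq_smul, hx.2⟩
  have hbot := h.quasinilpotentPart_eq_bot_of_twist hI hfin hw (ν := 1 + z) (by simpa using hz0)
  refine hx0 ?_
  rw [← Submodule.mem_bot ℂ, ← hbot]
  refine mem_quasinilpotentPart_of_apply_eq_zero ?_
  rw [map_add, map_one, ← sub_sub, sub_apply, hx, Algebra.algebraMap_eq_smul_one]
  simp

/-- The ideal of an irreducible pair contains no finite rank operators. -/
theorem eq_zero_of_finiteDimensional_range (h : IrreducibleJordanPair J I) :
    ∀ c ∈ I, FiniteDimensional ℂ (LinearMap.range c.toLinearMap) → c = 0 := by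
  intro c₀ hc₀ hfin₀
  by_contra h0
  let I' : Submodule ℂ (X →L[ℂ] X) :=
    { carrier := {c | c ∈ I ∧ FiniteDimensional ℂ (LinearMap.range c.toLinearMap)}
      zero_mem' := ⟨I.zero_mem, Submodule.finiteDimensional_of_le (S₂ := ⊥) (by
        rintro _ ⟨x, rfl⟩; simp)⟩
      add_mem' := by
        rintro a b ⟨ha, ha'⟩ ⟨hb, hb'⟩
        exact ⟨I.add_mem ha hb, Submodule.finiteDimensional_of_le
          (LinearMap.range_add_le a.toLinearMap b.toLinearMap)⟩
      smul_mem' := by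
        rintro z a ⟨ha, ha'⟩
        refine ⟨I.smul_mem z ha, Submodule.finiteDimensional_of_le
          (S₂ := LinearMap.range a.toLinearMap) ?_⟩
        rintro _ ⟨x, rfl⟩
        exact ⟨z • x, by simp⟩ }
  have hle : I' ≤ I := fun c hc => hc.1
  have hmul : ∀ c ∈ I', ∀ a b : X →L[ℂ] X,
      FiniteDimensional ℂ (LinearMap.range (a * c * b).toLinearMap) := by
    rintro c ⟨-, hc⟩ a b
    refine Submodule.finiteDimensional_of_le
      (S₂ := (LinearMap.range c.toLinearMap).map a.toLinearMap) ?_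
    rintro _ ⟨x, rfl⟩
    exact ⟨_, ⟨b x, rfl⟩, rfl⟩
  have h' : IrreducibleJordanPair J I' :=
    { h with
      le := hle.trans h.le
      add_mem := fun b hb c hc => by
        refine ⟨h.add_mem b hb c hc.1, ?_⟩
        have h1 := hmul c hc b 1
        have h2 := hmul c hc 1 b
        rw [mul_one] at h1
        rw [one_mul] at h2
        exact Submodule.finiteDimensional_of_le
          (LinearMap.range_add_le (b * c).toLinearMap (c * b).toLinearMap)
      exp_mul_mul_exp_mem := fun b hb c hc => ⟨h.exp_mul_mul_exp_mem b hb c hc.1, hmul c hc _ _⟩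
      isQuasinilpotent := fun c hc => h.isQuasinilpotent c hc.1
      ne_bot := fun hbot => h0 (by
        have : c₀ ∈ I' := ⟨hc₀, hfin₀⟩
        rwa [hbot] at this) }
  exact h'.exists_not_finiteDimensional_range fun c hc => hc.2

end IrreducibleJordanPair

section CompactWords

variable {X : Type*} [NormedAddCommGroup X] [NormedSpace ℂ X]

/-- Two-sided multiplication by compact operators maps balls to totally bounded sets. -/
theorem IsCompactOperator.totallyBounded_mul_mul {S T : X →L[ℂ] X} (hS : IsCompactOperator S)
    (hT : IsCompactOperator T) (R : ℝ) :
    TotallyBounded ((fun D : X →L[ℂ] X => S * D * T) '' closedBall 0 R) := by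
  classical
  refine Metric.totallyBounded_of_finite_discretization fun ε hε => ?_
  set η : ℝ := ε / (4 * (‖S‖ * (|R| + 1) + 2)) with hη
  have hη0 : 0 < η := by positivity
  obtain ⟨t, ht, htc⟩ := Metric.totallyBounded_iff.1
    ((hT.isCompact_closure_image_closedBall 1).totallyBounded.subset subset_closure) η hη0
  obtain ⟨t', ht', htc'⟩ := Metric.totallyBounded_iff.1
    ((hS.isCompact_closure_image_closedBall ((|R| + 1) * (‖T‖ + η + 1))).totallyBounded.subset
      subset_closure) η hη0
  set t₁ := {y ∈ t | ‖y‖ ≤ ‖T‖ + η} with ht₁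
  have hfin₁ : t₁.Finite := ht.subset (sep_subset _ _)
  have hfint : Fintype t₁ := hfin₁.fintype
  have hfint' : Fintype t' := ht'.fintype
  have hnear : ∀ D : X →L[ℂ] X, ‖D‖ ≤ R → ∀ y : t₁, ∃ z : t', dist (S (D y)) z < η := by
    intro D hD y
    have h1 : S (D y) ∈ S '' closedBall 0 ((|R| + 1) * (‖T‖ + η + 1)) := by
      refine ⟨D y, ?_, rfl⟩
      rw [mem_closedBall_zero_iff]
      refine (D.le_opNorm _).trans ?_
      have h2 : ‖D‖ ≤ |R| + 1 := by linarith [le_abs_self R]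
      have h3 : ‖(y : X)‖ ≤ ‖T‖ + η + 1 := by linarith [y.2.2]
      gcongr
    obtain ⟨z, hz, hz'⟩ := mem_iUnion₂.1 (htc' h1)
    exact ⟨⟨z, hz⟩, hz'⟩
  have hchoice : ∀ B : (fun D : X →L[ℂ] X => S * D * T) '' closedBall 0 R,
      ∃ D : X →L[ℂ] X, ‖D‖ ≤ R ∧ S * D * T = B := by
    rintro ⟨_, D, hD, rfl⟩
    exact ⟨D, by simpa using hD, rfl⟩
  choose D hD hDB using hchoice
  choose F hF using fun B => hnear (D B) (hD B)
  refine ⟨t₁ → t', inferInstance, F, fun B B' hFF => ?_⟩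
  rw [← hDB B, ← hDB B', dist_eq_norm]
  refine lt_of_le_of_lt (ContinuousLinearMap.opNorm_le_of_unit_norm (C := ε / 2) (by positivity)
    fun x hx => ?_) (half_lt_self hε)
  have h1 : T x ∈ T '' closedBall 0 1 := ⟨x, by simp [hx], rfl⟩
  obtain ⟨y, hy, hy'⟩ := mem_iUnion₂.1 (htc h1)
  rw [mem_ball, dist_eq_norm] at hy'
  have hyn : ‖y‖ ≤ ‖T‖ + η := by
    have h2 : ‖T x‖ ≤ ‖T‖ := by simpa [hx] using T.le_opNorm x
    have h3 := norm_sub_norm_le y (T x)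
    rw [norm_sub_rev] at h3
    linarith
  have h4 := hF B ⟨y, hy, hyn⟩
  have h5 := hF B' ⟨y, hy, hyn⟩
  rw [← hFF] at h5
  have h6 : ‖S (D B y) - S (D B' y)‖ ≤ 2 * η := by
    rw [← dist_eq_norm]
    linarith [dist_triangle_right (S (D B y)) (S (D B' y)) (F B ⟨y, hy, hyn⟩)]
  have h7 : ∀ B, ‖S (D B (T x - y))‖ ≤ ‖S‖ * (|R| + 1) * η := fun B => by
    refine (S.le_opNorm _).trans ?_
    rw [mul_assoc]
    gcongr
    refine ((D B).le_opNorm _).trans ?_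
    gcongr
    linarith [le_abs_self R, hD B]
  have h8 : (S * D B * T - S * D B' * T) x =
      S (D B (T x - y)) + (S (D B y) - S (D B' y)) - S (D B' (T x - y)) := by
    simp only [sub_apply, mul_apply_eq_comp, map_sub]
    abel
  rw [h8]
  calc _ ≤ ‖S‖ * (|R| + 1) * η + 2 * η + ‖S‖ * (|R| + 1) * η :=
        (norm_sub_le _ _).trans (add_le_add ((norm_add_le _ _).trans (add_le_add (h7 B) h6)) (h7 B'))
    _ = (4 * (‖S‖ * (|R| + 1) + 2)) * η / 2 - 2 * η := by ring
    _ ≤ ε / 2 := by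
      rw [hη, mul_div_cancel₀ _ (by positivity), ← hη]
      linarith

/-- The product of `T * v` over the letters `v` of a word. -/
def wordProd {A : Type*} [Monoid A] (T : A) (L : List A) : A := (L.map (T * ·)).prod

section wordProd

variable {A : Type*} [Monoid A] (T : A)

@[simp] theorem wordProd_nil : wordProd T [] = 1 := rfl

@[simp] theorem wordProd_cons (v : A) (L : List A) : wordProd T (v :: L) = T * v * wordProd T L :=
  rfl

@[simp] theorem wordProd_append (L L' : List A) :
    wordProd T (L ++ L') = wordProd T L * wordProd T L' := by
  simp [wordProd]

end wordProd

/-- The elements of the span of `G` are controlled by finitely many elements of `G`. -/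
theorem exists_finite_norm_apply_le_of_mem_span {G : Set (X →L[ℂ] X)}
    (hG : ∀ z : ℂ, ∀ g ∈ G, z • g ∈ G) {u : X →L[ℂ] X} (hu : u ∈ Submodule.span ℂ G) :
    ∃ V : Set (X →L[ℂ] X), V.Finite ∧ (∀ v ∈ V, v ∈ G ∧ ‖v‖ ≤ 1) ∧ ∃ κ : ℝ, 1 ≤ κ ∧
      ∀ (B : X →L[ℂ] X) (y : X) (t : ℝ), 0 ≤ t → (∀ v ∈ V, ‖B (v y)‖ ≤ t) → ‖B (u y)‖ ≤ κ * t := by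
  induction hu using Submodule.span_induction with
  | mem g hg =>
    have h0 : 0 < ‖g‖ + 1 := by positivity
    have h1 : ‖(((‖g‖ + 1)⁻¹ : ℝ) : ℂ)‖ = (‖g‖ + 1)⁻¹ := by
      rw [Complex.norm_real, Real.norm_of_nonneg (by positivity)]
    refine ⟨{(((‖g‖ + 1)⁻¹ : ℝ) : ℂ) • g}, finite_singleton _, ?_, ‖g‖ + 1, by simp, ?_⟩
    · rintro _ rfl
      refine ⟨hG _ g hg, ?_⟩
      rw [norm_smul, h1, inv_mul_le_iff₀ h0]
      linarith
    · intro B y t ht h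
      have h2 := h _ rfl
      rwa [smul_apply, map_smul, norm_smul, h1, inv_mul_le_iff₀ h0] at h2
  | zero => exact ⟨∅, finite_empty, by simp, 1, le_rfl, fun B y t ht _ => by simpa using ht⟩
  | add u v _ _ hu hv =>
    obtain ⟨V, hV, hVG, κ, hκ, h⟩ := hu
    obtain ⟨V', hV', hVG', κ', hκ', h'⟩ := hv
    refine ⟨V ∪ V', hV.union hV', fun v hv => hv.elim (hVG v) (hVG' v), κ + κ', by linarith,
      fun B y t ht hb => ?_⟩
    rw [add_apply, map_add, add_mul]
    exact (norm_add_le _ _).trans (add_le_add (h B y t ht fun v hv => hb v (Or.inl hv))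
      (h' B y t ht fun v hv => hb v (Or.inr hv)))
  | smul z u _ hu =>
    obtain ⟨V, hV, hVG, κ, hκ, h⟩ := hu
    refine ⟨V, hV, hVG, ‖z‖ * κ + 1, by nlinarith [norm_nonneg z], fun B y t ht hb => ?_⟩
    rw [smul_apply, map_smul, norm_smul]
    nlinarith [h B y t ht hb, norm_nonneg z, mul_le_mul_of_nonneg_left (h B y t ht hb) (norm_nonneg z)]

/-- Hilden's argument: the words in finitely many letters of a topologically transitive set
decay at most exponentially. -/
theorem IsCompactOperator.exists_finite_le_norm_wordProd {T : X →L[ℂ] X} (hT : IsCompactOperator T)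
    (hT0 : T ≠ 0) {G : Set (X →L[ℂ] X)} (hG : ∀ z : ℂ, ∀ g ∈ G, z • g ∈ G)
    (hdense : ∀ x : X, x ≠ 0 →
      (Submodule.span ℂ ((fun g : X →L[ℂ] X => g x) '' G)).topologicalClosure = ⊤) :
    ∃ V : Set (X →L[ℂ] X), V.Finite ∧ (∀ v ∈ V, v ∈ G ∧ ‖v‖ ≤ 1) ∧ ∃ κ : ℝ, 1 ≤ κ ∧ ∃ m > 0,
      ∀ n, ∃ L : List (X →L[ℂ] X), L.length = n ∧ (∀ v ∈ L, v ∈ V) ∧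
        m * (κ⁻¹) ^ n ≤ ‖wordProd T L * T‖ := by
  obtain ⟨x₀, hx₀⟩ : ∃ x, T x ≠ 0 := by
    by_contra! h
    exact hT0 (ContinuousLinearMap.ext h)
  have hTx : 0 < ‖T x₀‖ := norm_pos_iff.2 hx₀
  set s : ℝ := ‖T x₀‖ / (2 * (‖T‖ + 1)) with hs
  have hs0 : 0 < s := by positivity
  have hlow : ∀ x ∈ ball x₀ s, ‖T x₀‖ / 2 ≤ ‖T x‖ := by
    intro x hx
    rw [mem_ball, dist_eq_norm, norm_sub_rev] at hx
    have h1 : ‖T x₀‖ - ‖T x‖ ≤ ‖T‖ * s :=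
      (norm_sub_norm_le _ _).trans (by rw [← map_sub]; exact T.le_opNorm_of_le hx.le)
    have h2 : ‖T‖ * s ≤ ‖T x₀‖ / 2 := by
      have : (‖T‖ + 1) * s = ‖T x₀‖ / 2 := by rw [hs]; field_simp
      nlinarith
    linarith
  have hK : IsCompact (closure (T '' ball x₀ s)) := by
    refine (hT.isCompact_closure_image_closedBall (‖x₀‖ + s)).of_isClosed_subset isClosed_closure
      (closure_mono (image_mono fun x hx => ?_))
    rw [mem_closedBall_zero_iff]
    rw [mem_ball, dist_eq_norm] at hx
    linarith [norm_le_norm_add_norm_sub' x x₀]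
  have hKlow : ∀ y ∈ closure (T '' ball x₀ s), ‖T x₀‖ / 2 ≤ ‖y‖ := fun y hy => by
    refine closure_minimal (t := {y | ‖T x₀‖ / 2 ≤ ‖y‖}) ?_
      (isClosed_le continuous_const continuous_norm) hy
    rintro _ ⟨x, hx, rfl⟩
    exact hlow x hx
  obtain ⟨V, hV, hVG, κ, hκ, hmove⟩ : ∃ V : Set (X →L[ℂ] X), V.Finite ∧
      (∀ v ∈ V, v ∈ G ∧ ‖v‖ ≤ 1) ∧ ∃ κ : ℝ, 1 ≤ κ ∧ ∀ y ∈ closure (T '' ball x₀ s),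
      ∃ z ∈ ball x₀ s, ∀ (B : X →L[ℂ] X) (t : ℝ), 0 ≤ t → (∀ v ∈ V, ‖B (v y)‖ ≤ t) →
        ‖B z‖ ≤ κ * t := by
    refine hK.induction_on (p := fun s' => ∃ V : Set (X →L[ℂ] X), V.Finite ∧
      (∀ v ∈ V, v ∈ G ∧ ‖v‖ ≤ 1) ∧ ∃ κ : ℝ, 1 ≤ κ ∧ ∀ y ∈ s',
      ∃ z ∈ ball x₀ s, ∀ (B : X →L[ℂ] X) (t : ℝ), 0 ≤ t → (∀ v ∈ V, ‖B (v y)‖ ≤ t) →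
        ‖B z‖ ≤ κ * t) ⟨∅, finite_empty, by simp, 1, le_rfl, by simp⟩ ?_ ?_ ?_
    · rintro s' t' hst ⟨V, hV, hVG, κ, hκ, h⟩
      exact ⟨V, hV, hVG, κ, hκ, fun y hy => h y (hst hy)⟩
    · rintro s' t' ⟨V, hV, hVG, κ, hκ, h⟩ ⟨V', hV', hVG', κ', hκ', h'⟩
      refine ⟨V ∪ V', hV.union hV', fun v hv => hv.elim (hVG v) (hVG' v), κ + κ', by linarith, ?_⟩
      rintro y (hy | hy)
      · obtain ⟨z, hz, hz'⟩ := h y hy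
        refine ⟨z, hz, fun B t ht hb => (hz' B t ht fun v hv => hb v (Or.inl hv)).trans ?_⟩
        gcongr
        linarith
      · obtain ⟨z, hz, hz'⟩ := h' y hy
        refine ⟨z, hz, fun B t ht hb => (hz' B t ht fun v hv => hb v (Or.inr hv)).trans ?_⟩
        gcongr
        linarith
    · intro y hy
      have hy0 : y ≠ 0 := norm_pos_iff.1 (by linarith [hKlow y hy])
      have h1 : x₀ ∈ closure
          (Submodule.span ℂ ((fun g : X →L[ℂ] X => g y) '' G) : Set X) := by
        rw [← Submodule.topologicalClosure_coe, hdense y hy0]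
        trivial
      obtain ⟨z, hz, hz'⟩ := Metric.mem_closure_iff.1 h1 s hs0
      have h2 : Submodule.span ℂ ((fun g : X →L[ℂ] X => g y) '' G) =
          (Submodule.span ℂ G).map (ContinuousLinearMap.apply ℂ X y).toLinearMap := by
        rw [Submodule.map_span]; rfl
      rw [SetLike.mem_coe, h2] at hz
      obtain ⟨u, hu, rfl⟩ := hz
      obtain ⟨V, hV, hVG, κ, hκ, h⟩ := exists_finite_norm_apply_le_of_mem_span hG hu
      refine ⟨u ⁻¹' ball x₀ s, mem_nhdsWithin_of_mem_nhds
        ((isOpen_ball.preimage u.continuous).mem_nhds ?_), V, hV, hVG, κ, hκ, fun y' hy' =>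
        ⟨u y', hy', fun B t ht hb => h B y' t ht hb⟩⟩
      rw [mem_preimage, mem_ball, dist_comm]
      exact hz'
  have hκ0 : 0 < κ := by linarith
  have key : ∀ n, ∀ x ∈ ball x₀ s, ∃ L : List (X →L[ℂ] X), L.length = n ∧ (∀ v ∈ L, v ∈ V) ∧
      ‖T x₀‖ / 2 * (κ⁻¹) ^ n ≤ ‖wordProd T L (T x)‖ := by
    intro n
    induction n with
    | zero => exact fun x hx => ⟨[], rfl, by simp, by simpa using hlow x hx⟩
    | succ n ih =>
      intro x hx
      obtain ⟨z, hz, hz'⟩ := hmove (T x) (subset_closure ⟨x, hx, rfl⟩)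
      obtain ⟨L, hL, hLV, hLz⟩ := ih z hz
      by_contra! hcon
      obtain ⟨t, ht0, ht1, ht⟩ : ∃ t : ℝ, 0 ≤ t ∧ t < ‖T x₀‖ / 2 * (κ⁻¹) ^ (n + 1) ∧
          ∀ v ∈ V, ‖(wordProd T L * T) (v (T x))‖ ≤ t := by
        have h1 : ∀ v ∈ V, ‖(wordProd T L * T) (v (T x))‖ < ‖T x₀‖ / 2 * (κ⁻¹) ^ (n + 1) := by
          intro v hv
          have := hcon (L ++ [v]) (by simp [hL]) (by
            intro w hw
            rcases List.mem_append.1 hw with hw | hw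
            · exact hLV w hw
            · rw [List.mem_singleton.1 hw]; exact hv)
          simpa [mul_assoc] using this
        rcases V.eq_empty_or_nonempty with hVe | hVe
        · exact ⟨0, le_rfl, by positivity, by simp [hVe]⟩
        · obtain ⟨v, hv, hmax⟩ := hV.exists_maximalFor
            (fun v : X →L[ℂ] X => ‖(wordProd T L * T) (v (T x))‖) V hVe
          exact ⟨_, norm_nonneg _, h1 v hv, fun w hw => (le_total _ _).elim id (hmax hw)⟩
      have h2 := hz' (wordProd T L * T) t ht0 ht
      have h3 : ‖T x₀‖ / 2 * (κ⁻¹) ^ n ≤ κ * t := hLz.trans h2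
      have h4 : κ * t < κ * (‖T x₀‖ / 2 * (κ⁻¹) ^ (n + 1)) := by gcongr
      have h5 : κ * (‖T x₀‖ / 2 * (κ⁻¹) ^ (n + 1)) = ‖T x₀‖ / 2 * (κ⁻¹) ^ n := by
        rw [pow_succ]; field_simp
      linarith
  have hx₀0 : 0 < ‖x₀‖ := norm_pos_iff.2 fun h => hx₀ (by rw [h, map_zero])
  refine ⟨V, hV, hVG, κ, hκ, ‖T x₀‖ / 2 / ‖x₀‖, by positivity, fun n => ?_⟩
  obtain ⟨L, hL, hLV, h⟩ := key n x₀ (mem_ball_self hs0)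
  refine ⟨L, hL, hLV, ?_⟩
  rw [div_mul_eq_mul_div, div_le_iff₀ hx₀0]
  exact h.trans ((wordProd T L * T).le_opNorm x₀)

end CompactWords

section Growth

/-- The growth rate of a submultiplicative sequence. -/
theorem exists_growthRate {a : ℕ → ℝ} (ha : ∀ k, 0 < a k) (hmul : ∀ m n, a (m + n) ≤ a m * a n)
    {κ c : ℝ} (hκ : 0 < κ) (hc : 0 < c) (hlow : ∀ n, c * κ ^ n ≤ a n) :
    ∃ ρ, κ ≤ ρ ∧ (∀ k, ρ ^ k ≤ a k) ∧
      ∀ η > 0, ∃ C, ∀ n : ℕ, a n / ρ ^ n ≤ C * Real.exp (η * n) := by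
  have hsub : Subadditive fun n => Real.log (a n) := fun m n => by
    rw [← Real.log_mul (ha m).ne' (ha n).ne']
    exact Real.log_le_log (ha _) (hmul m n)
  have hlog : ∀ n : ℕ, Real.log c + n * Real.log κ ≤ Real.log (a n) := fun n => by
    rw [← Real.log_pow, ← Real.log_mul hc.ne' (by positivity)]
    exact Real.log_le_log (by positivity) (hlow n)
  have hdiv : ∀ n : ℕ, 0 < n → Real.log c / n + Real.log κ ≤ Real.log (a n) / n := fun n hn => by
    have : (0 : ℝ) < n := by exact_mod_cast hn
    rw [div_add' _ _ _ this.ne']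
    gcongr
    linarith [hlog n]
  have hbdd : BddBelow (range fun n : ℕ => Real.log (a n) / n) := by
    refine ⟨-|Real.log c| - |Real.log κ|, ?_⟩
    rintro _ ⟨n, rfl⟩
    rcases n.eq_zero_or_pos with rfl | hn
    · simp only [CharP.cast_eq_zero, div_zero]
      linarith [abs_nonneg (Real.log c), abs_nonneg (Real.log κ)]
    · refine le_trans ?_ (hdiv n hn)
      have h1 : (1 : ℝ) ≤ n := by exact_mod_cast hn
      have h2 : -|Real.log c| ≤ Real.log c / n := by
        rw [le_div_iff₀ (by linarith)]
        nlinarith [neg_abs_le (Real.log c), abs_nonneg (Real.log c)]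
      linarith [neg_abs_le (Real.log κ)]
  have hlim := hsub.tendsto_lim hbdd
  refine ⟨Real.exp hsub.lim, ?_, fun k => ?_, fun η hη => ?_⟩
  · rw [← Real.log_le_iff_le_exp hκ]
    have h1 : Tendsto (fun n : ℕ => Real.log c / n + Real.log κ) atTop (𝓝 (0 + Real.log κ)) :=
      (tendsto_const_div_atTop_nhds_zero_nat _).add_const _
    rw [zero_add] at h1
    exact le_of_tendsto_of_tendsto h1 hlim ((eventually_gt_atTop 0).mono hdiv)
  · rw [← Real.exp_nat_mul, ← Real.le_log_iff_exp_le (ha k)]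
    rcases k.eq_zero_or_pos with rfl | hk
    · have := hmul 0 0
      have h1 : 1 ≤ a 0 := by
        by_contra! h
        nlinarith [ha 0]
      simpa using Real.log_nonneg h1
    · have := hsub.lim_le_div hbdd hk.ne'
      rwa [le_div_iff₀ (by exact_mod_cast hk), mul_comm] at this
  · have hev : ∀ᶠ n : ℕ in atTop,
        a n / Real.exp hsub.lim ^ n / Real.exp (η * n) ≤ 1 := by
      filter_upwards [(tendsto_order.1 hlim).2 _ (lt_add_of_pos_right hsub.lim hη),
        eventually_gt_atTop 0] with n hn hn0
      rw [div_lt_iff₀ (by exact_mod_cast hn0), Real.log_lt_iff_lt_exp (ha n)] at hn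
      rw [div_div, div_le_one (by positivity), ← Real.exp_nat_mul, ← Real.exp_add]
      refine hn.le.trans_eq ?_
      ring_nf
    obtain ⟨C, hC⟩ := (isBoundedUnder_of_eventually_le hev).bddAbove_range
    exact ⟨C, fun n => by
      rw [← div_le_iff₀ (Real.exp_pos _)]
      exact hC ⟨n, rfl⟩⟩

theorem mul_le_one_of_record {a : ℕ → ℝ} {δ : ℝ} (hδ : 0 < δ) (ha : ∀ k, 0 < a k)
    (hgrowth : ∀ η > 0, ∃ C, ∀ n : ℕ, a n ≤ C * Real.exp (η * n))
    (hrec : ∀ k, (∀ j ≤ k, a j ≤ a k) → ∃ m ≤ 2 * k, δ * a k ^ 2 ≤ a m) (k : ℕ) :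
    δ * a k ≤ 1 := by
  by_contra! hq
  set q := δ * a k with hqdef
  have key : ∀ n, ∃ m ≤ 2 ^ n * k, q ^ 2 ^ n ≤ δ * a m := by
    intro n
    induction n with
    | zero => exact ⟨k, by simp, by simp [hqdef]⟩
    | succ n ih =>
      obtain ⟨m, hm, hqm⟩ := ih
      obtain ⟨j, hj, hmax⟩ := Finset.exists_max_image (Finset.range (m + 1)) a ⟨m, by simp⟩
      have hjm : j ≤ m := by simpa [Nat.lt_succ_iff] using hj
      obtain ⟨m', hm', h⟩ := hrec j fun i hi => hmax i (by simp; omega)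
      refine ⟨m', by rw [pow_succ]; nlinarith, ?_⟩
      have h1 : a m ≤ a j := hmax m (by simp)
      have h2 : q ^ 2 ^ n ≤ δ * a j := hqm.trans (by gcongr)
      calc q ^ 2 ^ (n + 1) = (q ^ 2 ^ n) ^ 2 := by rw [← pow_mul, pow_succ]
        _ ≤ (δ * a j) ^ 2 := by
          have : 0 ≤ q ^ 2 ^ n := by positivity
          gcongr
        _ = δ * (δ * a j ^ 2) := by ring
        _ ≤ δ * a m' := by gcongr
  -- choose the growth exponent so that `exp (η * k) < q`
  have hlogq : 0 < Real.log q := Real.log_pos hq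
  set η : ℝ := Real.log q / (2 * (k + 1)) with hη
  have hη0 : 0 < η := by positivity
  obtain ⟨C, hC⟩ := hgrowth η hη0
  have hC0 : 0 < C := by
    have := (ha 0).trans_le (hC 0)
    simpa using this
  have hbase : 1 < q / Real.exp (η * k) := by
    rw [one_lt_div (Real.exp_pos _), ← Real.lt_log_iff_exp_lt (by linarith), hη, div_mul_eq_mul_div,
      div_lt_iff₀ (by positivity)]
    nlinarith
  have hbound : ∀ n, (q / Real.exp (η * k)) ^ n ≤ δ * C := by
    intro n
    obtain ⟨m, hm, h⟩ := key n
    calc (q / Real.exp (η * k)) ^ n ≤ (q / Real.exp (η * k)) ^ 2 ^ n :=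
          pow_le_pow_right₀ hbase.le n.lt_two_pow_self.le
      _ ≤ δ * C := by
        rw [div_pow, div_le_iff₀ (by positivity), mul_assoc]
        refine h.trans ?_
        gcongr
        refine (hC m).trans ?_
        rw [← Real.exp_nat_mul]
        refine mul_le_mul_of_nonneg_left (Real.exp_le_exp.2 ?_) hC0.le
        have : (m : ℝ) ≤ 2 ^ n * k := by exact_mod_cast hm
        push_cast
        nlinarith [mul_le_mul_of_nonneg_left this hη0.le]
  obtain ⟨n, hn⟩ := pow_unbounded_of_one_lt (δ * C) hbase
  exact absurd (hbound n) (not_le.2 hn)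

theorem exists_max_norm_wordProd {A : Type*} [NormedRing A] (T : A) {V : Set A} (hV : V.Finite)
    (hne : V.Nonempty) : ∃ a : ℕ → ℝ, a 0 = 1 ∧
      (∀ L : List A, (∀ v ∈ L, v ∈ V) → ‖wordProd T L * T‖ ≤ a (L.length + 1)) ∧
      ∀ k, ∃ L : List A, L.length = k ∧ (∀ v ∈ L, v ∈ V) ∧ a (k + 1) = ‖wordProd T L * T‖ := by
  obtain ⟨v₀, hv₀⟩ := hne
  have h : ∀ k, ∃ L : List A, L.length = k ∧ (∀ v ∈ L, v ∈ V) ∧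
      ∀ L' : List A, L'.length = k → (∀ v ∈ L', v ∈ V) →
        ‖wordProd T L' * T‖ ≤ ‖wordProd T L * T‖ := by
    intro k
    have : Finite V := hV
    have hfin : {L : List A | L.length = k ∧ ∀ v ∈ L, v ∈ V}.Finite := by
      refine ((List.finite_length_eq V k).image (List.map Subtype.val)).subset ?_
      rintro L ⟨hL, hLV⟩
      lift L to List V using hLV
      exact ⟨L, by simpa using hL, rfl⟩
    obtain ⟨L, hL, hmax⟩ := hfin.exists_maximalFor (fun L => ‖wordProd T L * T‖) _
      ⟨List.replicate k v₀, by simp, fun v hv => by rwa [List.eq_of_mem_replicate hv]⟩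
    exact ⟨L, hL.1, hL.2, fun L' h1 h2 => (le_total _ _).elim id (hmax ⟨h1, h2⟩)⟩
  choose L hL hLV hmax using h
  exact ⟨fun k => k.casesOn 1 fun k => ‖wordProd T (L k) * T‖, rfl,
    fun L' hL' => hmax _ L' rfl hL', fun k => ⟨L k, hL k, hLV k, rfl⟩⟩

end Growth

section CompactWords

variable {X : Type*} [NormedAddCommGroup X] [NormedSpace ℂ X]

/-- A topologically transitive set contains, for every compact set of nonzero operators, finitely
many elements which do not annihilate any of them. -/
theorem IsCompact.exists_finite_le_norm_mul_mul {G K : Set (X →L[ℂ] X)} (hK : IsCompact K)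
    (hK0 : 0 ∉ K) (hG : ∀ z : ℂ, ∀ g ∈ G, z • g ∈ G)
    (hdense : ∀ x : X, x ≠ 0 →
      (Submodule.span ℂ ((fun g : X →L[ℂ] X => g x) '' G)).topologicalClosure = ⊤) :
    ∃ V : Set (X →L[ℂ] X), V.Finite ∧ (∀ v ∈ V, v ∈ G ∧ ‖v‖ ≤ 1) ∧ ∃ δ > 0, ∀ B ∈ K,
      ∃ v ∈ V, δ ≤ ‖B * v * B‖ := by
  refine hK.induction_on (p := fun K => ∃ V : Set (X →L[ℂ] X), V.Finite ∧
    (∀ v ∈ V, v ∈ G ∧ ‖v‖ ≤ 1) ∧ ∃ δ > 0, ∀ B ∈ K, ∃ v ∈ V, δ ≤ ‖B * v * B‖)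
    ⟨∅, finite_empty, by simp, 1, one_pos, by simp⟩ ?_ ?_ ?_
  · rintro s t hst ⟨V, hV, hVG, δ, hδ, h⟩
    exact ⟨V, hV, hVG, δ, hδ, fun B hB => h B (hst hB)⟩
  · rintro s t ⟨V, hV, hVG, δ, hδ, h⟩ ⟨V', hV', hVG', δ', hδ', h'⟩
    refine ⟨V ∪ V', hV.union hV', fun v hv => hv.elim (hVG v) (hVG' v), min δ δ', lt_min hδ hδ', ?_⟩
    rintro B (hB | hB)
    · obtain ⟨v, hv, hvB⟩ := h B hB
      exact ⟨v, Or.inl hv, (min_le_left _ _).trans hvB⟩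
    · obtain ⟨v, hv, hvB⟩ := h' B hB
      exact ⟨v, Or.inr hv, (min_le_right _ _).trans hvB⟩
  · intro B hB
    have hB0 : B ≠ 0 := fun h => hK0 (h ▸ hB)
    obtain ⟨x, hx⟩ : ∃ x, B x ≠ 0 := by
      by_contra! h
      exact hB0 (ContinuousLinearMap.ext h)
    obtain ⟨g, hg, hgB⟩ : ∃ g ∈ G, B (g (B x)) ≠ 0 := by
      by_contra! h
      exact hB0 (eq_zero_of_span_apply_topologicalClosure_eq_top (hdense _ hx) h)
    have h0 : 0 < ‖g‖ + 1 := by positivity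
    have h1 : ‖(((‖g‖ + 1)⁻¹ : ℝ) : ℂ)‖ = (‖g‖ + 1)⁻¹ := by
      rw [Complex.norm_real, Real.norm_of_nonneg (by positivity)]
    set v : X →L[ℂ] X := (((‖g‖ + 1)⁻¹ : ℝ) : ℂ) • g with hv
    have hvB : 0 < ‖B * v * B‖ := by
      rw [norm_pos_iff]
      intro h
      have h2 := congrArg (fun C : X →L[ℂ] X => C x) h
      simp only [hv, mul_apply_eq_comp, smul_apply, map_smul, zero_apply, smul_eq_zero, hgB,
        or_false] at h2
      rw [h2, norm_zero] at h1
      exact (inv_pos.2 h0).ne h1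
    refine ⟨{C | ‖B * v * B‖ / 2 < ‖C * v * C‖}, mem_nhdsWithin_of_mem_nhds
      (IsOpen.mem_nhds (isOpen_lt continuous_const (by fun_prop)) (half_lt_self hvB)),
      {v}, finite_singleton _, ?_, _, half_pos hvB, fun C hC => ⟨v, rfl, le_of_lt hC⟩⟩
    rintro _ rfl
    refine ⟨hG _ g hg, ?_⟩
    rw [hv, norm_smul, h1, inv_mul_le_iff₀ h0]
    linarith

end CompactWords

theorem exists_submultiplicative_norm_wordProd {A : Type*} [NormedRing A] (h1 : ‖(1 : A)‖ ≤ 1)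
    (T : A) {V : Set A} (hV : V.Finite) (hne : V.Nonempty) (hV1 : ∀ v ∈ V, ‖v‖ ≤ 1) :
    ∃ a : ℕ → ℝ, a 0 = 1 ∧
      (∀ L : List A, (∀ v ∈ L, v ∈ V) → ‖wordProd T L * T‖ ≤ a (L.length + 1)) ∧
      (∀ k, ∃ L : List A, L.length = k ∧ (∀ v ∈ L, v ∈ V) ∧ a (k + 1) = ‖wordProd T L * T‖) ∧
      (∀ m n, a (m + n) ≤ a m * a n) ∧
      ∀ L : List A, (∀ v ∈ L, v ∈ V) → ‖wordProd T L‖ ≤ a L.length := by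
  obtain ⟨a, ha0, hle, hex⟩ := exists_max_norm_wordProd T hV hne
  refine ⟨a, ha0, hle, hex, ?_, ?_⟩
  · rintro (_ | m) (_ | n)
    · simp [ha0]
    · simp [ha0]
    · simp [ha0]
    obtain ⟨L, hL, hLV, h⟩ := hex (m + (n + 1))
    rw [show m + 1 + (n + 1) = m + (n + 1) + 1 by ring, h]
    obtain ⟨v, L₂, hd⟩ : ∃ v L₂, L.drop m = v :: L₂ := by
      refine List.exists_cons_of_length_pos ?_
      rw [List.length_drop]
      omega
    have hsplit : L = L.take m ++ v :: L₂ := by rw [← hd, List.take_append_drop]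
    have hlen : L₂.length = n := by
      have := congrArg List.length hd
      simp only [List.length_drop, List.length_cons] at this
      omega
    have hv : ‖v‖ ≤ 1 := hV1 v (hLV v (by rw [hsplit]; simp))
    have h2 := hle (L.take m) fun u hu => hLV u (List.mem_of_mem_take hu)
    have h3 := hle L₂ fun u hu => hLV u (by rw [hsplit]; simp [hu])
    rw [List.length_take_of_le (by omega)] at h2
    rw [hlen] at h3
    have h4 : wordProd T L * T = wordProd T (L.take m) * T * v * (wordProd T L₂ * T) := by
      conv_lhs => rw [hsplit]
      simp [mul_assoc]
    rw [h4]
    calc _ ≤ ‖wordProd T (L.take m) * T‖ * ‖v‖ * ‖wordProd T L₂ * T‖ :=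
          (norm_mul_le _ _).trans (by gcongr; exact norm_mul_le _ _)
      _ ≤ a (m + 1) * 1 * a (n + 1) := by
        have := (norm_nonneg _).trans h2
        gcongr
      _ = _ := by ring
  · intro L hL
    rcases L.eq_nil_or_concat with rfl | ⟨L', v, rfl⟩
    · simpa [ha0] using h1
    · have h2 := hle L' fun u hu => hL u (by simp [hu])
      have hv := hV1 v (hL v (by simp))
      simp only [List.concat_eq_append, wordProd_append, wordProd_cons, wordProd_nil, mul_one,
        List.length_append, List.length_singleton]
      rw [← mul_assoc]
      refine (norm_mul_le _ _).trans ?_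
      nlinarith [norm_nonneg (wordProd T L' * T)]

section CompactWords

variable {X : Type*} [NormedAddCommGroup X] [NormedSpace ℂ X] [CompleteSpace X]

/-- After renormalization, the words in finitely many well-chosen letters are bounded, and
there are arbitrarily long words all of whose initial segments are bounded below. -/
theorem IsCompactOperator.exists_bounded_wordProd {T : X →L[ℂ] X} (hT : IsCompactOperator T)
    (hT1 : ‖T‖ = 1) {G : Set (X →L[ℂ] X)} (hG : ∀ z : ℂ, ∀ g ∈ G, z • g ∈ G)
    (hdense : ∀ x : X, x ≠ 0 →
      (Submodule.span ℂ ((fun g : X →L[ℂ] X => g x) '' G)).topologicalClosure = ⊤) :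
    ∃ V ⊆ G, V.Finite ∧ (∀ v ∈ V, ‖v‖ ≤ 1) ∧ ∃ ρ > 0, ∃ M > 0,
      (∀ L : List (X →L[ℂ] X), (∀ v ∈ L, v ∈ V) → ‖wordProd T L‖ ≤ M * ρ ^ L.length) ∧
      ∀ n, ∃ L : List (X →L[ℂ] X), L.length = n ∧ (∀ v ∈ L, v ∈ V) ∧
        ∀ k ≤ n, ρ ^ k ≤ M * ‖wordProd T (L.take k)‖ := by
  have hT0 : T ≠ 0 := by
    rintro rfl
    simp at hT1
  obtain ⟨V₀, hV₀, hV₀G, κ, hκ, m, hm, hlow⟩ := hT.exists_finite_le_norm_wordProd hT0 hG hdense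
  have hκ0 : 0 < κ := by linarith
  set K : Set (X →L[ℂ] X) :=
    (closure ((fun D : X →L[ℂ] X => T * D * T) '' closedBall 0 (κ ^ 2)) ∪ {T}) ∩ sphere 0 1
    with hKdef
  have hK : IsCompact K :=
    (((hT.totallyBounded_mul_mul hT _).closure.isCompact_of_isClosed isClosed_closure).union
      isCompact_singleton).inter_right isClosed_sphere
  have hK0 : 0 ∉ K := fun h => by simpa using h.2
  obtain ⟨V₁, hV₁, hV₁G, δ, hδ, hmul⟩ := hK.exists_finite_le_norm_mul_mul hK0 hG hdense
  have hTK : T ∈ K := ⟨Or.inr rfl, by simpa using hT1⟩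
  have hVG : ∀ v ∈ V₀ ∪ V₁, v ∈ G ∧ ‖v‖ ≤ 1 := fun v hv => hv.elim (hV₀G v) (hV₁G v)
  obtain ⟨v₁, hv₁, hv₁δ⟩ := hmul T hTK
  have hδ1 : δ ≤ 1 := hv₁δ.trans <| by
    calc ‖T * v₁ * T‖ ≤ ‖T‖ * ‖v₁‖ * ‖T‖ := (norm_mul_le _ _).trans (by gcongr; exact norm_mul_le _ _)
      _ ≤ 1 := by rw [hT1]; linarith [(hV₁G v₁ hv₁).2]
  obtain ⟨a, ha0, hle, hex, hsub, hle'⟩ := exists_submultiplicative_norm_wordProd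
    (ContinuousLinearMap.norm_id_le (𝕜 := ℂ) (E := X)) T (hV₀.union hV₁) ⟨v₁, Or.inr hv₁⟩
    fun v hv => (hVG v hv).2
  have hc : 0 < min m 1 := lt_min hm one_pos
  have hκi : κ⁻¹ ≤ 1 := inv_le_one_of_one_le₀ hκ
  have hlow' : ∀ n, min m 1 * κ⁻¹ ^ n ≤ a n := by
    rintro (_ | n)
    · simp [ha0]
    · obtain ⟨L, hL, hLV, h⟩ := hlow n
      have h1 := hle L fun v hv => Or.inl (hLV v hv)
      rw [hL] at h1
      refine le_trans ?_ (h.trans h1)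
      exact mul_le_mul (min_le_left _ _) (pow_le_pow_of_le_one (by positivity) hκi n.le_succ)
        (by positivity) hm.le
  have hapos : ∀ n, 0 < a n := fun n => lt_of_lt_of_le (by positivity) (hlow' n)
  obtain ⟨ρ, hκρ, hρa, hgrowth⟩ := exists_growthRate hapos hsub (inv_pos.2 hκ0) hc hlow'
  have hρ : 0 < ρ := (inv_pos.2 hκ0).trans_le hκρ
  have hbound : ∀ k, δ * (a k / ρ ^ k) ≤ 1 := by
    refine mul_le_one_of_record hδ (fun k => div_pos (hapos k) (pow_pos hρ k)) hgrowth ?_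
    intro k hk
    rcases k.eq_zero_or_pos with rfl | hk0
    · exact ⟨0, le_rfl, by simpa [ha0] using hδ1⟩
    obtain ⟨k, rfl⟩ := Nat.exists_eq_add_of_le' hk0
    obtain ⟨L, hL, hLV, h⟩ := hex k
    set S := wordProd T L * T with hS
    have hS0 : 0 < ‖S‖ := h ▸ hapos (k + 1)
    have hSn : ‖((‖S‖⁻¹ : ℝ) : ℂ)‖ = ‖S‖⁻¹ := by
      rw [Complex.norm_real, Real.norm_of_nonneg (by positivity)]
    have hSK : ((‖S‖⁻¹ : ℝ) : ℂ) • S ∈ K := by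
      refine ⟨?_, by rw [mem_sphere_zero_iff_norm, norm_smul, hSn, inv_mul_cancel₀ hS0.ne']⟩
      rcases L with _ | ⟨v, L'⟩
      · right
        simp [hS, hT1]
      · left
        refine subset_closure ⟨((‖S‖⁻¹ : ℝ) : ℂ) • (v * wordProd T L'), ?_, ?_⟩
        · rw [mem_closedBall_zero_iff, norm_smul, hSn, inv_mul_le_iff₀ hS0]
          have h2 := hle' L' fun u hu => hLV u (by simp [hu])
          have h3 := hk L'.length (by simp at hL; omega)
          have h4 : ‖v * wordProd T L'‖ ≤ a L'.length := by
            refine (norm_mul_le _ _).trans ?_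
            nlinarith [(hVG v (hLV v (by simp))).2, norm_nonneg (wordProd T L'), norm_nonneg v]
          refine h4.trans ?_
          rw [h, div_le_iff₀ (by positivity)] at h3
          refine h3.trans ?_
          have h5 : k = L'.length + 1 := by simpa using hL.symm
          have h6 : ‖S‖ / ρ ^ (k + 1) * ρ ^ L'.length = ‖S‖ * ρ⁻¹ ^ 2 := by
            rw [h5]
            field_simp
            ring
          rw [h6]
          gcongr
          exact inv_le_of_inv_le₀ hκ0 hκρ
        · simp [hS, mul_assoc]
    obtain ⟨u, hu, huδ⟩ := hmul _ hSK
    refine ⟨2 * (k + 1), le_rfl, ?_⟩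
    have h7 := hle (L ++ u :: L) (by
      intro v hv
      simp only [List.mem_append, List.mem_cons] at hv
      rcases hv with hv | rfl | hv
      · exact hLV v hv
      · exact Or.inr hu
      · exact hLV v hv)
    have h8 : wordProd T (L ++ u :: L) * T = S * u * S := by simp [hS, mul_assoc]
    rw [h8, show (L ++ u :: L).length + 1 = 2 * (k + 1) by simp [hL]; ring] at h7
    have h9 : ‖(((‖S‖⁻¹ : ℝ) : ℂ) • S) * u * (((‖S‖⁻¹ : ℝ) : ℂ) • S)‖ =
        ‖S * u * S‖ / ‖S‖ ^ 2 := by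
      simp only [smul_mul_assoc, mul_smul_comm, norm_smul, hSn]
      field_simp
    rw [h9, le_div_iff₀ (by positivity)] at huδ
    rw [h, div_pow, ← pow_mul, mul_comm (k + 1) 2, ← mul_div_assoc]
    gcongr
    exact huδ.trans h7
  refine ⟨V₀ ∪ V₁, fun v hv => (hVG v hv).1, hV₀.union hV₁, fun v hv => (hVG v hv).2, ρ, hρ,
    δ⁻¹, inv_pos.2 hδ, ?_, ?_⟩
  all_goals
    have hbound' : ∀ k, a k ≤ δ⁻¹ * ρ ^ k := fun k => by
      have := hbound k
      rw [← mul_div_assoc, div_le_one (by positivity)] at this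
      rwa [inv_mul_eq_div, le_div_iff₀ hδ, mul_comm]
  · exact fun L hL => (hle' L hL).trans (hbound' _)
  · intro n
    obtain ⟨L, hL, hLV, h⟩ := hex n
    refine ⟨L, hL, hLV, fun k hk => ?_⟩
    have h1 := hle (L.drop k) fun v hv => hLV v (List.mem_of_mem_drop hv)
    have h2 := h1.trans (hbound' _)
    rw [List.length_drop, hL] at h2
    have h3 : wordProd T L * T = wordProd T (L.take k) * (wordProd T (L.drop k) * T) := by
      conv_lhs => rw [← List.take_append_drop k L, wordProd_append, mul_assoc]
    have h4 := (hρa (n + 1)).trans (h.le.trans (h3.symm ▸ norm_mul_le _ _))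
    have h5 : ρ ^ (n + 1) = ρ ^ k * ρ ^ (n - k + 1) := by rw [← pow_add]; congr 1; omega
    have h6 : ρ ^ k * ρ ^ (n - k + 1) ≤ (δ⁻¹ * ‖wordProd T (L.take k)‖) * ρ ^ (n - k + 1) := by
      rw [← h5]
      refine h4.trans ?_
      calc _ ≤ ‖wordProd T (L.take k)‖ * (δ⁻¹ * ρ ^ (n - k + 1)) := by gcongr
        _ = _ := by ring
    exact le_of_mul_le_mul_right h6 (by positivity)

end CompactWords

section CompactWords

/-- Among sufficiently many points of a totally bounded set, two are close to each other. -/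
theorem exists_lt_dist_lt_of_totallyBounded {α : Type*} [PseudoMetricSpace α] {s : Set α}
    (hs : TotallyBounded s) {ε : ℝ} (hε : 0 < ε) :
    ∃ N : ℕ, ∀ f : ℕ → α, (∀ i ≤ N, f i ∈ s) → ∃ i j, i < j ∧ j ≤ N ∧ dist (f i) (f j) < ε := by
  obtain ⟨t, ht, hts⟩ := Metric.totallyBounded_iff.1 hs (ε / 2) (half_pos hε)
  have := ht.fintype
  refine ⟨Fintype.card t, fun f hf => ?_⟩
  have h : ∀ i : Fin (Fintype.card t + 1), ∃ y : t, dist (f i) y < ε / 2 := fun i => by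
    obtain ⟨y, hy, hy'⟩ := mem_iUnion₂.1 (hts (hf i (Nat.lt_succ_iff.1 i.2)))
    exact ⟨⟨y, hy⟩, hy'⟩
  choose g hg using h
  obtain ⟨i, j, hij, hgij⟩ := Fintype.exists_ne_map_eq_of_card_lt g (by simp)
  have hd : dist (f i) (f j) < ε := by
    have h1 := hg i
    have h2 := hg j
    rw [← hgij] at h2
    linarith [dist_triangle_right (f i) (f j) (g i)]
  rcases lt_or_gt_of_ne hij with h | h
  · exact ⟨i, j, h, Nat.lt_succ_iff.1 j.2, hd⟩
  · exact ⟨j, i, h, Nat.lt_succ_iff.1 i.2, by rwa [dist_comm]⟩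

variable {X : Type*} [NormedAddCommGroup X] [NormedSpace ℂ X] [CompleteSpace X]

/-- The inverses of `1 - q` are bounded for `q` in a totally bounded set of compact
quasinilpotent operators. -/
theorem exists_norm_le_mul_norm_mul_one_sub {Q : Set (X →L[ℂ] X)}
    (hQ : TotallyBounded Q) (hQc : ∀ q ∈ Q, IsCompactOperator q)
    (hQq : ∀ q ∈ Q, IsQuasinilpotent q) :
    ∃ C > 0, ∀ q ∈ Q, ∀ p : X →L[ℂ] X, ‖p‖ ≤ C * ‖p * (1 - q)‖ := by
  have hunit : ∀ q ∈ closure Q, IsUnit (1 - q) := by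
    intro q hq
    obtain ⟨u, hu, hlim⟩ := mem_closure_iff_seq_limit.1 hq
    have hqc : IsCompactOperator q :=
      isCompactOperator_of_tendsto hlim (Eventually.of_forall fun n => hQc _ (hu n))
    have := isQuasinilpotent_of_tendsto hlim hqc.countable_spectrum
      (Eventually.of_forall fun n => hQq _ (hu n)) (-1)
    rwa [neg_one_smul, ← sub_eq_add_neg] at this
  have hcont : ContinuousOn (fun q : X →L[ℂ] X => Ring.inverse (1 - q)) (closure Q) := by
    intro q hq
    obtain ⟨w, hw⟩ := hunit q hq
    have h1 : ContinuousAt Ring.inverse (1 - q) := hw ▸ NormedRing.inverse_continuousAt w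
    exact (ContinuousAt.comp (f := fun q : X →L[ℂ] X => 1 - q) h1
      (by fun_prop)).continuousWithinAt
  obtain ⟨C, hC⟩ := (hQ.closure.isCompact_of_isClosed
    isClosed_closure).exists_bound_of_continuousOn hcont
  refine ⟨|C| + 1, by positivity, fun q hq p => ?_⟩
  have h1 := hC q (subset_closure hq)
  have h2 : p = p * (1 - q) * Ring.inverse (1 - q) := by
    rw [mul_assoc, Ring.mul_inverse_cancel _ (hunit q (subset_closure hq)), mul_one]
  calc ‖p‖ = ‖p * (1 - q) * Ring.inverse (1 - q)‖ := by rw [← h2]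
    _ ≤ ‖p * (1 - q)‖ * ‖Ring.inverse (1 - q)‖ := norm_mul_le _ _
    _ ≤ ‖p * (1 - q)‖ * (|C| + 1) := by
      gcongr
      linarith [le_abs_self C]
    _ = _ := mul_comm _ _

/-- A version of Turovskii's theorem: a topologically transitive set of letters produces
a word which is not quasinilpotent. -/
theorem IsCompactOperator.exists_not_isQuasinilpotent_wordProd {T : X →L[ℂ] X}
    (hT : IsCompactOperator T) (hT1 : ‖T‖ = 1) {G : Set (X →L[ℂ] X)}
    (hG : ∀ z : ℂ, ∀ g ∈ G, z • g ∈ G)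
    (hdense : ∀ x : X, x ≠ 0 →
      (Submodule.span ℂ ((fun g : X →L[ℂ] X => g x) '' G)).topologicalClosure = ⊤) :
    ∃ L : List (X →L[ℂ] X), L ≠ [] ∧ (∀ v ∈ L, v ∈ G) ∧ ¬ IsQuasinilpotent (wordProd T L) := by
  by_contra! hq
  obtain ⟨V, hVG, hV, hV1, ρ, hρ, M, hM, hle, hex⟩ := hT.exists_bounded_wordProd hT1 hG hdense
  set s : List (X →L[ℂ] X) → (X →L[ℂ] X) :=
    fun L => (((ρ⁻¹ : ℝ) : ℂ) ^ L.length) • wordProd T L with hs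
  have hsn : ∀ L, ‖s L‖ = (ρ⁻¹) ^ L.length * ‖wordProd T L‖ := fun L => by
    rw [hs, norm_smul, norm_pow, Complex.norm_real, Real.norm_of_nonneg (by positivity)]
  have hs_append : ∀ L L', s (L ++ L') = s L * s L' := fun L L' => by
    simp only [hs, List.length_append, wordProd_append, pow_add, smul_mul_smul_comm]
  have hsM : ∀ L, (∀ v ∈ L, v ∈ V) → ‖s L‖ ≤ M := fun L hL => by
    rw [hsn]
    calc _ ≤ (ρ⁻¹) ^ L.length * (M * ρ ^ L.length) := by gcongr; exact hle L hL
      _ = M := by rw [mul_left_comm, ← mul_pow, inv_mul_cancel₀ hρ.ne', one_pow, mul_one]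
  set Q : Set (X →L[ℂ] X) := {q | ∃ L, 2 ≤ L.length ∧ (∀ v ∈ L, v ∈ V) ∧ s L = q} with hQdef
  have hQ : TotallyBounded Q := by
    refine ((totallyBounded_biUnion hV).2 fun v _ =>
      hT.totallyBounded_mul_mul (hT.mul_right v) ((ρ⁻¹) ^ 2 * M)).subset ?_
    rintro _ ⟨L, hL2, hLV, rfl⟩
    rcases L with _ | ⟨v, L⟩
    · simp at hL2
    rcases L.eq_nil_or_concat with rfl | ⟨L', v', rfl⟩
    · simp at hL2
    refine mem_iUnion₂.2 ⟨v', hLV v' (by simp), (((ρ⁻¹ : ℝ) : ℂ) ^ 2) • (v * s L'), ?_, ?_⟩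
    · rw [mem_closedBall_zero_iff, norm_smul, norm_pow, Complex.norm_real,
        Real.norm_of_nonneg (by positivity)]
      have h1 := hsM L' fun u hu => hLV u (by simp [hu])
      have h2 := hV1 v (hLV v (by simp))
      gcongr
      refine (norm_mul_le _ _).trans ?_
      nlinarith [norm_nonneg v, norm_nonneg (s L')]
    · simp only [hs, List.concat_eq_append, List.length_cons, List.length_append,
        List.length_nil, wordProd_cons, wordProd_append, wordProd_nil, mul_one, mul_smul_comm,
        smul_mul_assoc, smul_smul, mul_assoc]
      congr 1
      ring
  have hQc : ∀ q ∈ Q, IsCompactOperator q := by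
    rintro _ ⟨L, hL2, hLV, rfl⟩
    rcases L with _ | ⟨v, L⟩
    · simp at hL2
    rw [hs]
    simp only [wordProd_cons, mul_assoc]
    exact (hT.mul_right _).smul _
  have hQq : ∀ q ∈ Q, IsQuasinilpotent q := by
    rintro _ ⟨L, hL2, hLV, rfl⟩
    refine (hq L ?_ fun v hv => hVG (hLV v hv)).smul _
    rintro rfl
    simp at hL2
  obtain ⟨C, hC, hQC⟩ := exists_norm_le_mul_norm_mul_one_sub hQ hQc hQq
  obtain ⟨N, hN⟩ := exists_lt_dist_lt_of_totallyBounded hQ (ε := (M * C)⁻¹) (by positivity)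
  obtain ⟨L, hL, hLV, hlow⟩ := hex (2 * (N + 1))
  have hlen : ∀ i ≤ N, (L.take (2 * (i + 1))).length = 2 * (i + 1) := fun i hi => by
    rw [List.length_take_of_le (by omega)]
  obtain ⟨i, j, hij, hj, hd⟩ := hN (fun i => s (L.take (2 * (i + 1)))) fun i hi =>
    ⟨_, by rw [hlen i hi]; omega, fun v hv => hLV v (List.mem_of_mem_take hv), rfl⟩
  have hsplit : L.take (2 * (j + 1)) =
      L.take (2 * (i + 1)) ++ (L.take (2 * (j + 1))).drop (2 * (i + 1)) := by
    conv_lhs => rw [← List.take_append_drop (2 * (i + 1)) (L.take (2 * (j + 1)))]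
    rw [List.take_take, min_eq_left (by omega)]
  set p := s (L.take (2 * (i + 1))) with hp
  set q := s ((L.take (2 * (j + 1))).drop (2 * (i + 1))) with hqdef
  have hqQ : q ∈ Q := ⟨_, by rw [List.length_drop, hlen j hj]; omega,
    fun v hv => hLV v (List.mem_of_mem_take (List.mem_of_mem_drop hv)), rfl⟩
  have h1 := hQC q hqQ p
  have h2 : dist p (p * q) < (M * C)⁻¹ := by
    rw [← hs_append, ← hsplit]
    exact hd
  rw [dist_eq_norm, ← mul_one_sub] at h2
  have h3 : 1 ≤ M * ‖p‖ := by
    have h4 := hlow (2 * (i + 1)) (by omega)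
    rw [hsn, hlen i (by omega)]
    calc (1 : ℝ) = ρ⁻¹ ^ (2 * (i + 1)) * ρ ^ (2 * (i + 1)) := by
          rw [← mul_pow, inv_mul_cancel₀ hρ.ne', one_pow]
      _ ≤ ρ⁻¹ ^ (2 * (i + 1)) * (M * ‖wordProd T (L.take (2 * (i + 1)))‖) := by gcongr
      _ = _ := by ring
  have h5 : M * ‖p‖ ≤ M * C * ‖p * (1 - q)‖ := by
    rw [mul_assoc]
    gcongr
  have h6 : M * C * ‖p * (1 - q)‖ < M * C * (M * C)⁻¹ := by gcongr
  rw [mul_inv_cancel₀ (by positivity)] at h6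
  linarith

end CompactWords

theorem IsQuasinilpotent.eq_of_mem_spectrum_smul {A : Type*} [NormedRing A] [NormedAlgebra ℂ A]
    {w : A} (hw : IsQuasinilpotent (w - 1)) {c x : ℂ} (hx : x ∈ spectrum ℂ (c • w)) : x = c := by
  by_contra h
  have h0 : x - c ≠ 0 := sub_ne_zero.2 h
  refine hx ?_
  have h1 : algebraMap ℂ A x - c • w = (x - c) • (1 + (-(c / (x - c))) • (w - 1)) := by
    rw [Algebra.algebraMap_eq_smul_one, smul_add, smul_smul, mul_neg, mul_div_cancel₀ _ h0]
    module
  rw [spectrum.mem_resolventSet_iff, h1]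
  exact (hw _).smul (Units.mk0 _ h0)

theorem continuous_wordProd {A : Type*} [NormedRing A] (L : List A) :
    Continuous fun T : A => wordProd T L := by
  induction L with
  | nil => exact continuous_const
  | cons v L ih => exact (continuous_id.mul continuous_const).mul ih

namespace IrreducibleJordanPair

variable {X : Type*} [NormedAddCommGroup X] [NormedSpace ℂ X] [CompleteSpace X]
  {J I : Submodule ℂ (X →L[ℂ] X)}

theorem twist_expUnit (h : IrreducibleJordanPair J I) {b : X →L[ℂ] X} (hb : b ∈ J) :
    Twist I (expUnit b) (expUnit (-b)) := by
  refine ⟨h.isCompactOperator _ (h.isJordanSubspace.exp_sub_one_mem h.isClosed hb),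
    h.isCompactOperator _ (h.isJordanSubspace.exp_sub_one_mem h.isClosed (neg_mem hb)),
    fun c hc => ?_, fun c hc => ?_⟩
  · rw [expUnit_inv, neg_neg]
    exact h.exp_mul_mul_exp_mem b hb c hc
  · rw [expUnit_inv]
    exact h.exp_mul_mul_exp_mem (-b) (neg_mem hb) c hc

theorem exists_twist_eq_one_add (h : IrreducibleJordanPair J I)
    (hI : IsClosed (I : Set (X →L[ℂ] X))) {c : X →L[ℂ] X} (hc : c ∈ I) :
    ∃ w w' : (X →L[ℂ] X)ˣ, (w : X →L[ℂ] X) = 1 + c ∧ Twist I w w' := by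
  have hIJ : IsJordanSubspace I := fun a ha b hb => h.add_mem a (h.le ha) b hb
  obtain ⟨d, hd, hcd, hdc⟩ := hIJ.exists_inverse_one_add hI hc (h.isQuasinilpotent c hc)
  have key : ∀ b ∈ I, ∀ a ∈ I, (1 + b) * a * (1 + b) ∈ I := fun b hb a ha => by
    have : (1 + b) * a * (1 + b) = a + (b * a + a * b) + b * a * b := by noncomm_ring
    rw [this]
    exact I.add_mem (I.add_mem ha (hIJ b hb a ha)) (hIJ.mul_mul_mem hb ha)
  refine ⟨⟨1 + c, 1 + d, hcd, hdc⟩, ⟨1 + d, 1 + c, hdc, hcd⟩, rfl, ?_, ?_, key c hc, key d hd⟩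
  · rw [add_sub_cancel_left]
    exact h.isCompactOperator c (h.le hc)
  · rw [add_sub_cancel_left]
    exact h.isCompactOperator d (h.le hd)

/-- The scalar multiples of the twists of `I`. -/
def twistLetters (I : Submodule ℂ (X →L[ℂ] X)) : Set (X →L[ℂ] X) :=
  {g | ∃ (z : ℂ) (w w' : (X →L[ℂ] X)ˣ), Twist I w w' ∧ g = z • (w : X →L[ℂ] X)}

theorem dense_span_twistLetters (h : IrreducibleJordanPair J I) {x : X} (hx : x ≠ 0) :
    (Submodule.span ℂ ((fun g : X →L[ℂ] X => g x) '' twistLetters I)).topologicalClosure = ⊤ := by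
  refine h.dense_span_apply ?_ ⟨1, ⟨1, 1, 1, Twist.one, by simp⟩, hx⟩
  rintro b hb _ ⟨z, w, w', hw, rfl⟩
  exact ⟨z, expUnit b * w, _, (h.twist_expUnit hb).mul hw, by
    rw [Units.val_mul, expUnit_val, mul_smul_comm]⟩

theorem exists_wordProd_eq_smul_twist (h : IrreducibleJordanPair J I)
    (hI : IsClosed (I : Set (X →L[ℂ] X))) {T : X →L[ℂ] X} (hT : T ∈ I) {L : List (X →L[ℂ] X)}
    (hL : ∀ v ∈ L, v ∈ twistLetters I) :
    ∃ c : ℂ, ∀ z : ℂ, z ≠ 0 → ∃ w w' : (X →L[ℂ] X)ˣ, Twist I w w' ∧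
      wordProd (z • 1 + T) L = (c * z ^ L.length) • (w : X →L[ℂ] X) := by
  induction L with
  | nil => exact ⟨1, fun z _ => ⟨1, 1, Twist.one, by simp⟩⟩
  | cons v L ih =>
    obtain ⟨c, hc⟩ := ih fun u hu => hL u (by simp [hu])
    obtain ⟨a, u, u', hu, rfl⟩ := hL v (by simp)
    refine ⟨a * c, fun z hz => ?_⟩
    obtain ⟨w, w', hw, hLw⟩ := hc z hz
    obtain ⟨t, t', ht, htt⟩ := h.exists_twist_eq_one_add hI (I.smul_mem z⁻¹ hT)
    refine ⟨t * u * w, _, (htt.mul hu).mul hw, ?_⟩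
    have h1 : z • 1 + T = z • (t : X →L[ℂ] X) := by
      rw [ht, smul_add, smul_smul, mul_inv_cancel₀ hz, one_smul]
    rw [wordProd_cons, hLw, h1, Units.val_mul, Units.val_mul, List.length_cons]
    simp only [smul_mul_assoc, mul_smul_comm, smul_smul]
    congr 1
    ring

theorem isQuasinilpotent_wordProd (h : IrreducibleJordanPair J I)
    (hI : IsClosed (I : Set (X →L[ℂ] X))) {T : X →L[ℂ] X} (hT : T ∈ I) {L : List (X →L[ℂ] X)}
    (hL0 : L ≠ []) (hL : ∀ v ∈ L, v ∈ twistLetters I) : IsQuasinilpotent (wordProd T L) := by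
  have hTc := h.isCompactOperator T (h.le hT)
  have hcount : (spectrum ℂ (wordProd T L)).Countable := by
    rcases L with _ | ⟨v, L⟩
    · exact absurd rfl hL0
    rw [wordProd_cons, mul_assoc]
    exact (hTc.mul_right _).countable_spectrum
  have hlim : Tendsto (fun z : ℂ => wordProd (z • 1 + T) L) (𝓝[≠] 0) (𝓝 (wordProd T L)) := by
    have h1 : Continuous fun z : ℂ => wordProd (z • 1 + T) L :=
      (continuous_wordProd L).comp (by fun_prop)
    have h2 := h1.tendsto 0
    rw [zero_smul, zero_add] at h2
    exact h2.mono_left nhdsWithin_le_nhds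
  obtain ⟨c, hc⟩ := h.exists_wordProd_eq_smul_twist hI hT hL
  refine isQuasinilpotent_of_tendsto' hlim hcount fun ε hε => ?_
  have hsmall : ∀ᶠ z : ℂ in 𝓝[≠] 0, ‖c * z ^ L.length‖ < ε := by
    have h1 : Continuous fun z : ℂ => ‖c * z ^ L.length‖ := by fun_prop
    have h2 := h1.tendsto 0
    rw [zero_pow (by simpa using hL0), mul_zero, norm_zero] at h2
    exact (h2.mono_left nhdsWithin_le_nhds).eventually (gt_mem_nhds hε)
  filter_upwards [hsmall, self_mem_nhdsWithin] with z hz hz0 x hx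
  obtain ⟨w, w', hw, hLw⟩ := hc z hz0
  rw [hLw] at hx
  rwa [(h.isQuasinilpotent_sub_one_of_twist hI h.eq_zero_of_finiteDimensional_range
    hw).eq_of_mem_spectrum_smul hx]

/-- The ideal of an irreducible pair cannot be closed. -/
theorem not_isClosed (h : IrreducibleJordanPair J I) : ¬ IsClosed (I : Set (X →L[ℂ] X)) := by
  intro hI
  obtain ⟨T, hT, hT0⟩ := I.ne_bot_iff.1 h.ne_bot
  have hn : ‖(((‖T‖⁻¹ : ℝ) : ℂ)) • T‖ = 1 := by
    rw [norm_smul, Complex.norm_real, norm_inv, norm_norm, inv_mul_cancel₀ (norm_ne_zero_iff.2 hT0)]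
  have hTI := I.smul_mem ((‖T‖⁻¹ : ℝ) : ℂ) hT
  obtain ⟨L, hL0, hL, hLq⟩ := (h.isCompactOperator _ (h.le hTI)).exists_not_isQuasinilpotent_wordProd
    hn (G := twistLetters I) (by
      rintro z _ ⟨a, w, w', hw, rfl⟩
      exact ⟨z * a, w, w', hw, by rw [smul_smul]⟩) fun x hx => h.dense_span_twistLetters hx
  exact hLq (h.isQuasinilpotent_wordProd hI hTI hL0 hL)

end IrreducibleJordanPair

end

/-- A Jordan algebra of compact operators with `T`-stable spectrum, for some nonzero
`T` in the algebra, is reducible. -/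
theorem jordan_algebra_stable_spectrum_reducible
    {X : Type*} [NormedAddCommGroup X] [NormedSpace ℂ X] [CompleteSpace X]
    (J : Submodule ℂ (X →L[ℂ] X))
    (hJordan : ∀ A ∈ J, ∀ B ∈ J, A * B + B * A ∈ J)
    (hcompact : ∀ A ∈ J, IsCompactOperator A)
    (T : X →L[ℂ] X) (hT : T ∈ J) (hT0 : T ≠ 0)
    (hstable : ∀ A ∈ J, ∀ lam : ℂ, spectralRadius ℂ (A + lam • T) ≤ spectralRadius ℂ A) :
    ∃ M : Submodule ℂ X, IsClosed (M : Set X) ∧ M ≠ ⊥ ∧ M ≠ ⊤ ∧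
      ∀ A ∈ J, ∀ x ∈ M, A x ∈ M := by
  by_contra! hirr
  obtain ⟨x, hx⟩ : ∃ x, T x ≠ 0 := by
    by_contra! h
    exact hT0 (ContinuousLinearMap.ext h)
  have hnontriv : Nontrivial X := ⟨T x, 0, hx⟩
  have hJ : IsJordanSubspace J := hJordan
  have hcl : IsClosed (J.topologicalClosure : Set (X →L[ℂ] X)) := J.isClosed_topologicalClosure
  have hJc : ∀ b ∈ J.topologicalClosure, IsCompactOperator b := fun b hb =>
    closure_minimal (t := {b : X →L[ℂ] X | IsCompactOperator b}) hcompact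
      isClosed_setOfPred_isCompactOperator hb
  have hcount : ∀ b ∈ J.topologicalClosure, ∀ a : X →L[ℂ] X, (spectrum ℂ (a * b)).Countable :=
    fun b hb a => ((hJc b hb).mul_left a).countable_spectrum
  have hI := isClosed_stableIdeal hcl hcount
  have hexp : ∀ b ∈ J.topologicalClosure, ∀ c ∈ stableIdeal J.topologicalClosure,
      NormedSpace.exp b * c * NormedSpace.exp b ∈ stableIdeal J.topologicalClosure := fun b hb c hc =>
    exp_mul_mul_exp_mem_stableIdeal hJ.topologicalClosure hcl hb hc
  have hTI : T ∈ stableIdeal J.topologicalClosure :=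
    mem_stableIdeal_topologicalClosure hT (fun a ha => hcount a (J.le_topologicalClosure ha)) hstable
  have hpair : IrreducibleJordanPair J.topologicalClosure (stableIdeal J.topologicalClosure) :=
    { isJordanSubspace := hJ.topologicalClosure
      isClosed := hcl
      isCompactOperator := hJc
      irreducible := fun M hM hinv => by
        by_contra! h
        obtain ⟨A, hA, x, hx, hAx⟩ := hirr M hM h.1 h.2
        exact hAx (hinv A (J.le_topologicalClosure hA) x hx)
      le := stableIdeal_le _
      add_mem := fun b hb c hc => add_mem_of_exp_mul_mul_exp_mem hI fun z =>
        hexp _ (Submodule.smul_mem _ z hb) c hc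
      exp_mul_mul_exp_mem := hexp
      isQuasinilpotent := fun c hc => isQuasinilpotent_of_mem_stableIdeal hc
      ne_bot := (Submodule.ne_bot_iff _).2 ⟨T, hTI, hT0⟩ }
  exact hpair.not_isClosed hI
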